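/- Let k ≥ 2 and n ∈ ℕ with 2n ≥ k² + 3, let N ∈ ℕ and v_0 ∈ ℤ^{2n} with gcd(v_0, N) = 1, and let δ_0 ∈ (0,1) be as in the generic counting theorem. For every δ ∈ (δ_0, 1) and every collection of bounded intervals (a_{ij}, b_{ij}) ⊆ ℝ (1 ≤ i < j ≤ k), for Haar-almost every g ∈ SL_{2n}(ℝ) the following holds: there exist a constant c_g > 0 depending only on g, n and k (the same constant as in the non-congruence generic counting theorem) and constants C, T_0 > 0 such that for all T > T_0, |N_{g,I,v_0,N}(T) − (c_g/N^{2nk}) · ∏_{1≤i<j≤k}(b_{ij} − a_{ij}) · T^{2nk − k(k−1)}| ≤ C · T^{δ(2nk − k(k−1))}, where N_{g,I,v_0,N}(T) = #{(v_1, …, v_k) ∈ (v_0 + Nℤ^{2n})^k : ⟨v_i, v_j⟩^g ∈ (a_{ij}, b_{ij}) for all 1 ≤ i < j ≤ k, and ‖v_ℓ‖ < T for all 1 ≤ ℓ ≤ k}. -/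

import Mathlib

open Matrix MeasureTheory

noncomputable section

abbrev Pairs (k : ℕ) := {p : Fin k × Fin k // p.1 < p.2}

/-- The standard symplectic matrix `J_n` with block form `(0 Iₙ; -Iₙ 0)`. -/
def Jmat (n : ℕ) : Matrix (Fin (2*n)) (Fin (2*n)) ℝ :=
  fun i j => if (i : ℕ) + n = (j : ℕ) then 1 else if (j : ℕ) + n = (i : ℕ) then -1 else 0

/-- The standard symplectic form `⟨v,w⟩ = vᵀ Jₙ w` on `ℝ^{2n}`. -/
def symp (n : ℕ) (v w : Fin (2*n) → ℝ) : ℝ := v ⬝ᵥ (Jmat n).mulVec w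

abbrev SL2n (n : ℕ) := Matrix.SpecialLinearGroup (Fin (2*n)) ℝ

/-- The symplectic form `⟨v,w⟩^g = ⟨g v, g w⟩` attached to `g ∈ SL_{2n}(ℝ)`. -/
def sympG (n : ℕ) (g : SL2n n) (v w : Fin (2*n) → ℝ) : ℝ :=
  symp n ((g : Matrix (Fin (2*n)) (Fin (2*n)) ℝ).mulVec v)
         ((g : Matrix (Fin (2*n)) (Fin (2*n)) ℝ).mulVec w)

/-- Euclidean norm on `ℝ^d` (presented as `Fin d → ℝ`). -/
def enorm2 {d : ℕ} (v : Fin d → ℝ) : ℝ := Real.sqrt (∑ i, (v i)^2)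

instance (m : ℕ) : MeasurableSpace (Matrix (Fin m) (Fin m) ℝ) := MeasurableSpace.pi

noncomputable instance (m : ℕ) : TopologicalSpace (Matrix.SpecialLinearGroup (Fin m) ℝ) :=
  instTopologicalSpaceSubtype

instance (m : ℕ) : MeasurableSpace (Matrix.SpecialLinearGroup (Fin m) ℝ) :=
  Subtype.instMeasurableSpace

/-- The exponent `2nk - k(k-1)` as a real number. -/
def expo (n k : ℕ) : ℝ := ((2*n*k : ℕ) : ℝ) - ((k*(k-1) : ℕ) : ℝ)

/-- The counting function `N_{g,I}(T)`: the number of integer tuples `(v_1,…,v_k)`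
with `⟨v_i,v_j⟩^g ∈ (a_{ij},b_{ij})` for `i < j` and `‖v_ℓ‖ < T`. -/
def Ncount (n k : ℕ) (g : SL2n n) (a b : Pairs k → ℝ) (T : ℝ) : ℕ :=
  Nat.card {v : Fin k → (Fin (2*n) → ℤ) |
    (∀ p : Pairs k, sympG n g (fun j => ((v p.1.1 j : ℤ) : ℝ))
        (fun j => ((v p.1.2 j : ℤ) : ℝ)) ∈ Set.Ioo (a p) (b p)) ∧
    ∀ l, enorm2 (fun j => ((v l j : ℤ) : ℝ)) < T}

/-- The congruence counting function `N_{g,I,v₀,N}(T)`: the number of integer tuples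
`(v_1,…,v_k)` with `v_ℓ ≡ v₀ mod N`, `⟨v_i,v_j⟩^g ∈ (a_{ij},b_{ij})` for `i < j`, and
`‖v_ℓ‖ < T`. -/
def NcountCong (n k : ℕ) (N : ℕ) (v₀ : Fin (2*n) → ℤ) (g : SL2n n)
    (a b : Pairs k → ℝ) (T : ℝ) : ℕ :=
  Nat.card {v : Fin k → (Fin (2*n) → ℤ) |
    (∀ l j, (N : ℤ) ∣ (v l j - v₀ j)) ∧
    (∀ p : Pairs k, sympG n g (fun j => ((v p.1.1 j : ℤ) : ℝ))
        (fun j => ((v p.1.2 j : ℤ) : ℝ)) ∈ Set.Ioo (a p) (b p)) ∧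
    ∀ l, enorm2 (fun j => ((v l j : ℤ) : ℝ)) < T}

/-- Theorem 1.5 (congruence generic counting): with `δ₀` and the constant `c_g` as in the
generic counting theorem (formalized by requiring both asymptotics to hold simultaneously
with the same `δ₀` and `c_g`), for `N ∈ ℕ` and `v₀ ∈ ℤ^{2n}` with `gcd(v₀,N) = 1`,
for Haar-almost every `g`,
`N_{g,I,v₀,N}(T) = (c_g/N^{2nk}) ∏(b_{ij}-a_{ij}) T^{2nk-k(k-1)} + O(T^{δ(2nk-k(k-1))})`. -/

theorem tri_fin : ∀ (n : ℕ) (S : Set (Fin n → ℝ)) (h : Fin n → ℝ), MeasurableSet S →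
    (∀ s, ∀ x ∈ S, ∀ y ∈ S, (∀ t < s, x t = y t) → |x s - y s| ≤ h s) →
    volume S ≤ ∏ s, ENNReal.ofReal (h s) := by
  intro n
  induction n with
  | zero =>
    intro S h hS H
    simp only [Finset.univ_eq_empty, Finset.prod_empty]
    rw [volume_pi, Measure.pi_of_empty]
    exact prob_le_one
  | succ n ih =>
    intro S h hS H
    set e := MeasurableEquiv.piFinSuccAbove (fun _ : Fin (n+1) => ℝ) 0 with he
    have hmp := volume_preserving_piFinSuccAbove (fun _ : Fin (n+1) => ℝ) 0
    have h1 : volume S = volume (e.symm ⁻¹' S) := by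
      rw [(hmp.symm e).measure_preimage hS.nullMeasurableSet]
    have hm : MeasurableSet (e.symm ⁻¹' S) := e.symm.measurable hS
    have hsymm : ∀ a b, e.symm (a, b) = Fin.cons a b := by
      intro a b
      simp [he, MeasurableEquiv.piFinSuccAbove, Fin.insertNthEquiv]
    rw [h1, Measure.volume_eq_prod, Measure.prod_apply hm, Fin.prod_univ_succ]
    set P : Set ℝ := {a | ∃ b, e.symm (a, b) ∈ S} with hP
    have hPd : volume P ≤ ENNReal.ofReal (h 0) := by
      refine (Real.volume_le_diam P).trans ?_
      refine Metric.ediam_le ?_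
      rintro a ⟨b, hb⟩ a' ⟨b', hb'⟩
      rw [edist_dist, Real.dist_eq]
      apply ENNReal.ofReal_le_ofReal
      have := H 0 _ hb _ hb' (by intro t ht; exact absurd ht (Fin.not_lt_zero t))
      simpa [hsymm] using this
    calc ∫⁻ a, volume (Prod.mk a ⁻¹' (e.symm ⁻¹' S))
        ≤ ∫⁻ a, P.indicator (fun _ => ∏ s : Fin n, ENNReal.ofReal (h s.succ)) a := by
          apply lintegral_mono
          intro a
          by_cases ha : a ∈ P
          · simp only [Set.indicator_of_mem ha]
            apply ih _ _ (measurable_prodMk_left hm)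
            intro s x hx y hy hxy
            have := H s.succ _ hx _ hy (by
              intro t ht
              rw [hsymm, hsymm]
              refine Fin.cases ?_ ?_ t ht
              · simp
              · intro t ht
                simpa using hxy t (by simpa using ht))
            simpa [hsymm] using this
          · show volume (Prod.mk a ⁻¹' (e.symm ⁻¹' S)) ≤ _
            have : Prod.mk a ⁻¹' (e.symm ⁻¹' S) = ∅ := by
              ext b
              simp only [Set.mem_preimage, Set.mem_empty_iff_false, iff_false]
              exact fun hb => ha ⟨b, hb⟩
            rw [this]; simp
      _ ≤ (∏ s : Fin n, ENNReal.ofReal (h s.succ)) * volume P := lintegral_indicator_const_le _ _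
      _ ≤ _ := by rw [mul_comm]; gcongr

theorem tri_gen {ι : Type} [Fintype ι] (key : ι → ℕ) (hk : Function.Injective key)
    (S : Set (ι → ℝ)) (h : ι → ℝ) (hS : MeasurableSet S)
    (H : ∀ s, ∀ x ∈ S, ∀ y ∈ S, (∀ t, key t < key s → x t = y t) → |x s - y s| ≤ h s) :
    volume S ≤ ∏ s, ENNReal.ofReal (h s) := by
  classical
  let _ : LinearOrder ι := LinearOrder.lift' key hk
  let o : Fin (Fintype.card ι) ≃o ι := monoEquivOfFin ι rfl
  let e : Fin (Fintype.card ι) ≃ ι := o.toEquiv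
  have hmp := volume_measurePreserving_piCongrLeft (fun _ : ι => ℝ) e
  have happ : ∀ f s, (MeasurableEquiv.piCongrLeft (fun _ : ι => ℝ) e) f (e s) = f s := by
    intro f s
    exact Equiv.piCongrLeft_apply_apply (fun _ : ι => ℝ) e f s
  rw [← hmp.measure_preimage hS.nullMeasurableSet, ← Equiv.prod_comp e]
  apply tri_fin _ _ _ (hmp.measurable hS)
  intro s x hx y hy hxy
  have := H (e s) _ hx _ hy (by
    intro t ht
    obtain ⟨t, rfl⟩ := e.surjective t
    rw [happ, happ]
    apply hxy
    have : o t < o s := ht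
    simpa using this)
  simpa [happ] using this

abbrev EE (d : ℕ) := EuclideanSpace ℝ (Fin d)
abbrev MM (d : ℕ) := EuclideanSpace ℝ (Fin d × Fin d)

def tens {d : ℕ} (u w : EE d) : MM d := WithLp.toLp 2 (fun p => u p.1 * w p.2)

theorem inner_tens {d : ℕ} (u w u' w' : EE d) :
    inner ℝ (tens u w) (tens u' w') = inner ℝ u u' * inner ℝ w w' := by
  simp only [tens, PiLp.inner_apply, Fintype.sum_prod_type, Finset.sum_mul_sum]
  refine Finset.sum_congr rfl fun i _ => Finset.sum_congr rfl fun j _ => ?_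
  simp; ring

def AX {d : ℕ} (X : MM d) (u w : EE d) : ℝ := inner ℝ X (tens u w - tens w u)

theorem tens_orth {d : ℕ} (b : OrthonormalBasis (Fin d) ℝ (EE d)) :
    Orthonormal ℝ (fun p : Fin d × Fin d => tens (b p.1) (b p.2)) := by
  rw [orthonormal_iff_ite]
  rintro ⟨p, q⟩ ⟨p', q'⟩
  rw [inner_tens, orthonormal_iff_ite.mp b.orthonormal, orthonormal_iff_ite.mp b.orthonormal]
  simp only [Prod.mk.injEq]
  split_ifs <;> simp_all

theorem exists_tbasis {d : ℕ} (b : OrthonormalBasis (Fin d) ℝ (EE d)) :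
    ∃ B : OrthonormalBasis (Fin d × Fin d) ℝ (MM d), ∀ p, B p = tens (b p.1) (b p.2) := by
  have h := tens_orth b
  refine ⟨OrthonormalBasis.mk h ?_, fun p => congrFun (OrthonormalBasis.coe_mk h _) p⟩
  rw [LinearIndependent.span_eq_top_of_card_eq_finrank' h.linearIndependent (by simp)]

def rdist {d m : ℕ} (z : Fin m → EE d) (i : Fin m) : ℝ :=
  Metric.infDist (z i) (Submodule.span ℝ (z '' Set.Iio i) : Set (EE d))

theorem gs_basis0 {d : ℕ} (f : Fin d → EE d) :
    ∃ b : OrthonormalBasis (Fin d) ℝ (EE d),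
      (∀ i p : Fin d, i < p → inner ℝ (b p) (f i) = 0) ∧
      (∀ i, rdist f i ≤ |inner ℝ (b i) (f i)|) := by
  have hc : Module.finrank ℝ (EE d) = Fintype.card (Fin d) := by simp
  refine ⟨InnerProductSpace.gramSchmidtOrthonormalBasis hc f, fun i p h =>
    InnerProductSpace.gramSchmidtOrthonormalBasis_inv_triangular hc f h, fun i => ?_⟩
  set g := InnerProductSpace.gramSchmidt ℝ f with hg
  have h1 := InnerProductSpace.gramSchmidt_def'' ℝ f i
  rw [← hg] at h1
  set w := ∑ j ∈ Finset.Iio i, (inner ℝ (g j) (f i) / (‖g j‖ : ℝ) ^ 2) • g j with hw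
  have h1 : f i = g i + w := h1
  have hwm : w ∈ Submodule.span ℝ (f '' Set.Iio i) := by
    rw [← InnerProductSpace.span_gramSchmidt_Iio ℝ f i]
    refine Submodule.sum_mem _ fun j hj => Submodule.smul_mem _ _ (Submodule.subset_span ⟨j, ?_, rfl⟩)
    simpa using hj
  have hgw : inner ℝ (g i) w = 0 := by
    rw [hw, inner_sum]
    refine Finset.sum_eq_zero fun j hj => ?_
    rw [inner_smul_right, hg, InnerProductSpace.gramSchmidt_orthogonal ℝ f
      (Finset.mem_Iio.mp hj).ne', mul_zero]
  have h2 : rdist f i ≤ ‖g i‖ := by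
    refine (Metric.infDist_le_dist_of_mem hwm).trans ?_
    rw [dist_eq_norm, h1]; simp
  by_cases h0 : g i = 0
  · refine h2.trans ?_
    rw [h0]; simp
  · have h3 : InnerProductSpace.gramSchmidtNormed ℝ f i ≠ 0 := by
      simp only [InnerProductSpace.gramSchmidtNormed, ← hg]
      simpa using h0
    rw [InnerProductSpace.gramSchmidtOrthonormalBasis_apply hc h3]
    refine h2.trans (le_of_eq ?_)
    simp only [InnerProductSpace.gramSchmidtNormed, ← hg]
    rw [inner_smul_left, h1, inner_add_right, hgw, real_inner_self_eq_norm_sq]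
    have : ‖g i‖ ≠ 0 := by simpa using h0
    simp
    field_simp

theorem gs_basis {d m : ℕ} (hm : m ≤ d) (z : Fin m → EE d) :
    ∃ b : OrthonormalBasis (Fin d) ℝ (EE d),
      (∀ (i : Fin m) (p : Fin d), (i : ℕ) < p → inner ℝ (b p) (z i) = 0) ∧
      (∀ i, rdist z i ≤ |inner ℝ (b (Fin.castLE hm i)) (z i)|) := by
  let f : Fin d → EE d := fun p => if h : (p : ℕ) < m then z ⟨p, h⟩ else 0
  have hf : ∀ i : Fin m, f (Fin.castLE hm i) = z i := by
    intro i; simp [f]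
  obtain ⟨b, h1, h2⟩ := gs_basis0 f
  refine ⟨b, fun i p h => ?_, fun i => ?_⟩
  · rw [← hf]; exact h1 _ _ h
  · have := h2 (Fin.castLE hm i)
    rw [hf] at this
    refine le_trans (le_of_eq ?_) this
    unfold rdist
    rw [hf]
    congr 3
    ext x
    constructor
    · rintro ⟨j, hj, rfl⟩
      exact ⟨Fin.castLE hm j, by simpa using hj, hf j⟩
    · rintro ⟨j, hj, rfl⟩
      have hj' : (j : ℕ) < i := hj
      refine ⟨⟨j, hj'.trans i.2⟩, hj', ?_⟩
      simp [f, hj'.trans i.2]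

theorem vol_coords {d : ℕ} {ι : Type} [Fintype ι] {V : Type} [NormedAddCommGroup V]
    [InnerProductSpace ℝ V] [FiniteDimensional ℝ V] [MeasurableSpace V] [BorelSpace V]
    (B : OrthonormalBasis ι ℝ V) (key : ι → ℕ) (hk : Function.Injective key)
    (S : Set V) (h : ι → ℝ) (hS : MeasurableSet S)
    (H : ∀ s, ∀ x ∈ S, ∀ y ∈ S, (∀ t, key t < key s → inner ℝ (B t) x = inner ℝ (B t) y) →
      |inner ℝ (B s) x - inner ℝ (B s) y| ≤ h s) :
    volume S ≤ ∏ s, ENNReal.ofReal (h s) := by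
  have hmp : MeasurePreserving (fun c : ι → ℝ => B.repr.symm (WithLp.toLp 2 c)) volume volume :=
    (B.measurePreserving_repr_symm).comp (PiLp.volume_preserving_toLp ι)
  rw [← hmp.measure_preimage hS.nullMeasurableSet]
  have hc : ∀ (c : ι → ℝ) s, inner ℝ (B s) (B.repr.symm (WithLp.toLp 2 c)) = c s := by
    intro c s
    rw [← OrthonormalBasis.repr_apply_apply]; simp
  apply tri_gen key hk _ _ (hmp.measurable hS)
  intro s x hx y hy hxy
  have := H s _ hx _ hy (by intro t ht; rw [hc, hc]; exact hxy t ht)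
  rwa [hc, hc] at this

theorem tube_vol {d l : ℕ} (hl : l ≤ d) (z : Fin l → EE d) (C0 ρ : ℝ) (hρ : 0 ≤ ρ) :
    volume {x : EE d | ‖x‖ ≤ C0 ∧
      Metric.infDist x (Submodule.span ℝ (Set.range z) : Set (EE d)) ≤ ρ}
      ≤ ENNReal.ofReal (2 * C0) ^ l * ENNReal.ofReal (2 * ρ) ^ (d - l) := by
  obtain ⟨b, h1, -⟩ := gs_basis hl z
  have hm : MeasurableSet {x : EE d | ‖x‖ ≤ C0 ∧
      Metric.infDist x (Submodule.span ℝ (Set.range z) : Set (EE d)) ≤ ρ} := by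
    apply IsClosed.measurableSet
    exact (isClosed_le continuous_norm continuous_const).inter
      (isClosed_le (Metric.continuous_infDist_pt _) continuous_const)
  have key := vol_coords (d := d) b (fun i => (i : ℕ)) Fin.val_injective _
    (fun p => if (p : ℕ) < l then 2 * C0 else 2 * ρ) hm (by
      intro s x hx y hy _
      have hb : ‖b s‖ = 1 := b.orthonormal.1 s
      by_cases hs : (s : ℕ) < l
      · simp only [hs, if_true]
        have e1 := abs_real_inner_le_norm (b s) x
        have e2 := abs_real_inner_le_norm (b s) y
        rw [hb, one_mul] at e1 e2
        have := hx.1; have := hy.1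
        calc _ ≤ |inner ℝ (b s) x| + |inner ℝ (b s) y| := abs_sub _ _
          _ ≤ _ := by linarith
      · simp only [hs, if_false]
        have hW : ∀ w ∈ Submodule.span ℝ (Set.range z), inner ℝ (b s) w = 0 := by
          intro w hw
          induction hw using Submodule.span_induction with
          | mem x hx =>
            obtain ⟨i, rfl⟩ := hx
            exact h1 i s (lt_of_lt_of_le i.2 (not_lt.mp hs))
          | zero => simp
          | add x y _ _ hx hy => rw [inner_add_right, hx, hy, add_zero]
          | smul a x _ hx => rw [inner_smul_right, hx, mul_zero]
        have hin : ∀ x : EE d, |inner ℝ (b s) x| ≤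
            Metric.infDist x (Submodule.span ℝ (Set.range z) : Set (EE d)) := by
          intro x
          refine (Metric.le_infDist ⟨0, Submodule.zero_mem _⟩).mpr ?_
          intro w hw
          have : inner ℝ (b s) x = inner ℝ (b s) (x - w) := by
            rw [inner_sub_right, hW w hw, sub_zero]
          rw [this, dist_eq_norm]
          have := abs_real_inner_le_norm (b s) (x - w)
          rwa [hb, one_mul] at this
        calc _ ≤ |inner ℝ (b s) x| + |inner ℝ (b s) y| := abs_sub _ _
          _ ≤ _ := by linarith [hin x, hin y, hx.2, hy.2])
  refine key.trans (le_of_eq ?_)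
  have : ∀ p : Fin d, ENNReal.ofReal (if (p : ℕ) < l then 2 * C0 else 2 * ρ) =
      if (p : ℕ) < l then ENNReal.ofReal (2 * C0) else ENNReal.ofReal (2 * ρ) := by
    intro p; split_ifs <;> rfl
  simp_rw [this]
  rw [Finset.prod_ite, Finset.prod_const, Finset.prod_const]
  have e1 : (Finset.univ.filter fun p : Fin d => (p : ℕ) < l).card = l := by
    rw [Fin.card_filter_val_lt]; omega
  have e2 : (Finset.univ.filter fun p : Fin d => ¬ (p : ℕ) < l).card = d - l := by
    have := Finset.card_filter_add_card_filter_not (s := (Finset.univ : Finset (Fin d)))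
      (fun p : Fin d => (p : ℕ) < l)
    simp only [Finset.card_univ, Fintype.card_fin] at this
    omega
  rw [e1, e2]

def keyf (d : ℕ) (p : Fin d × Fin d) : ℕ :=
  if (p.1 : ℕ) < p.2 then d * d + (p.2 * d + p.1) else p.2 * d + p.1

theorem lin_inj {d a b a' b' : ℕ} (hb : b < d) (hb' : b' < d) (h : a * d + b = a' * d + b') :
    a = a' ∧ b = b' := by
  have hd : 0 < d := by omega
  have h1 : (a * d + b) / d = a := by
    rw [mul_comm, Nat.mul_add_div hd, Nat.div_eq_of_lt hb, add_zero]
  have h2 : (a' * d + b') / d = a' := by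
    rw [mul_comm, Nat.mul_add_div hd, Nat.div_eq_of_lt hb', add_zero]
  have : a = a' := by rw [← h1, ← h2, h]
  subst this
  exact ⟨rfl, by omega⟩

theorem lin_lt {d a b a' b' : ℕ} (hb : b < d) (h : a < a') :
    a * d + b < a' * d + b' := by
  have : (a + 1) * d ≤ a' * d := Nat.mul_le_mul_right _ h
  rw [add_mul, one_mul] at this
  omega

theorem keyf_inj (d : ℕ) : Function.Injective (keyf d) := by
  rintro ⟨p, q⟩ ⟨p', q'⟩ h
  simp only [keyf] at h
  have hq : (q : ℕ) * d + p < d * d + 0 := lin_lt p.2 q.2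
  have hq' : (q' : ℕ) * d + p' < d * d + 0 := lin_lt p'.2 q'.2
  have : (q : ℕ) * d + p = q' * d + p' := by
    split_ifs at h <;> omega
  obtain ⟨h1, h2⟩ := lin_inj p.2 p'.2 this
  ext <;> simp [h1, h2]

theorem vol_A4 {d m : ℕ} (hm : m ≤ d) (z : Fin m → EE d) (R : ℝ) (hR : 1 ≤ 2 * R)
    (S : Set (MM d)) (hS : MeasurableSet S) (hSR : ∀ X ∈ S, ‖X‖ ≤ R)
    (g : Fin m → Fin m → ℝ)
    (hg : ∀ i j, i < j → (0 < rdist z i * rdist z j ∧ ∀ X ∈ S, ∀ Y ∈ S,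
      |AX X (z i) (z j) - AX Y (z i) (z j)| ≤ g i j * (rdist z i * rdist z j)) ∨
      2 * R ≤ g i j) :
    volume S ≤ ENNReal.ofReal (2 * R) ^ (d * d) *
      ∏ x : Fin m × Fin m, (if x.1 < x.2 then ENNReal.ofReal (g x.1 x.2) else 1) := by
  obtain ⟨b, h1, h2⟩ := gs_basis hm z
  obtain ⟨B, hB⟩ := exists_tbasis b
  let F : Fin d × Fin d → ℝ := fun p =>
    if hp : (p.1 : ℕ) < p.2 ∧ (p.2 : ℕ) < m then g ⟨p.1, by omega⟩ ⟨p.2, hp.2⟩ else 2 * R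
  have key := vol_coords (d := d) B (keyf d) (keyf_inj d) S F hS (by
    rintro ⟨p, q⟩ X hX Y hY hXY
    have htriv : |inner ℝ (B (p, q)) X - inner ℝ (B (p, q)) Y| ≤ 2 * R := by
      have hb : ‖B (p, q)‖ = 1 := B.orthonormal.1 _
      have e1 := abs_real_inner_le_norm (B (p, q)) X
      have e2 := abs_real_inner_le_norm (B (p, q)) Y
      rw [hb, one_mul] at e1 e2
      have := hSR X hX; have := hSR Y hY
      calc _ ≤ |inner ℝ (B (p, q)) X| + |inner ℝ (B (p, q)) Y| := abs_sub _ _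
        _ ≤ _ := by linarith
    by_cases hp : (p : ℕ) < q ∧ (q : ℕ) < m
    swap
    · simp only [F, hp, dif_neg, not_false_eq_true]; exact htriv
    simp only [F, hp, and_self, dif_pos]
    set i : Fin m := ⟨p, by omega⟩ with hi
    set j : Fin m := ⟨q, hp.2⟩ with hj
    have hij : i < j := hp.1
    rcases hg i j hij with ⟨hr, hle⟩ | hle
    swap
    · exact htriv.trans hle
    have hpi : Fin.castLE hm i = p := by ext; simp [hi]
    have hqj : Fin.castLE hm j = q := by ext; simp [hj]
    have hexp : ∀ X : MM d, AX X (z i) (z j) = ∑ t, inner ℝ (B t) X *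
        inner ℝ (B t) (tens (z i) (z j) - tens (z j) (z i)) := by
      intro X
      rw [AX, ← B.sum_inner_mul_inner]
      refine Finset.sum_congr rfl fun t _ => ?_
      rw [real_inner_comm]
    have hcoef : ∀ t : Fin d × Fin d, inner ℝ (B t) (tens (z i) (z j) - tens (z j) (z i)) =
        inner ℝ (b t.1) (z i) * inner ℝ (b t.2) (z j) -
        inner ℝ (b t.1) (z j) * inner ℝ (b t.2) (z i) := by
      intro t
      rw [inner_sub_right, hB, inner_tens, inner_tens]
    have hq0 : inner ℝ (b q) (z i) = 0 := h1 i q hp.1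
    have hdiff : AX X (z i) (z j) - AX Y (z i) (z j) =
        (inner ℝ (B (p, q)) X - inner ℝ (B (p, q)) Y) *
          (inner ℝ (b p) (z i) * inner ℝ (b q) (z j)) := by
      rw [hexp, hexp, ← Finset.sum_sub_distrib]
      rw [Finset.sum_eq_single (p, q)]
      · rw [hcoef]; simp only [hq0]; ring
      · rintro ⟨p', q'⟩ - hne
        rcases lt_trichotomy (keyf d (p', q')) (keyf d (p, q)) with hlt | heq | hgt
        · rw [hXY _ hlt]; ring
        · exact absurd (keyf_inj d heq) hne
        · have hz : inner ℝ (B (p', q')) (tens (z i) (z j) - tens (z j) (z i)) = 0 := by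
            rw [hcoef]
            simp only [keyf, hp.1, if_true] at hgt
            have hq1 : (q' : ℕ) * d + p' < d * d + 0 := lin_lt p'.2 q'.2
            have hpq' : (p' : ℕ) < q' := by
              by_contra hc
              simp only [hc, if_false] at hgt
              omega
            simp only [hpq', if_true] at hgt
            rcases lt_trichotomy (q' : ℕ) q with hl | he | hl
            · have := lin_lt (b' := p) p'.2 hl
              omega
            · have hqq : q' = q := Fin.ext he
              subst hqq
              have hpp : (p : ℕ) < p' := by omega
              rw [h1 i p' hpp]
              simp only [hq0]; ring
            · rw [h1 j q' hl, h1 i q' (by have := hp.1; simp only [hi]; omega)]; ring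
          rw [hz]; ring
      · simp
    have h3 := hle X hX Y hY
    rw [hdiff, abs_mul, abs_mul] at h3
    have e1 := h2 i; have e2 := h2 j
    rw [hpi] at e1; rw [hqj] at e2
    have r1 : 0 ≤ rdist z i := Metric.infDist_nonneg
    have r2 : 0 ≤ rdist z j := Metric.infDist_nonneg
    have h4 : |inner ℝ (B (p, q)) X - inner ℝ (B (p, q)) Y| * (rdist z i * rdist z j) ≤
        g i j * (rdist z i * rdist z j) := by
      refine le_trans ?_ h3
      gcongr
    exact le_of_mul_le_mul_right h4 hr)
  refine key.trans ?_
  let F' : Fin d × Fin d → ENNReal := fun p =>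
    if hp : (p.1 : ℕ) < p.2 ∧ (p.2 : ℕ) < m then ENNReal.ofReal (g ⟨p.1, by omega⟩ ⟨p.2, hp.2⟩)
    else 1
  have h2R : (1 : ENNReal) ≤ ENNReal.ofReal (2 * R) := by
    rw [← ENNReal.ofReal_one]; exact ENNReal.ofReal_le_ofReal hR
  calc ∏ s, ENNReal.ofReal (F s) ≤ ∏ s, (ENNReal.ofReal (2 * R) * F' s) := by
        refine Finset.prod_le_prod' fun s _ => ?_
        simp only [F, F']
        split_ifs
        · exact le_mul_of_one_le_left zero_le h2R
        · simp
    _ = ENNReal.ofReal (2 * R) ^ (d * d) * ∏ s, F' s := by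
        rw [Finset.prod_mul_distrib]; simp
    _ = _ := by
        congr 1
        symm
        apply Fintype.prod_of_injective (fun x : Fin m × Fin m => (Fin.castLE hm x.1, Fin.castLE hm x.2))
        · rintro ⟨a, b⟩ ⟨a', b'⟩ hab
          simpa using hab
        · rintro ⟨a, b⟩ hab
          simp only [F']
          rw [dif_neg]
          rintro ⟨h1, h2⟩
          exact hab ⟨(⟨a, by omega⟩, ⟨b, h2⟩), by simp⟩
        · rintro ⟨a, b⟩
          simp only [F']
          by_cases hab : a < b
          · have : (a : ℕ) < b := hab
            simp [hab]
          · have : ¬ (a : ℕ) < b := hab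
            simp [hab]

abbrev II (k : ℕ) := Fin k ⊕ Fin k
abbrev JJ (k : ℕ) := Pairs k ⊕ Pairs k
def e1 {k : ℕ} : JJ k → II k := Sum.map (fun p => p.1.1) (fun p => p.1.1)
def e2 {k : ℕ} : JJ k → II k := Sum.map (fun p => p.1.2) (fun p => p.1.2)

def WIN {d k : ℕ} (L U : JJ k → ℝ) (X : MM d) (Z : II k → EE d) : Prop :=
  ∀ p, AX X (Z (e1 p)) (Z (e2 p)) ∈ Set.Ioo (L p) (U p)

theorem AX_antisymm {d : ℕ} (X : MM d) (u w : EE d) : AX X u w = - AX X w u := by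
  rw [AX, AX, ← inner_neg_right, neg_sub]

theorem continuous_tens {d : ℕ} : Continuous (fun p : EE d × EE d => tens p.1 p.2) := by
  unfold tens
  apply (PiLp.continuous_toLp 2 _).comp
  fun_prop

theorem continuous_AX {d : ℕ} : Continuous (fun p : MM d × EE d × EE d => AX p.1 p.2.1 p.2.2) := by
  unfold AX
  apply Continuous.inner
  · fun_prop
  · apply Continuous.sub
    · exact continuous_tens.comp (by fun_prop : Continuous fun p : MM d × EE d × EE d => (p.2.1, p.2.2))
    · exact continuous_tens.comp (by fun_prop : Continuous fun p : MM d × EE d × EE d => (p.2.2, p.2.1))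

theorem isOpen_WIN {d k : ℕ} (L U : JJ k → ℝ) :
    IsOpen {p : MM d × (II k → EE d) | WIN L U p.1 p.2} := by
  simp only [WIN, Set.ofPred_forall]
  apply isOpen_iInter_of_finite
  intro p
  have : Continuous fun q : MM d × (II k → EE d) => AX q.1 (q.2 (e1 p)) (q.2 (e2 p)) :=
    continuous_AX.comp (by fun_prop : Continuous fun q : MM d × (II k → EE d) =>
      (q.1, q.2 (e1 p), q.2 (e2 p)))
  exact isOpen_Ioo.preimage this

theorem meas_WIN {d k : ℕ} (L U : JJ k → ℝ) (Z : II k → EE d) :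
    MeasurableSet {X : MM d | WIN L U X Z} := by
  have := (isOpen_WIN (d := d) L U).preimage (by fun_prop : Continuous fun X : MM d => (X, Z))
  exact this.measurableSet

/-- reorder -/
theorem prod_reorder {I : Type} [Fintype I] [DecidableEq I] {M : Type} [CommMonoid M]
    (κ κ' : I → ℕ) (h : Function.Injective κ) (h' : Function.Injective κ')
    (f : I → I → M) (hf : ∀ a b, f a b = f b a) :
    ∏ x : I × I, (if κ x.1 < κ x.2 then f x.1 x.2 else 1) =
    ∏ x : I × I, (if κ' x.1 < κ' x.2 then f x.1 x.2 else 1) := by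
  classical
  let φ : I × I → I × I := fun x => if (κ x.1 < κ x.2 ↔ κ' x.1 < κ' x.2) then x else x.swap
  have ne : ∀ a b : I, a ≠ b → κ a ≠ κ b := fun a b hab hc => hab (h hc)
  have ne' : ∀ a b : I, a ≠ b → κ' a ≠ κ' b := fun a b hab hc => hab (h' hc)
  have hφ : Function.Involutive φ := by
    rintro ⟨a, b⟩
    by_cases hab : a = b
    · subst hab; simp [φ]
    · have := ne a b hab; have := ne' a b hab
      simp only [φ]
      split_ifs with h1 h2
      · rfl
      · exfalso; simp only [Prod.fst_swap, Prod.snd_swap] at h2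
        have : (κ b < κ a) ↔ ¬ (κ a < κ b) := by omega
        have : (κ' b < κ' a) ↔ ¬ (κ' a < κ' b) := by omega
        tauto
      · rfl
  rw [← Equiv.prod_comp (hφ.toPerm φ)]
  refine Finset.prod_congr rfl ?_
  rintro ⟨a, b⟩ -
  rw [Function.Involutive.coe_toPerm]
  by_cases hab : a = b
  · subst hab; simp [φ]
  · have := ne a b hab; have := ne' a b hab
    simp only [φ]
    split_ifs <;> first | rfl | exact hf _ _ | (simp only [Prod.fst_swap, Prod.snd_swap] at *; omega)

theorem prod_pairs {k : ℕ} {M : Type} [CommMonoid M] (f : Fin k → Fin k → M) :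
    ∏ x : Fin k × Fin k, (if x.1 < x.2 then f x.1 x.2 else 1) =
    ∏ p : Pairs k, f p.1.1 p.1.2 := by
  classical
  rw [← Finset.prod_filter]
  exact (Finset.prod_subtype (Finset.univ.filter fun x : Fin k × Fin k => x.1 < x.2)
    (by simp) (fun x => f x.1 x.2))

theorem prod_pairs_pow {k : ℕ} {M : Type} [CommMonoid M] (f : Fin k → M) :
    ∏ p : Pairs k, (f p.1.1 * f p.1.2) = ∏ i, f i ^ (k - 1) := by
  classical
  rw [← prod_pairs (fun i j => f i * f j)]
  have h1 : ∀ x : Fin k × Fin k, (if x.1 < x.2 then f x.1 * f x.2 else 1) =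
      (if x.1 < x.2 then f x.1 else 1) * (if x.1 < x.2 then f x.2 else 1) := by
    intro x; split_ifs <;> simp
  simp_rw [h1]
  rw [Finset.prod_mul_distrib]
  have h2 : ∏ x : Fin k × Fin k, (if x.1 < x.2 then f x.2 else 1) =
      ∏ x : Fin k × Fin k, (if x.2 < x.1 then f x.1 else 1) := by
    rw [← Equiv.prod_comp (Equiv.prodComm _ _)]; rfl
  rw [h2, ← Finset.prod_mul_distrib]
  have h3 : ∀ x : Fin k × Fin k, (if x.1 < x.2 then f x.1 else 1) * (if x.2 < x.1 then f x.1 else 1)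
      = if x.2 ≠ x.1 then f x.1 else 1 := by
    intro x
    rcases lt_trichotomy x.1 x.2 with h | h | h
    · simp [h, h.not_gt, h.ne']
    · simp [h]
    · simp [h, h.not_gt, h.ne]
  simp_rw [h3]
  rw [Fintype.prod_prod_type]
  refine Finset.prod_congr rfl fun i _ => ?_
  simp only
  rw [← Finset.prod_filter, Finset.prod_const, Finset.filter_ne', Finset.card_erase_of_mem (by simp)]
  simp

def wd {k : ℕ} (u : Pairs k → ℝ) (i j : Fin k) : ℝ :=
  if h : i < j then u ⟨(i, j), h⟩ else if h : j < i then u ⟨(j, i), h⟩ else 0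

theorem wd_comm {k : ℕ} (u : Pairs k → ℝ) (i j : Fin k) : wd u i j = wd u j i := by
  unfold wd
  rcases lt_trichotomy i j with h | h | h
  · simp [h, h.not_gt]
  · subst h; rfl
  · simp [h, h.not_gt]

def Gf {k : ℕ} (u : JJ k → ℝ) (Ω : II k → ENNReal) : II k → II k → ENNReal
  | Sum.inl i, Sum.inl j => ENNReal.ofReal (wd (fun p => u (Sum.inl p)) i j) *
      (Ω (Sum.inl i) * Ω (Sum.inl j))
  | Sum.inr i, Sum.inr j => ENNReal.ofReal (wd (fun p => u (Sum.inr p)) i j) *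
      (Ω (Sum.inr i) * Ω (Sum.inr j))
  | _, _ => 1

theorem Gf_comm {k : ℕ} (u : JJ k → ℝ) (Ω : II k → ENNReal) (a b : II k) :
    Gf u Ω a b = Gf u Ω b a := by
  rcases a with i | i <;> rcases b with j | j <;> simp only [Gf]
  · rw [wd_comm, mul_comm (Ω _)]
  · rw [wd_comm, mul_comm (Ω _)]

def κ0 {k : ℕ} : II k → ℕ := Sum.elim (fun i => i) (fun i => k + i)

theorem κ0_inj {k : ℕ} : Function.Injective (κ0 (k := k)) := by
  rintro (i | i) (j | j) h <;> simp only [κ0, Sum.elim_inl, Sum.elim_inr] at h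
  · congr; omega
  · omega
  · omega
  · congr; omega

theorem Gf_prod {k : ℕ} (u : JJ k → ℝ) (Ω : II k → ENNReal) :
    ∏ x : II k × II k, (if κ0 x.1 < κ0 x.2 then Gf u Ω x.1 x.2 else 1) =
    (∏ p, ENNReal.ofReal (u p)) * ∏ a, Ω a ^ (k - 1) := by
  rw [Fintype.prod_prod_type]
  simp only [Fintype.prod_sum_type]
  have hA : ∏ i : Fin k, ∏ j : Fin k, (if κ0 (Sum.inl i : II k) < κ0 (Sum.inl j : II k) then
      Gf u Ω (Sum.inl i) (Sum.inl j) else 1) = (∏ p, ENNReal.ofReal (u (Sum.inl p))) *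
      ∏ i, Ω (Sum.inl i) ^ (k - 1) := by
    rw [← prod_pairs_pow (fun i => Ω (Sum.inl i)), ← Finset.prod_mul_distrib]
    rw [← Fintype.prod_prod_type (f := fun x : Fin k × Fin k =>
      (if κ0 (Sum.inl x.1 : II k) < κ0 (Sum.inl x.2 : II k) then
      Gf u Ω (Sum.inl x.1) (Sum.inl x.2) else 1))]
    simp only [κ0, Sum.elim_inl, Fin.val_fin_lt]
    rw [prod_pairs (fun i j => Gf u Ω (Sum.inl i) (Sum.inl j))]
    refine Finset.prod_congr rfl fun p _ => ?_
    simp only [Gf, wd, p.2, dif_pos]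
  have hB : ∏ i : Fin k, ∏ j : Fin k, (if κ0 (Sum.inr i : II k) < κ0 (Sum.inr j : II k) then
      Gf u Ω (Sum.inr i) (Sum.inr j) else 1) = (∏ p, ENNReal.ofReal (u (Sum.inr p))) *
      ∏ i, Ω (Sum.inr i) ^ (k - 1) := by
    rw [← prod_pairs_pow (fun i => Ω (Sum.inr i)), ← Finset.prod_mul_distrib]
    rw [← Fintype.prod_prod_type (f := fun x : Fin k × Fin k =>
      (if κ0 (Sum.inr x.1 : II k) < κ0 (Sum.inr x.2 : II k) then
      Gf u Ω (Sum.inr x.1) (Sum.inr x.2) else 1))]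
    simp only [κ0, Sum.elim_inr, add_lt_add_iff_left, Fin.val_fin_lt]
    rw [prod_pairs (fun i j => Gf u Ω (Sum.inr i) (Sum.inr j))]
    refine Finset.prod_congr rfl fun p _ => ?_
    simp only [Gf, wd, p.2, dif_pos]
  have hC : ∀ i j : Fin k, (if κ0 (Sum.inl i : II k) < κ0 (Sum.inr j : II k) then
      Gf u Ω (Sum.inl i) (Sum.inr j) else 1) = 1 := by
    intro i j; simp [Gf]
  have hD : ∀ i j : Fin k, (if κ0 (Sum.inr i : II k) < κ0 (Sum.inl j : II k) then
      Gf u Ω (Sum.inr i) (Sum.inl j) else 1) = 1 := by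
    intro i j; simp [Gf]
  simp only [hC, hD, Finset.prod_const_one, mul_one, one_mul, hA, hB]
  ring

/-- the `ω` weights -/
def om {d k : ℕ} (θ : II k → ℝ) (Z : II k → EE d) (σ : Fin (k + k) ≃ II k) (a : II k) : ℝ :=
  max (rdist (Z ∘ σ) (σ.symm a)) (θ a)

theorem rdist_le_norm {d m : ℕ} (z : Fin m → EE d) (i : Fin m) : rdist z i ≤ ‖z i‖ := by
  have := Metric.infDist_le_dist_of_mem (x := z i)
    (Submodule.zero_mem (Submodule.span ℝ (z '' Set.Iio i)))
  simpa [rdist] using this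

theorem V_bound {d k : ℕ} (hkd : k + k ≤ d) (R H : ℝ) (hR : 1 ≤ R) (hH : 1 ≤ H)
    (Z : II k → EE d) (hZ : ∀ a, ‖Z a‖ ≤ 1) (σ : Fin (k + k) ≃ II k)
    (θ : II k → ℝ) (hθ : ∀ a, 0 < θ a) (hθ1 : ∀ a, θ a ≤ 1) (L U : JJ k → ℝ)
    (hLU : ∀ p, θ (e1 p) ≤ H * (U p - L p)) (hθe : ∀ p, θ (e1 p) = θ (e2 p)) :
    volume {X : MM d | ‖X‖ ≤ R ∧ WIN L U X Z} ≤
      (ENNReal.ofReal (2 * R) ^ (d * d) *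
        ENNReal.ofReal (2 * R * H) ^ (Fintype.card (II k × II k))) *
      ((∏ p, ENNReal.ofReal (U p - L p)) *
        ∏ a, ENNReal.ofReal (1 / om θ Z σ a) ^ (k - 1)) := by
  set S : Set (MM d) := {X : MM d | ‖X‖ ≤ R ∧ WIN L U X Z} with hS
  set Ω : II k → ENNReal := fun a => ENNReal.ofReal (1 / om θ Z σ a) with hΩ
  set u : JJ k → ℝ := fun p => U p - L p with hu
  have hSm : MeasurableSet S :=
    (isClosed_le continuous_norm continuous_const).measurableSet.inter (meas_WIN L U Z)
  have hom : ∀ a, 0 < om θ Z σ a := fun a => lt_max_of_lt_right (hθ a)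
  have hom1 : ∀ a, om θ Z σ a ≤ 1 := by
    intro a
    refine max_le ((rdist_le_norm _ _).trans ?_) (hθ1 a)
    simpa using hZ a
  have hu0 : ∀ p, 0 < u p := by
    intro p
    have h1 := hLU p; have h2 := hθ (e1 p)
    by_contra hc
    have : H * (U p - L p) ≤ 0 := mul_nonpos_of_nonneg_of_nonpos (by linarith) (not_lt.mp hc)
    linarith
  have hGt : ∀ a b, Gf u Ω a b ≠ ⊤ := by
    intro a b
    rcases a with i | i <;> rcases b with j | j <;> simp only [Gf, hΩ] <;>
      first | exact ENNReal.one_ne_top | skip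
    all_goals exact ENNReal.mul_ne_top ENNReal.ofReal_ne_top (ENNReal.mul_ne_top ENNReal.ofReal_ne_top ENNReal.ofReal_ne_top)
  -- main local fact
  have hloc : ∀ (p : JJ k) (ω1 ω2 : ℝ), ω1 = om θ Z σ (e1 p) → ω2 = om θ Z σ (e2 p) →
      (rdist (Z ∘ σ) (σ.symm (e1 p)) * rdist (Z ∘ σ) (σ.symm (e2 p)) = ω1 * ω2) ∨
      2 * R ≤ 2 * R * H * (u p * (1 / ω1 * (1 / ω2))) := by
    intro p ω1 ω2 h1 h2
    have p1 := hom (e1 p); have p2 := hom (e2 p)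
    have q1 := hom1 (e1 p); have q2 := hom1 (e2 p)
    rw [← h1] at p1 q1; rw [← h2] at p2 q2
    have hor : (ω1 = rdist (Z ∘ σ) (σ.symm (e1 p)) ∧ ω2 = rdist (Z ∘ σ) (σ.symm (e2 p))) ∨
        (ω1 = θ (e1 p) ∨ ω2 = θ (e1 p)) := by
      rcases max_choice (rdist (Z ∘ σ) (σ.symm (e1 p))) (θ (e1 p)) with h | h
      · rcases max_choice (rdist (Z ∘ σ) (σ.symm (e2 p))) (θ (e2 p)) with h' | h'
        · left; exact ⟨h1.trans h, h2.trans h'⟩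
        · right; right; rw [hθe]; exact h2.trans h'
      · right; left; exact h1.trans h
    rcases hor with ⟨h, h'⟩ | h
    · left; rw [← h, ← h']
    · right
      have hle : ω1 * ω2 ≤ H * u p := by
        refine le_trans ?_ (hLU p)
        rcases h with h | h <;> rw [← h]
        · exact mul_le_of_le_one_right p1.le q2
        · exact mul_le_of_le_one_left p2.le q1
      have : 2 * R * H * (u p * (1 / ω1 * (1 / ω2))) = 2 * R * ((H * u p) / (ω1 * ω2)) := by
        field_simp
      rw [this]
      refine le_mul_of_one_le_right (by linarith) ?_
      rw [one_le_div (by positivity)]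
      exact hle
  have key := vol_A4 hkd (Z ∘ σ) R (by linarith) S hSm (fun X hX => hX.1)
    (fun i j => 2 * R * H * (Gf u Ω (σ i) (σ j)).toReal) (by
      intro i j hij
      -- reduce to a statement about elements of II
      suffices hmain : ∀ a b : II k, a ≠ b →
          ((0 < rdist (Z ∘ σ) (σ.symm a) * rdist (Z ∘ σ) (σ.symm b) ∧ ∀ X ∈ S, ∀ Y ∈ S,
          |AX X (Z a) (Z b) - AX Y (Z a) (Z b)| ≤ 2 * R * H * (Gf u Ω a b).toReal *
            (rdist (Z ∘ σ) (σ.symm a) * rdist (Z ∘ σ) (σ.symm b))) ∨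
          2 * R ≤ 2 * R * H * (Gf u Ω a b).toReal) by
        have := hmain (σ i) (σ j) (fun h => hij.ne (σ.injective h))
        simpa using this
      have hpair : ∀ p : JJ k, Gf u Ω (e1 p) (e2 p) =
          ENNReal.ofReal (u p) * (Ω (e1 p) * Ω (e2 p)) →
          ((0 < rdist (Z ∘ σ) (σ.symm (e1 p)) * rdist (Z ∘ σ) (σ.symm (e2 p)) ∧ ∀ X ∈ S, ∀ Y ∈ S,
          |AX X (Z (e1 p)) (Z (e2 p)) - AX Y (Z (e1 p)) (Z (e2 p))| ≤
            2 * R * H * (Gf u Ω (e1 p) (e2 p)).toReal *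
            (rdist (Z ∘ σ) (σ.symm (e1 p)) * rdist (Z ∘ σ) (σ.symm (e2 p)))) ∨
          2 * R ≤ 2 * R * H * (Gf u Ω (e1 p) (e2 p)).toReal) := by
        intro p hp
        have p1 := hom (e1 p); have p2 := hom (e2 p)
        have hval : (Gf u Ω (e1 p) (e2 p)).toReal =
            u p * (1 / om θ Z σ (e1 p) * (1 / om θ Z σ (e2 p))) := by
          rw [hp, ENNReal.toReal_mul, ENNReal.toReal_mul, ENNReal.toReal_ofReal (hu0 p).le,
            ENNReal.toReal_ofReal (by positivity), ENNReal.toReal_ofReal (by positivity)]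
        rcases hloc p _ _ rfl rfl with h | h
        · left
          rw [h]
          refine ⟨by positivity, fun X hX Y hY => ?_⟩
          have hx := hX.2 p; have hy := hY.2 p
          rw [hval]
          have : 2 * R * H * (u p * (1 / om θ Z σ (e1 p) * (1 / om θ Z σ (e2 p)))) *
              (om θ Z σ (e1 p) * om θ Z σ (e2 p)) = (2 * R * H) * u p := by
            field_simp
          rw [this]
          have h1 : |AX X (Z (e1 p)) (Z (e2 p)) - AX Y (Z (e1 p)) (Z (e2 p))| ≤ u p := by
            rw [abs_le]; constructor <;> simp only [hu] <;> linarith [hx.1, hx.2, hy.1, hy.2]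
          refine h1.trans (le_mul_of_one_le_left (hu0 p).le ?_)
          nlinarith
        · right; rw [hval]; exact h
      have hsymm : ∀ a b : II k, ((0 < rdist (Z ∘ σ) (σ.symm a) * rdist (Z ∘ σ) (σ.symm b) ∧ ∀ X ∈ S, ∀ Y ∈ S,
          |AX X (Z a) (Z b) - AX Y (Z a) (Z b)| ≤ 2 * R * H * (Gf u Ω a b).toReal *
            (rdist (Z ∘ σ) (σ.symm a) * rdist (Z ∘ σ) (σ.symm b))) ∨
          2 * R ≤ 2 * R * H * (Gf u Ω a b).toReal) →
          ((0 < rdist (Z ∘ σ) (σ.symm b) * rdist (Z ∘ σ) (σ.symm a) ∧ ∀ X ∈ S, ∀ Y ∈ S,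
          |AX X (Z b) (Z a) - AX Y (Z b) (Z a)| ≤ 2 * R * H * (Gf u Ω b a).toReal *
            (rdist (Z ∘ σ) (σ.symm b) * rdist (Z ∘ σ) (σ.symm a))) ∨
          2 * R ≤ 2 * R * H * (Gf u Ω b a).toReal) := by
        intro a b h
        rw [Gf_comm u Ω b a, mul_comm (rdist (Z ∘ σ) (σ.symm b))]
        refine h.imp_left fun h => ⟨h.1, fun X hX Y hY => ?_⟩
        rw [AX_antisymm X, AX_antisymm Y, neg_sub_neg, abs_sub_comm]
        exact h.2 X hX Y hY
      rintro (i | i) (j | j) hab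
      · rcases lt_or_gt_of_ne (fun h => hab (congrArg _ h) : i ≠ j) with h | h
        · exact hpair (Sum.inl ⟨(i, j), h⟩) (by simp [e1, e2, Gf, wd, h])
        · exact hsymm _ _ (hpair (Sum.inl ⟨(j, i), h⟩) (by simp [e1, e2, Gf, wd, h]))
      · right; simp only [Gf, ENNReal.toReal_one]; nlinarith
      · right; simp only [Gf, ENNReal.toReal_one]; nlinarith
      · rcases lt_or_gt_of_ne (fun h => hab (congrArg _ h) : i ≠ j) with h | h
        · exact hpair (Sum.inr ⟨(i, j), h⟩) (by simp [e1, e2, Gf, wd, h])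
        · exact hsymm _ _ (hpair (Sum.inr ⟨(j, i), h⟩) (by simp [e1, e2, Gf, wd, h])))
  refine key.trans ?_
  rw [mul_assoc (ENNReal.ofReal (2 * R) ^ (d * d))]
  refine mul_le_mul_right ?_ _
  have hc1 : (1 : ENNReal) ≤ ENNReal.ofReal (2 * R * H) := by
    rw [← ENNReal.ofReal_one]; exact ENNReal.ofReal_le_ofReal (by nlinarith)
  change _ ≤ _ * ((∏ p, ENNReal.ofReal (u p)) * ∏ a, Ω a ^ (k - 1))
  rw [← Gf_prod, prod_reorder κ0 (fun a => ((σ.symm a : Fin (k+k)) : ℕ)) κ0_inj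
    (Fin.val_injective.comp σ.symm.injective) _ (Gf_comm u Ω)]
  rw [← Finset.card_univ, ← Finset.prod_const, ← Finset.prod_mul_distrib]
  rw [← Equiv.prod_comp (Equiv.prodCongr σ σ)]
  refine Finset.prod_le_prod' ?_
  rintro ⟨i, j⟩ -
  simp only [Equiv.prodCongr_apply, Prod.map_apply, Equiv.symm_apply_apply, Fin.val_fin_lt]
  split_ifs
  · rw [ENNReal.ofReal_mul (by nlinarith), ENNReal.ofReal_toReal (hGt _ _)]
  · simpa using hc1

def Good {d : ℕ} {ι : Type} [Fintype ι] (τ : ℝ) (Z : ι → EE d) : Prop :=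
  ∀ c : ι → ℝ, ∀ l, τ * |c l| ≤ ‖∑ a, c a • Z a‖

theorem Good.perturb {d : ℕ} {ι : Type} [Fintype ι] {τ ε : ℝ} {Z Z' : ι → EE d}
    (h : Good τ Z) (hε : ∀ a, ‖Z a - Z' a‖ ≤ ε) : Good (τ - Fintype.card ι * ε) Z' := by
  intro c l
  obtain ⟨b, -, hb⟩ := Finset.exists_max_image Finset.univ (fun a => |c a|) ⟨l, Finset.mem_univ l⟩
  have h1 := h c b
  have h2 : ‖∑ a, c a • Z a - ∑ a, c a • Z' a‖ ≤ Fintype.card ι * ε * |c b| := by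
    rw [← Finset.sum_sub_distrib]
    refine (norm_sum_le _ _).trans ?_
    calc _ ≤ ∑ a : ι, |c b| * ε := by
          refine Finset.sum_le_sum fun a _ => ?_
          rw [← smul_sub, norm_smul, Real.norm_eq_abs]
          exact mul_le_mul (hb a (Finset.mem_univ a)) (hε a) (norm_nonneg _) (abs_nonneg _)
      _ = _ := by rw [Finset.sum_const, Finset.card_univ, nsmul_eq_mul]; ring
  have h3 : ‖∑ a, c a • Z a‖ ≤ ‖∑ a, c a • Z' a‖ + ‖∑ a, c a • Z a - ∑ a, c a • Z' a‖ := by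
    have := norm_add_le (∑ a, c a • Z' a) (∑ a, c a • Z a - ∑ a, c a • Z' a)
    simpa using this
  by_cases hs : 0 ≤ τ - Fintype.card ι * ε
  · have := mul_le_mul_of_nonneg_left (hb l (Finset.mem_univ l)) hs
    nlinarith
  · have : (τ - Fintype.card ι * ε) * |c l| ≤ 0 :=
      mul_nonpos_of_nonpos_of_nonneg (not_le.mp hs).le (abs_nonneg _)
    exact this.trans (norm_nonneg _)

theorem Good.dist_span {d : ℕ} {ι : Type} [Fintype ι] [DecidableEq ι] {τ : ℝ} {Z : ι → EE d}
    (h : Good τ Z) (l : ι) (w : EE d) (hw : w ∈ Submodule.span ℝ (Z '' {l}ᶜ)) :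
    τ ≤ ‖Z l - w‖ := by
  obtain ⟨f, hf, rfl⟩ := (Finsupp.mem_span_image_iff_linearCombination ℝ).mp hw
  have hfl : f l = 0 := by
    by_contra hc
    have := hf (Finsupp.mem_support_iff.mpr hc)
    simp at this
  have := h (fun a => (if a = l then 1 else 0) - f a) l
  simp only [if_true, hfl, sub_zero, abs_one, mul_one] at this
  refine this.trans (le_of_eq ?_)
  congr 1
  simp only [sub_smul, Finset.sum_sub_distrib, ite_smul, one_smul, zero_smul,
    Finset.sum_ite_eq', Finset.mem_univ, if_true]
  rw [Finsupp.linearCombination_apply, Finsupp.sum_fintype _ _ (by simp)]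

theorem Good.rdist_ge {d k : ℕ} {τ : ℝ} {Z : II k → EE d}
    (h : Good τ Z) (σ : Fin (k + k) ≃ II k) (i : Fin (k + k)) : τ ≤ rdist (Z ∘ σ) i := by
  refine (Metric.le_infDist ⟨0, Submodule.zero_mem _⟩).mpr ?_
  intro w hw
  rw [dist_eq_norm]
  refine h.dist_span (σ i) w (Submodule.span_mono ?_ hw)
  rintro x ⟨j, hj, rfl⟩
  exact ⟨σ j, by simpa using (ne_of_lt hj), rfl⟩

theorem not_good {d : ℕ} {ι : Type} [Fintype ι] [DecidableEq ι] {τ : ℝ} {Z : ι → EE d}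
    (h : ¬ Good τ Z) : ∃ l, ∃ w ∈ Submodule.span ℝ (Z '' {l}ᶜ), ‖Z l - w‖ < τ := by
  unfold Good at h
  push Not at h
  obtain ⟨c, l, hc⟩ := h
  have hcl : c l ≠ 0 := by
    intro h0; rw [h0] at hc; simp at hc
    exact absurd hc (not_lt.mpr (norm_nonneg _))
  refine ⟨l, - ∑ a ∈ Finset.univ.erase l, (c a / c l) • Z a, ?_, ?_⟩
  · refine Submodule.neg_mem _ (Submodule.sum_mem _ fun a ha => Submodule.smul_mem _ _
      (Submodule.subset_span ⟨a, by simpa using ha, rfl⟩))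
  · have h1 : Z l - - ∑ a ∈ Finset.univ.erase l, (c a / c l) • Z a =
        (c l)⁻¹ • ∑ a, c a • Z a := by
      rw [← Finset.add_sum_erase _ _ (Finset.mem_univ l), smul_add, smul_smul,
        inv_mul_cancel₀ hcl, one_smul, sub_neg_eq_add, Finset.smul_sum]
      congr 1
      refine Finset.sum_congr rfl fun a _ => ?_
      rw [smul_smul]; congr 1; field_simp
    rw [h1, norm_smul, norm_inv, Real.norm_eq_abs]
    have : 0 < |c l| := abs_pos.mpr hcl
    rw [inv_mul_lt_iff₀ this]; linarith

theorem Good.dual {d : ℕ} {ι : Type} [Fintype ι] [DecidableEq ι] {τ : ℝ} (hτ : 0 < τ)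
    {Z : ι → EE d} (h : Good τ Z) : ∃ zs : ι → EE d,
      (∀ a b, inner ℝ (zs a) (Z b) = if a = b then 1 else 0) ∧ ∀ a, ‖zs a‖ ≤ 1 / τ := by
  have : ∀ a, ∃ v : EE d, (∀ b, inner ℝ v (Z b) = if a = b then 1 else 0) ∧ ‖v‖ ≤ 1 / τ := by
    intro a
    set W := Submodule.span ℝ (Z '' {a}ᶜ) with hW
    set w := Z a - W.starProjection (Z a) with hw
    have hwW : ∀ u ∈ W, inner ℝ w u = 0 := by
      intro u hu
      exact Submodule.starProjection_inner_eq_zero _ u hu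
    have hn : τ ≤ ‖w‖ := h.dist_span a _ (Submodule.starProjection_apply_mem _ _)
    have hw0 : 0 < ‖w‖ := hτ.trans_le hn
    have hwa : inner ℝ w (Z a) = ‖w‖ ^ 2 := by
      have : Z a = w + W.starProjection (Z a) := by rw [hw]; abel
      rw [this, inner_add_right, hwW _ (Submodule.starProjection_apply_mem _ _), add_zero]
      exact real_inner_self_eq_norm_sq w
    refine ⟨(‖w‖ ^ 2)⁻¹ • w, fun b => ?_, ?_⟩
    · rw [real_inner_smul_left]
      split_ifs with hab
      · subst hab; rw [hwa]; field_simp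
      · rw [hwW _ (Submodule.subset_span ⟨b, by simpa using Ne.symm hab, rfl⟩), mul_zero]
    · rw [norm_smul, norm_inv, norm_pow, norm_norm]
      have : (‖w‖ ^ 2)⁻¹ * ‖w‖ = 1 / ‖w‖ := by field_simp
      rw [this]
      exact one_div_le_one_div_of_le hτ hn
  choose v hv using this
  exact ⟨v, fun a b => (hv a).1 b, fun a => (hv a).2⟩

theorem norm_tens {d : ℕ} (u w : EE d) : ‖tens u w‖ = ‖u‖ * ‖w‖ := by
  have h := inner_tens u w u w
  rw [real_inner_self_eq_norm_sq, real_inner_self_eq_norm_sq, real_inner_self_eq_norm_sq,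
    ← mul_pow] at h
  exact (pow_left_inj₀ (norm_nonneg _) (by positivity) two_ne_zero).mp h

theorem AX_le {d : ℕ} (X : MM d) (u w : EE d) : |AX X u w| ≤ 2 * ‖X‖ * (‖u‖ * ‖w‖) := by
  rw [AX]
  refine (abs_real_inner_le_norm _ _).trans ?_
  have h1 := norm_sub_le (tens u w) (tens w u)
  rw [norm_tens, norm_tens] at h1
  have := mul_le_mul_of_nonneg_left h1 (norm_nonneg X)
  linarith

theorem tens_sub_left {d : ℕ} (u u' w : EE d) : tens (u - u') w = tens u w - tens u' w := by
  ext p; simp [tens, sub_mul]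
theorem tens_sub_right {d : ℕ} (u w w' : EE d) : tens u (w - w') = tens u w - tens u w' := by
  ext p; simp [tens, mul_sub]

theorem AX_diff {d : ℕ} (X : MM d) (u w u' w' : EE d) (ε : ℝ) (h1 : ‖u - u'‖ ≤ ε)
    (h2 : ‖w - w'‖ ≤ ε) (h3 : ‖w‖ ≤ 1) (h4 : ‖u'‖ ≤ 1) :
    |AX X u w - AX X u' w'| ≤ 4 * ε * ‖X‖ := by
  have : AX X u w - AX X u' w' = AX X (u - u') w + AX X u' (w - w') := by
    simp only [AX, tens_sub_left, tens_sub_right, inner_sub_right]; ring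
  rw [this]
  have e1 := AX_le X (u - u') w
  have e2 := AX_le X u' (w - w')
  have f1 : ‖u - u'‖ * ‖w‖ ≤ ε * 1 := mul_le_mul h1 h3 (norm_nonneg _) ((norm_nonneg _).trans h1)
  have f2 : ‖u'‖ * ‖w - w'‖ ≤ 1 * ε := mul_le_mul h4 h2 (norm_nonneg _) zero_le_one
  have g1 := mul_le_mul_of_nonneg_left f1 (by positivity : 0 ≤ 2 * ‖X‖)
  have g2 := mul_le_mul_of_nonneg_left f2 (by positivity : 0 ≤ 2 * ‖X‖)
  have := abs_add_le (AX X (u - u') w) (AX X u' (w - w'))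
  linarith

theorem AX_add {d : ℕ} (X Y : MM d) (u w : EE d) : AX (X + Y) u w = AX X u w + AX Y u w := by
  simp only [AX, inner_add_left]
theorem AX_smul {d : ℕ} (c : ℝ) (X : MM d) (u w : EE d) : AX (c • X) u w = c * AX X u w := by
  simp only [AX, real_inner_smul_left]
theorem AX_sum {d : ℕ} {ι : Type} (s : Finset ι) (f : ι → MM d) (u w : EE d) :
    AX (∑ i ∈ s, f i) u w = ∑ i ∈ s, AX (f i) u w := by
  simp only [AX, sum_inner]

def Mv {d k : ℕ} (Z : II k → EE d) (X : MM d) : JJ k → ℝ := fun p => AX X (Z (e1 p)) (Z (e2 p))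

theorem e_ne {k : ℕ} (p p' : JJ k) : ¬ (e1 p = e2 p' ∧ e2 p = e1 p') := by
  rintro ⟨h1, h2⟩
  rcases p with ⟨⟨i, j⟩, h⟩ | ⟨⟨i, j⟩, h⟩ <;> rcases p' with ⟨⟨i', j'⟩, h'⟩ | ⟨⟨i', j'⟩, h'⟩ <;>
    simp only [e1, e2, Sum.map_inl, Sum.map_inr, Sum.inl.injEq, Sum.inr.injEq, reduceCtorEq] at h1 h2
  · subst h1; subst h2; exact absurd h (not_lt.mpr h'.le)
  · subst h1; subst h2; exact absurd h (not_lt.mpr h'.le)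

theorem e_inj {k : ℕ} (p p' : JJ k) (h1 : e1 p = e1 p') (h2 : e2 p = e2 p') : p = p' := by
  rcases p with ⟨⟨i, j⟩, h⟩ | ⟨⟨i, j⟩, h⟩ <;> rcases p' with ⟨⟨i', j'⟩, h'⟩ | ⟨⟨i', j'⟩, h'⟩ <;>
    simp only [e1, e2, Sum.map_inl, Sum.map_inr, Sum.inl.injEq, Sum.inr.injEq, reduceCtorEq] at h1 h2
  · subst h1; subst h2; rfl
  · subst h1; subst h2; rfl

theorem Good.rinv {d k : ℕ} {τ : ℝ} (hτ : 0 < τ) {Z : II k → EE d} (h : Good τ Z) :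
    ∃ B : (JJ k → ℝ) →ₗ[ℝ] MM d, (∀ q, Mv Z (B q) = q) ∧
      ∀ q s, (∀ p, |q p| ≤ s) → ‖B q‖ ≤ Fintype.card (JJ k) * (1 / τ) ^ 2 * s := by
  classical
  obtain ⟨zs, h1, h2⟩ := h.dual hτ
  refine ⟨∑ p : JJ k, (LinearMap.proj p).smulRight (tens (zs (e1 p)) (zs (e2 p))), ?_, ?_⟩
  · intro q
    ext p
    simp only [Mv, LinearMap.sum_apply, LinearMap.smulRight_apply, LinearMap.proj_apply,
      AX_sum, AX_smul]
    rw [Finset.sum_eq_single p]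
    · rw [AX, inner_sub_right, inner_tens, inner_tens, h1, h1, h1, h1]
      have := e_ne p p
      simp only [if_true]
      split_ifs with h3 h4
      · exact absurd ⟨h3, h4⟩ this
      all_goals simp
    · intro p' _ hne
      rw [AX, inner_sub_right, inner_tens, inner_tens, h1, h1, h1, h1]
      have g1 := e_ne p' p
      have g2 : ¬ (e1 p' = e1 p ∧ e2 p' = e2 p) := fun hh => hne (e_inj _ _ hh.1 hh.2)
      split_ifs <;> simp_all
    · simp
  · intro q s hq
    simp only [LinearMap.sum_apply, LinearMap.smulRight_apply, LinearMap.proj_apply]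
    refine (norm_sum_le _ _).trans ?_
    calc _ ≤ ∑ p : JJ k, s * ((1 / τ) * (1 / τ)) := by
          refine Finset.sum_le_sum fun p _ => ?_
          rw [norm_smul, Real.norm_eq_abs, norm_tens]
          have := h2 (e1 p); have := h2 (e2 p)
          have hs : 0 ≤ s := (abs_nonneg _).trans (hq p)
          gcongr
          exact hq p
      _ = _ := by rw [Finset.sum_const, Finset.card_univ, nsmul_eq_mul]; ring

def rho {d : ℕ} (R : ℝ) (X : MM d) : ENNReal := ENNReal.ofReal (R - ‖X‖)

theorem meas_rho {d : ℕ} (R : ℝ) : Measurable (rho (d := d) R) := by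
  unfold rho; fun_prop

def bx {k : ℕ} (L U : JJ k → ℝ) : Set (JJ k → ℝ) := Set.pi Set.univ fun p => Set.Ioo (L p) (U p)

theorem WIN_iff {d k : ℕ} (L U : JJ k → ℝ) (X : MM d) (Z : II k → EE d) :
    WIN L U X Z ↔ Mv Z X ∈ bx L U := by
  simp [WIN, bx, Mv, Set.mem_pi]

theorem meas_bx {k : ℕ} (L U : JJ k → ℝ) : MeasurableSet (bx L U) :=
  MeasurableSet.univ_pi fun _ => measurableSet_Ioo

theorem meas_Mv {d k : ℕ} (Z : II k → EE d) : Measurable (Mv Z) := by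
  refine measurable_pi_lambda _ fun p => Continuous.measurable ?_
  exact continuous_AX.comp (by fun_prop : Continuous fun X : MM d => (X, Z (e1 p), Z (e2 p)))

/-- weighted measure of the set of forms whose values on `Z` lie in `Q` -/
def Wq {d k : ℕ} (R : ℝ) (Z : II k → EE d) (Q : Set (JJ k → ℝ)) : ENNReal :=
  ∫⁻ X : MM d, rho R X * Q.indicator (fun _ => 1) (Mv Z X)

def Vq {d k : ℕ} (R : ℝ) (Z : II k → EE d) (Q : Set (JJ k → ℝ)) : ENNReal :=
  volume {X : MM d | ‖X‖ ≤ R ∧ Mv Z X ∈ Q}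

theorem exists_pos_le {J : Type} [Finite J] (u : J → ℝ) (hu : ∀ p, 0 < u p) :
    ∃ θ : ℝ, 0 < θ ∧ θ ≤ 1 ∧ ∀ p, θ ≤ u p := by
  cases isEmpty_or_nonempty J
  · exact ⟨1, one_pos, le_rfl, fun p => isEmptyElim p⟩
  · obtain ⟨p, hp⟩ := Finite.exists_min u
    exact ⟨min 1 (u p), lt_min one_pos (hu p), min_le_left _ _,
      fun q => (min_le_right _ _).trans (hp q)⟩

theorem V_good {d k : ℕ} (hkd : k + k ≤ d) (R : ℝ) (hR : 1 ≤ R) {τ : ℝ} (hτ : 0 < τ)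
    (Z : II k → EE d) (hZ : ∀ a, ‖Z a‖ ≤ 1) (hg : Good τ Z)
    (L U : JJ k → ℝ) (hLU : ∀ p, L p < U p) :
    Vq R Z (bx L U) ≤ ENNReal.ofReal (2 * R) ^ (d * d + Fintype.card (II k × II k)) *
      (∏ p, ENNReal.ofReal (U p - L p)) *
      ENNReal.ofReal (1 / τ) ^ (Fintype.card (II k) * (k - 1)) := by
  obtain ⟨θ, h0, h1, h2⟩ := exists_pos_le (fun p => U p - L p) (fun p => sub_pos.mpr (hLU p))
  let σ : Fin (k + k) ≃ II k := finSumFinEquiv.symm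
  have := V_bound hkd R 1 hR le_rfl Z hZ σ (fun _ => θ) (fun _ => h0) (fun _ => h1) L U
    (fun p => by simpa using h2 p) (fun _ => rfl)
  simp only [WIN_iff] at this
  refine this.trans ?_
  rw [mul_one, ← pow_add, ← mul_assoc]
  refine mul_le_mul_right ?_ _
  rw [pow_mul', ← Finset.card_univ, ← Finset.prod_const]
  refine Finset.prod_le_prod' fun a _ => ?_
  gcongr
  exact (hg.rdist_ge σ _).trans (le_max_left _ _)

theorem antilip_vol {d : ℕ} (f : MM d → MM d) (K : NNReal) (hf : AntilipschitzWith K f)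
    (S : Set (MM d)) : volume (f ⁻¹' S) ≤ (K : ENNReal) ^ (d * d) * volume S := by
  have h1 := hf.hausdorffMeasure_preimage_le (d := ((d * d : ℕ) : ℝ)) (Nat.cast_nonneg _) S
  rw [ENNReal.rpow_natCast] at h1
  have hfr : Module.finrank ℝ (MM d) = d * d := by simp
  rw [← hfr] at h1
  obtain ⟨sc, h2⟩ : ∃ sc : NNReal, (volume : Measure (MM d)) = sc •
      (Measure.hausdorffMeasure (Module.finrank ℝ (MM d)) : Measure (MM d)) :=
    ⟨_, Measure.isAddLeftInvariant_eq_smul _ _⟩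
  rw [show (K : ENNReal) ^ (d * d) = (K : ENNReal) ^ Module.finrank ℝ (MM d) by rw [hfr]]
  rw [h2]
  simp only [Measure.smul_apply, smul_eq_mul, ENNReal.smul_def]
  calc _ ≤ _ * ((K : ENNReal) ^ Module.finrank ℝ (MM d) * _) := mul_le_mul_right h1 _
    _ = _ := by ring

theorem PER {d k : ℕ} (R : ℝ) (f : MM d → MM d) (hf : Measurable f) (K : ENNReal)
    (hK : ∀ S, MeasurableSet S → volume (f ⁻¹' S) ≤ K * volume S) (e : ℝ) (he1 : e ≤ 1)
    (hfe : ∀ X, ‖X‖ ≤ R → ‖f X - X‖ ≤ e) (Z Z' : II k → EE d) (Q Q' : Set (JJ k → ℝ))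
    (hQ' : MeasurableSet Q') (hfQ : ∀ X, Mv Z X ∈ Q → Mv Z' (f X) ∈ Q') :
    Wq R Z Q ≤ K * (Wq R Z' Q' + ENNReal.ofReal e * Vq (R + 1) Z' Q') := by
  set F : MM d → ENNReal := fun Y => rho R Y * Q'.indicator (fun _ => 1) (Mv Z' Y) +
    ENNReal.ofReal e * {X : MM d | ‖X‖ ≤ R + 1 ∧ Mv Z' X ∈ Q'}.indicator (fun _ => 1) Y with hF
  have hm : MeasurableSet {X : MM d | ‖X‖ ≤ R + 1 ∧ Mv Z' X ∈ Q'} :=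
    (isClosed_le continuous_norm continuous_const).measurableSet.inter (meas_Mv Z' hQ')
  have hm1 : Measurable fun Y : MM d => rho R Y * Q'.indicator (fun _ => 1) (Mv Z' Y) :=
    (meas_rho R).mul ((measurable_const.indicator hQ').comp (meas_Mv Z'))
  have hFm : Measurable F :=
    hm1.add (measurable_const.mul (measurable_const.indicator hm))
  have hFi : ∫⁻ Y, F Y = Wq R Z' Q' + ENNReal.ofReal e * Vq (R + 1) Z' Q' := by
    simp only [hF]
    rw [lintegral_add_left hm1, lintegral_const_mul _ (measurable_const.indicator hm)]
    rw [lintegral_indicator_const hm, one_mul]; rfl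
  calc Wq R Z Q ≤ ∫⁻ X, F (f X) := by
        apply lintegral_mono
        intro X
        simp only [hF]
        by_cases hX : Mv Z X ∈ Q
        · rw [Set.indicator_of_mem hX, Set.indicator_of_mem (hfQ X hX), mul_one, mul_one]
          by_cases hXR : ‖X‖ ≤ R
          · have h1 := hfe X hXR
            have h2 : ‖f X‖ ≤ ‖X‖ + e := by
              have := norm_add_le X (f X - X)
              rw [add_sub_cancel] at this; linarith
            rw [Set.indicator_of_mem (show f X ∈ {X : MM d | ‖X‖ ≤ R + 1 ∧ Mv Z' X ∈ Q'} from
              ⟨by linarith, hfQ X hX⟩), mul_one, rho, rho]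
            have : R - ‖X‖ ≤ (R - ‖f X‖) + e := by linarith
            exact (ENNReal.ofReal_le_ofReal this).trans ENNReal.ofReal_add_le
          · have : rho R X = 0 := ENNReal.ofReal_of_nonpos (by linarith)
            rw [this]; exact zero_le
        · rw [Set.indicator_of_notMem hX, mul_zero]; exact zero_le
    _ = ∫⁻ Y, F Y ∂(Measure.map f volume) := (lintegral_map hFm hf).symm
    _ ≤ ∫⁻ Y, F Y ∂(K • volume) := by
        apply lintegral_mono' _ le_rfl
        refine Measure.le_iff.mpr fun S hS => ?_
        rw [Measure.map_apply hf hS]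
        simpa using hK S hS
    _ = _ := by rw [lintegral_smul_measure, hFi]; rfl

theorem vol_bx {k : ℕ} (L U : JJ k → ℝ) : volume (bx L U) = ∏ p, ENNReal.ofReal (U p - L p) :=
  Real.volume_pi_Ioo

theorem Mv_add {d k : ℕ} (Z : II k → EE d) (X Y : MM d) : Mv Z (X + Y) = Mv Z X + Mv Z Y := by
  funext p; simp [Mv, AX_add]

theorem Mv_sub {d k : ℕ} (Z : II k → EE d) (X Y : MM d) : Mv Z (X - Y) = Mv Z X - Mv Z Y := by
  have := Mv_add Z (X - Y) Y
  rw [sub_add_cancel] at this; rw [this]; simp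

/-- constant in volume bound -/
def VC (d k : ℕ) (R τ : ℝ) : ENNReal :=
  ENNReal.ofReal (2 * R) ^ (d * d + Fintype.card (II k × II k)) *
      ENNReal.ofReal (1 / τ) ^ (Fintype.card (II k) * (k - 1))

theorem V_good' {d k : ℕ} (hkd : k + k ≤ d) (R : ℝ) (hR : 1 ≤ R) {τ : ℝ} (hτ : 0 < τ)
    (Z : II k → EE d) (hZ : ∀ a, ‖Z a‖ ≤ 1) (hg : Good τ Z)
    (L U : JJ k → ℝ) (hLU : ∀ p, L p < U p) :
    Vq R Z (bx L U) ≤ VC d k R τ * volume (bx L U) := by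
  refine (V_good hkd R hR hτ Z hZ hg L U hLU).trans (le_of_eq ?_)
  rw [vol_bx, VC]; ring

theorem step1 {d k : ℕ} (hkd : k + k ≤ d) (R : ℝ) (hR : 1 ≤ R) {τ : ℝ} (hτ : 0 < τ)
    (Z Z' : II k → EE d) (hZ : ∀ a, ‖Z a‖ ≤ 1) (hZ' : ∀ a, ‖Z' a‖ ≤ 1)
    (hg' : Good τ Z') (s : ℝ) (hs : 0 ≤ s) (hZZ : ∀ a, ‖Z a - Z' a‖ ≤ s)
    (L U : JJ k → ℝ) (hLU : ∀ p, L p < U p) (q : JJ k → ℝ) (hq : ∀ p, |q p| ≤ s) (m : ℝ)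
    (hm : m = Fintype.card (JJ k) * (1 / τ) ^ 2 * (4 * s * R + s)) (hm2 : m ≤ 1 / 2) :
    Wq R Z (bx L U) ≤ ENNReal.ofReal (1 + 2 * m) ^ (d * d) *
      (Wq R Z' (bx (L + q) (U + q)) + ENNReal.ofReal m * (VC d k (R + 1) τ * volume (bx L U))) := by
  obtain ⟨B, hB1, hB2⟩ := hg'.rinv hτ
  have hm0 : 0 ≤ m := by rw [hm]; positivity
  set f : MM d → MM d := fun X => X + B (Mv Z X - Mv Z' X + q) with hf
  have hfM : ∀ X, Mv Z' (f X) = Mv Z X + q := by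
    intro X; rw [hf]; simp only; rw [Mv_add, hB1]; abel
  have hD : ∀ X : MM d, ∀ p, |Mv Z X p - Mv Z' X p| ≤ 4 * s * ‖X‖ := fun X p =>
    AX_diff X _ _ _ _ s (hZZ _) (hZZ _) (hZ _) (hZ' _)
  have hfe : ∀ X, ‖X‖ ≤ R → ‖f X - X‖ ≤ m := by
    intro X hX
    rw [hf]; simp only [add_sub_cancel_left]
    rw [hm]
    refine hB2 _ _ fun p => ?_
    have h1 := hD X p
    have h2 := hq p
    have h3 : 4 * s * ‖X‖ ≤ 4 * s * R := by gcongr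
    simp only [Pi.add_apply, Pi.sub_apply]
    exact (abs_add_le _ _).trans (by linarith)
  have hsub : ∀ X Y, f X - f Y = (X - Y) + B (Mv Z (X - Y) - Mv Z' (X - Y)) := by
    intro X Y
    rw [hf]; simp only
    rw [add_sub_add_comm, ← map_sub, Mv_sub, Mv_sub]
    congr 2; abel
  have hanti : AntilipschitzWith (Real.toNNReal (1 + 2 * m)) f := by
    refine AntilipschitzWith.of_le_mul_dist fun X Y => ?_
    rw [dist_eq_norm, dist_eq_norm, hsub, Real.coe_toNNReal _ (by linarith)]
    have h1 := hB2 (Mv Z (X - Y) - Mv Z' (X - Y)) _ (hD (X - Y))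
    have h2 : Fintype.card (JJ k) * (1 / τ) ^ 2 * (4 * s * ‖X - Y‖) ≤ m * ‖X - Y‖ := by
      rw [hm]
      have h5 : 4 * s * ‖X - Y‖ ≤ (4 * s * R + s) * ‖X - Y‖ := by
        refine mul_le_mul_of_nonneg_right ?_ (norm_nonneg _)
        nlinarith
      calc _ ≤ Fintype.card (JJ k) * (1 / τ) ^ 2 * ((4 * s * R + s) * ‖X - Y‖) := by gcongr
        _ = _ := by ring
    have h3 : ‖X - Y‖ - ‖B (Mv Z (X - Y) - Mv Z' (X - Y))‖ ≤
        ‖(X - Y) + B (Mv Z (X - Y) - Mv Z' (X - Y))‖ := norm_sub_le_norm_add _ _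
    have h4 : (1 - m) * ‖X - Y‖ ≤ ‖(X - Y) + B (Mv Z (X - Y) - Mv Z' (X - Y))‖ := by linarith
    have h6 : ‖X - Y‖ ≤ (1 + 2 * m) * ((1 - m) * ‖X - Y‖) := by
      have : 1 ≤ (1 + 2 * m) * (1 - m) := by nlinarith
      nlinarith [norm_nonneg (X - Y)]
    exact h6.trans (by gcongr)
  have hfm : Measurable f := by
    have hBc : Continuous B := B.continuous_of_finiteDimensional
    exact measurable_id.add (hBc.measurable.comp
      (((meas_Mv Z).sub (meas_Mv Z')).add measurable_const))
  have hper := PER R f hfm (ENNReal.ofReal (1 + 2 * m) ^ (d * d))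
    (fun S _ => antilip_vol f _ hanti S) m (by linarith) hfe Z Z' (bx L U) (bx (L + q) (U + q))
    (meas_bx _ _) (by
      intro X hX
      rw [hfM]
      intro p hp
      have := hX p hp
      simp only [Set.mem_Ioo, Pi.add_apply] at this ⊢
      constructor <;> linarith [this.1, this.2])
  refine hper.trans (mul_le_mul_right (add_le_add_right (mul_le_mul_right ?_ _) _) _)
  refine (V_good' hkd (R + 1) (by linarith) hτ Z' hZ' hg' _ _ (fun p => by simpa using hLU p)).trans
    (le_of_eq ?_)
  simp [vol_bx]

theorem bx_shift {k : ℕ} (L U q x : JJ k → ℝ) : x ∈ bx (L + q) (U + q) ↔ x - q ∈ bx L U := by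
  simp only [bx, Set.mem_pi, Set.mem_univ, true_imp_iff, Pi.add_apply, Pi.sub_apply, Set.mem_Ioo]
  exact forall_congr' fun p => by
    rw [lt_sub_iff_add_lt, sub_lt_iff_lt_add]

theorem ind_shift {k : ℕ} (L U q x : JJ k → ℝ) :
    (bx (L + q) (U + q)).indicator (fun _ => (1 : ENNReal)) x =
    (bx L U).indicator (fun _ => (1 : ENNReal)) (x - q) := by
  classical
  simp only [Set.indicator_apply, bx_shift]

theorem swapQ {d k : ℕ} (R : ℝ) (Z : II k → EE d) (L U L' U' : JJ k → ℝ) :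
    ∫⁻ q, (bx L' U').indicator (fun _ => 1) q * Wq R Z (bx (L + q) (U + q)) =
    ∫⁻ q, (bx L U).indicator (fun _ => 1) q * Wq R Z (bx (L' + q) (U' + q)) := by
  have mi : ∀ L U : JJ k → ℝ, Measurable ((bx L U).indicator (fun _ => (1 : ENNReal))) :=
    fun L U => measurable_const.indicator (meas_bx L U)
  have key : ∀ L U L' U' : JJ k → ℝ,
      ∫⁻ q, (bx L' U').indicator (fun _ => 1) q * Wq R Z (bx (L + q) (U + q)) =
      ∫⁻ X : MM d, rho R X * ∫⁻ q, (bx L' U').indicator (fun _ => 1) q *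
        (bx L U).indicator (fun _ => 1) (Mv Z X - q) := by
    intro L U L' U'
    have h1 : ∀ q, (bx L' U').indicator (fun _ => 1) q * Wq R Z (bx (L + q) (U + q)) =
        ∫⁻ X : MM d, rho R X * ((bx L' U').indicator (fun _ => 1) q *
        (bx L U).indicator (fun _ => 1) (Mv Z X - q)) := by
      intro q
      rw [Wq, ← lintegral_const_mul']
      · refine lintegral_congr fun X => ?_
        rw [ind_shift]; ring
      · by_cases h : q ∈ bx L' U' <;> simp [h]
    simp_rw [h1]
    rw [lintegral_lintegral_swap]
    · refine lintegral_congr fun X => ?_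
      rw [lintegral_const_mul']
      exact ENNReal.ofReal_ne_top
    · refine Measurable.aemeasurable ?_
      refine ((meas_rho R).comp measurable_snd).mul ?_
      exact ((mi L' U').comp measurable_fst).mul
        ((mi L U).comp (((meas_Mv Z).comp measurable_snd).sub measurable_fst))
  rw [key, key]
  refine lintegral_congr fun X => ?_
  congr 1
  rw [← lintegral_sub_left_eq_self _ (Mv Z X)]
  refine lintegral_congr fun q => ?_
  rw [sub_sub_cancel, mul_comm]

theorem Wq_le {d k : ℕ} (R : ℝ) (Z : II k → EE d) (L U : JJ k → ℝ) :
    Wq R Z (bx L U) ≤ ENNReal.ofReal R * Vq R Z (bx L U) := by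
  have hmm : MeasurableSet {X : MM d | ‖X‖ ≤ R ∧ Mv Z X ∈ bx L U} :=
    (isClosed_le continuous_norm continuous_const).measurableSet.inter
      (meas_Mv Z (meas_bx L U))
  rw [Vq, ← lintegral_indicator_const hmm]
  refine lintegral_mono fun X => ?_
  by_cases hX : ‖X‖ ≤ R
  · by_cases hX2 : Mv Z X ∈ bx L U
    · rw [Set.indicator_of_mem hX2, Set.indicator_of_mem (show X ∈ {X : MM d | ‖X‖ ≤ R ∧ Mv Z X ∈ bx L U} from ⟨hX, hX2⟩), mul_one]
      exact ENNReal.ofReal_le_ofReal (by linarith [norm_nonneg X])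
    · rw [Set.indicator_of_notMem hX2, mul_zero]; exact zero_le
  · have : rho R X = 0 := ENNReal.ofReal_of_nonpos (by linarith)
    rw [this, zero_mul]; exact zero_le

theorem step2 {d k : ℕ} (hkd : k + k ≤ d) (R : ℝ) (hR : 1 ≤ R) {τ : ℝ} (hτ : 0 < τ)
    (Z Z' : II k → EE d) (hZ : ∀ a, ‖Z a‖ ≤ 1) (hZ' : ∀ a, ‖Z' a‖ ≤ 1)
    (hg' : Good τ Z') (s : ℝ) (hs : 0 ≤ s) (hZZ : ∀ a, ‖Z a - Z' a‖ ≤ s)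
    (L U L' U' : JJ k → ℝ) (hLU : ∀ p, L p < U p) (hLU' : ∀ p, L' p < U' p)
    (h1 : ∀ p, |L p| ≤ s) (h2 : ∀ p, |U p| ≤ s) (h3 : ∀ p, |L' p| ≤ s) (h4 : ∀ p, |U' p| ≤ s)
    (m : ℝ)
    (hm : m = Fintype.card (JJ k) * (1 / τ) ^ 2 * (4 * s * R + s)) (hm2 : m ≤ 1 / 2) :
    Wq R Z (bx L U) * volume (bx L' U') ≤ ENNReal.ofReal (1 + 2 * m) ^ (d * d + d * d) *
      (Wq R Z' (bx L' U') + 2 * (ENNReal.ofReal m * VC d k (R + 1) τ * volume (bx L' U'))) *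
      volume (bx L U) := by
  have hm0 : 0 ≤ m := by rw [hm]; positivity
  set K := ENNReal.ofReal (1 + 2 * m) ^ (d * d) with hK
  have hK1 : 1 ≤ K := by
    refine one_le_pow₀ ?_
    rw [← ENNReal.ofReal_one]; exact ENNReal.ofReal_le_ofReal (by linarith)
  have hKt : K ≠ ⊤ := ENNReal.pow_ne_top ENNReal.ofReal_ne_top
  set V := VC d k (R + 1) τ with hV
  have hVt : V ≠ ⊤ := ENNReal.mul_ne_top (ENNReal.pow_ne_top ENNReal.ofReal_ne_top)
    (ENNReal.pow_ne_top ENNReal.ofReal_ne_top)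
  have hQt : ∀ L U : JJ k → ℝ, volume (bx L U) ≠ ⊤ := fun L U => by
    rw [vol_bx]; exact ENNReal.prod_ne_top fun _ _ => ENNReal.ofReal_ne_top
  have hbd : ∀ L U q : JJ k → ℝ, (∀ p, |L p| ≤ s) → (∀ p, |U p| ≤ s) → q ∈ bx L U →
      ∀ p, |q p| ≤ s := by
    intro L U q hL hU hq p
    have := hq p (Set.mem_univ p)
    have a1 := abs_le.mp (hL p)
    have a2 := abs_le.mp (hU p)
    exact abs_le.mpr ⟨by linarith [this.1], by linarith [this.2]⟩
  have i1 : ∀ (L U : JJ k → ℝ) (c : ENNReal), c ≠ ⊤ →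
      ∫⁻ q, (bx L U).indicator (fun _ => 1) q * c = volume (bx L U) * c := by
    intro L U c hc
    rw [lintegral_mul_const' _ _ hc, lintegral_indicator_const (meas_bx L U), one_mul]
  have hWt : ∀ L U, (∀ p, L p < U p) → Wq R Z' (bx L U) ≠ ⊤ := by
    intro L U hLU
    refine ne_top_of_le_ne_top ?_ (show Wq R Z' (bx L U) ≤ ENNReal.ofReal R * Vq R Z' (bx L U) from ?_)
    · refine ENNReal.mul_ne_top ENNReal.ofReal_ne_top
        (ne_top_of_le_ne_top ?_ (V_good' hkd R hR hτ Z' hZ' hg' L U hLU))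
      exact ENNReal.mul_ne_top (ENNReal.mul_ne_top (ENNReal.pow_ne_top ENNReal.ofReal_ne_top)
        (ENNReal.pow_ne_top ENNReal.ofReal_ne_top)) (hQt _ _)
    · exact Wq_le R Z' L U
  calc Wq R Z (bx L U) * volume (bx L' U')
      ≤ ∫⁻ q, (bx L' U').indicator (fun _ => 1) q * Wq R Z (bx L U) := by
        by_cases ht : Wq R Z (bx L U) = ⊤
        · have := step1 hkd R hR hτ Z Z' hZ hZ' hg' s hs hZZ L U hLU 0 (fun p => by simpa using hs) m hm hm2
          rw [ht, top_le_iff] at this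
          simp only [add_zero] at this
          exact absurd this (ENNReal.mul_ne_top hKt (ENNReal.add_ne_top.mpr ⟨hWt L U hLU,
            ENNReal.mul_ne_top ENNReal.ofReal_ne_top (ENNReal.mul_ne_top hVt (hQt _ _))⟩))
        · rw [i1 _ _ _ ht, mul_comm]
    _ ≤ ∫⁻ q, K * ((bx L' U').indicator (fun _ => 1) q * Wq R Z' (bx (L + q) (U + q)) +
          (bx L' U').indicator (fun _ => 1) q * (ENNReal.ofReal m * (V * volume (bx L U)))) := by
        refine lintegral_mono fun q => ?_
        by_cases hq : q ∈ bx L' U'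
        · simp only [Set.indicator_of_mem hq, one_mul]
          exact step1 hkd R hR hτ Z Z' hZ hZ' hg' s hs hZZ L U hLU q (hbd _ _ _ h3 h4 hq) m hm hm2
        · simp only [Set.indicator_of_notMem hq, zero_mul]; exact zero_le
    _ = K * ((∫⁻ q, (bx L' U').indicator (fun _ => 1) q * Wq R Z' (bx (L + q) (U + q))) +
          volume (bx L' U') * (ENNReal.ofReal m * (V * volume (bx L U)))) := by
        rw [lintegral_const_mul' _ _ hKt, lintegral_add_right, i1]
        · exact ENNReal.mul_ne_top ENNReal.ofReal_ne_top (ENNReal.mul_ne_top hVt (hQt _ _))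
        · exact (measurable_const.indicator (meas_bx L' U')).mul measurable_const
    _ = K * ((∫⁻ q, (bx L U).indicator (fun _ => 1) q * Wq R Z' (bx (L' + q) (U' + q))) +
          volume (bx L' U') * (ENNReal.ofReal m * (V * volume (bx L U)))) := by rw [swapQ]
    _ ≤ K * (volume (bx L U) * (K * (Wq R Z' (bx L' U') +
          ENNReal.ofReal m * (V * volume (bx L' U')))) +
          volume (bx L' U') * (ENNReal.ofReal m * (V * volume (bx L U)))) := by
        refine mul_le_mul_right (add_le_add_left ?_ _) _
        rw [← i1]
        · refine lintegral_mono fun q => ?_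
          by_cases hq : q ∈ bx L U
          · simp only [Set.indicator_of_mem hq, one_mul]
            have := step1 hkd R hR hτ Z' Z' hZ' hZ' hg' s hs (fun a => by simpa using hs) (L' + q) (U' + q)
              (fun p => by simpa using hLU' p) (-q)
              (fun p => by simpa using hbd _ _ _ h1 h2 hq p) m hm hm2
            simp only [add_neg_cancel_right] at this
            refine this.trans (le_of_eq ?_)
            simp [vol_bx, hK, hV]
          · simp only [Set.indicator_of_notMem hq, zero_mul]; exact zero_le
        · exact ENNReal.mul_ne_top hKt (ENNReal.add_ne_top.mpr ⟨hWt L' U' hLU',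
            ENNReal.mul_ne_top ENNReal.ofReal_ne_top (ENNReal.mul_ne_top hVt (hQt _ _))⟩)
    _ ≤ K * (volume (bx L U) * (K * (Wq R Z' (bx L' U') +
          ENNReal.ofReal m * (V * volume (bx L' U')))) +
          K * (volume (bx L' U') * (ENNReal.ofReal m * (V * volume (bx L U))))) := by
        refine mul_le_mul_right (add_le_add_right ?_ _) _
        exact le_mul_of_one_le_left zero_le hK1
    _ = _ := by rw [pow_add, ← hK]; ring

/-- normalised weighted measure -/
def Gh {d k : ℕ} (R : ℝ) (L U : JJ k → ℝ) (Z : II k → EE d) : ENNReal :=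
  Wq R Z (bx L U) / volume (bx L U)

theorem one_add_pow_le (x : ℝ) (h0 : 0 ≤ x) (h1 : x ≤ 1) (n : ℕ) : (1 + x) ^ n ≤ 1 + 3 ^ n * x := by
  induction n with
  | zero => simpa using h0
  | succ n ih =>
    rw [pow_succ, pow_succ]
    have h3 : (1 : ℝ) ≤ 3 ^ n := one_le_pow₀ (by norm_num)
    have : (1 + x) ^ n * (1 + x) ≤ (1 + 3 ^ n * x) * (1 + x) := by gcongr
    nlinarith [mul_nonneg (by linarith : (0 : ℝ) ≤ 3 ^ n) (mul_nonneg h0 (sub_nonneg.mpr h1))]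

theorem bx_pos {k : ℕ} (L U : JJ k → ℝ) (hLU : ∀ p, L p < U p) :
    volume (bx L U) ≠ 0 ∧ volume (bx L U) ≠ ⊤ := by
  rw [vol_bx]
  refine ⟨?_, ENNReal.prod_ne_top fun _ _ => ENNReal.ofReal_ne_top⟩
  rw [Finset.prod_ne_zero_iff]
  intro p _
  simpa using hLU p

theorem Gh_le {d k : ℕ} (hkd : k + k ≤ d) (R : ℝ) (hR : 1 ≤ R) {τ : ℝ} (hτ : 0 < τ)
    (Z : II k → EE d) (hZ : ∀ a, ‖Z a‖ ≤ 1) (hg : Good τ Z)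
    (L U : JJ k → ℝ) (hLU : ∀ p, L p < U p) :
    Gh R L U Z ≤ ENNReal.ofReal R * VC d k (R + 1) τ := by
  obtain ⟨h0, ht⟩ := bx_pos L U hLU
  rw [Gh, ENNReal.div_le_iff h0 ht, mul_assoc]
  refine (Wq_le R Z L U).trans (mul_le_mul_right ?_ _)
  refine le_trans ?_ (V_good' hkd (R + 1) (by linarith) hτ Z hZ hg L U hLU)
  exact measure_mono fun X hX => ⟨hX.1.trans (by linarith), hX.2⟩

theorem good_cmp {d k : ℕ} (hkd : k + k ≤ d) (R : ℝ) (hR : 1 ≤ R) :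
    ∃ C : ℝ, 0 < C ∧ ∀ τ : ℝ, 0 < τ → ∀ (Z Z' : II k → EE d),
    (∀ a, ‖Z a‖ ≤ 1) → (∀ a, ‖Z' a‖ ≤ 1) → Good τ Z → Good τ Z' → ∀ s : ℝ, 0 ≤ s →
    (∀ a, ‖Z a - Z' a‖ ≤ s) → ∀ L U L' U' : JJ k → ℝ, (∀ p, L p < U p) → (∀ p, L' p < U' p) →
    (∀ p, |L p| ≤ s) → (∀ p, |U p| ≤ s) → (∀ p, |L' p| ≤ s) → (∀ p, |U' p| ≤ s) →
    Gh R L U Z ≤ Gh R L' U' Z' + ENNReal.ofReal (C * (1 / τ) ^ (Fintype.card (II k) * (k - 1) + 2) * s) := by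
  set J := (Fintype.card (JJ k) : ℝ)
  set A := (2 * (R + 1)) ^ (d * d + Fintype.card (II k × II k)) with hA
  have hA0 : 0 < A := by positivity
  set c1 := Fintype.card (II k) * (k - 1) with hc1
  set M := (3 : ℝ) ^ (d * d + d * d) with hM
  have hM0 : 0 < M := by positivity
  have hJ0 : 0 ≤ J := Nat.cast_nonneg _
  have hVC : ∀ τ, 0 < τ → VC d k (R + 1) τ = ENNReal.ofReal (A * (1 / τ) ^ c1) := by
    intro τ hτ
    rw [VC, ENNReal.ofReal_mul hA0.le, ENNReal.ofReal_pow (by positivity),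
      ENNReal.ofReal_pow (by positivity)]
  -- total: m * (stuff)
  refine ⟨(2 * M * R * A + 2 * (1 + M) * A) * (J * (5 * R)) + 1, by positivity, ?_⟩
  intro τ hτ Z Z' hZ hZ' hg hg' s hs hZZ L U L' U' hLU hLU' h1 h2 h3 h4
  set m := J * (1 / τ) ^ 2 * (4 * s * R + s) with hm
  have hm0 : 0 ≤ m := by positivity
  have hmle : m ≤ (1 / τ) ^ 2 * (J * (5 * R)) * s := by
    rw [hm]
    have : 4 * s * R + s ≤ 5 * R * s := by nlinarith
    calc J * (1 / τ) ^ 2 * (4 * s * R + s) ≤ J * (1 / τ) ^ 2 * (5 * R * s) := by gcongr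
      _ = _ := by ring
  have hfin : (2 * M * R * A + 2 * (1 + M) * A) * (1 / τ) ^ c1 * m ≤
      ((2 * M * R * A + 2 * (1 + M) * A) * (J * (5 * R)) + 1) * (1 / τ) ^ (c1 + 2) * s := by
    calc _ ≤ (2 * M * R * A + 2 * (1 + M) * A) * (1 / τ) ^ c1 * ((1 / τ) ^ 2 * (J * (5 * R)) * s) := by
          gcongr
      _ = ((2 * M * R * A + 2 * (1 + M) * A) * (J * (5 * R))) * (1 / τ) ^ (c1 + 2) * s := by ring
      _ ≤ _ := by gcongr; linarith
  by_cases hm2 : m ≤ 1 / 2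
  · obtain ⟨q0, qt⟩ := bx_pos L U hLU
    obtain ⟨q0', qt'⟩ := bx_pos L' U' hLU'
    have hst := step2 hkd R hR hτ Z Z' hZ hZ' hg' s hs hZZ L U L' U' hLU hLU' h1 h2 h3 h4 m hm hm2
    have h5 : Gh R L U Z ≤ ENNReal.ofReal (1 + 2 * m) ^ (d * d + d * d) *
        (Gh R L' U' Z' + 2 * (ENNReal.ofReal m * VC d k (R + 1) τ)) := by
      rw [Gh, ENNReal.div_le_iff q0 qt, ← ENNReal.mul_le_mul_iff_left q0' qt']
      refine hst.trans (le_of_eq ?_)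
      have : Wq R Z' (bx L' U') = Gh R L' U' Z' * volume (bx L' U') := by
        rw [Gh, ENNReal.div_mul_cancel q0' qt']
      rw [this]; ring
    have h6 : ENNReal.ofReal (1 + 2 * m) ^ (d * d + d * d) ≤ 1 + ENNReal.ofReal (2 * M * m) := by
      rw [← ENNReal.ofReal_pow (by linarith), ← ENNReal.ofReal_one,
        ← ENNReal.ofReal_add zero_le_one (by positivity)]
      refine ENNReal.ofReal_le_ofReal ?_
      have := one_add_pow_le (2 * m) (by linarith) (by linarith) (d * d + d * d)
      linarith
    have h7 := Gh_le hkd R hR hτ Z' hZ' hg' L' U' hLU'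
    calc Gh R L U Z ≤ (1 + ENNReal.ofReal (2 * M * m)) *
          (Gh R L' U' Z' + 2 * (ENNReal.ofReal m * VC d k (R + 1) τ)) :=
          h5.trans (mul_le_mul_left h6 _)
      _ = Gh R L' U' Z' + (ENNReal.ofReal (2 * M * m) * Gh R L' U' Z' +
        (1 + ENNReal.ofReal (2 * M * m)) * (2 * (ENNReal.ofReal m * VC d k (R + 1) τ))) := by ring
      _ ≤ Gh R L' U' Z' + (ENNReal.ofReal (2 * M * m) * (ENNReal.ofReal R * VC d k (R + 1) τ) +
        (1 + ENNReal.ofReal (2 * M * m)) * (2 * (ENNReal.ofReal m * VC d k (R + 1) τ))) := by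
          refine add_le_add_right (add_le_add_left (mul_le_mul_right h7 _) _) _
      _ = Gh R L' U' Z' + ENNReal.ofReal (2 * M * m * (R * (A * (1 / τ) ^ c1)) +
        (1 + 2 * M * m) * (2 * (m * (A * (1 / τ) ^ c1)))) := by
          rw [hVC τ hτ]
          rw [ENNReal.ofReal_add (by positivity) (by positivity), ENNReal.ofReal_mul (by positivity : (0 : ℝ) ≤ 2 * M * m),
            ENNReal.ofReal_mul (by positivity : (0 : ℝ) ≤ R),
            ENNReal.ofReal_mul (by positivity : (0 : ℝ) ≤ 1 + 2 * M * m),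
            ENNReal.ofReal_mul (by positivity : (0 : ℝ) ≤ 2), ENNReal.ofReal_mul hm0,
            ENNReal.ofReal_add zero_le_one (by positivity), ENNReal.ofReal_one,
            ENNReal.ofReal_ofNat]
      _ ≤ _ := by
          refine add_le_add_right (ENNReal.ofReal_le_ofReal (le_trans ?_ hfin)) _
          have hB : 0 ≤ A * (1 / τ) ^ c1 * m := by positivity
          have : 2 * M * m * (R * (A * (1 / τ) ^ c1)) + (1 + 2 * M * m) * (2 * (m * (A * (1 / τ) ^ c1)))
            = (2 * M * R + 2 * (1 + 2 * M * m)) * (A * (1 / τ) ^ c1 * m) := by ring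
          rw [this]
          have h8 : (2 * M * R + 2 * (1 + 2 * M * m)) ≤ 2 * M * R + 2 * (1 + M) := by nlinarith
          calc _ ≤ (2 * M * R + 2 * (1 + M)) * (A * (1 / τ) ^ c1 * m) := by gcongr
            _ = _ := by ring
  · refine (Gh_le hkd R hR hτ Z hZ hg L U hLU).trans ?_
    rw [hVC τ hτ, ← ENNReal.ofReal_mul (by linarith)]
    refine le_trans (ENNReal.ofReal_le_ofReal (le_trans ?_ hfin)) le_add_self
    push Not at hm2
    have hM1 : 1 ≤ M := one_le_pow₀ (by norm_num)
    have hB : 0 ≤ A * (1 / τ) ^ c1 := by positivity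
    calc R * (A * (1 / τ) ^ c1) ≤ (2 * M * R * m) * (A * (1 / τ) ^ c1) := by
          gcongr
          have : 1 ≤ 2 * M * m := by nlinarith
          nlinarith
      _ ≤ (2 * M * R * m + 2 * (1 + M) * m) * (A * (1 / τ) ^ c1) := by
          gcongr
          have : 0 ≤ 2 * (1 + M) * m := by positivity
          linarith
      _ = _ := by ring

open Classical in
def Phi {d : ℕ} (k : ℕ) (t τ : ℝ) (u : EE d) (W : Submodule ℝ (EE d)) : ENNReal :=
  if ‖u‖ < 1 ∧ Metric.infDist u (W : Set (EE d)) < τ then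
    ENNReal.ofReal (1 / max (Metric.infDist u (W : Set (EE d))) (t ^ 2)) ^ (k - 1) else 0

theorem Phi_ne_top {d : ℕ} (k : ℕ) (t τ : ℝ) (u : EE d) (W : Submodule ℝ (EE d)) :
    Phi k t τ u W ≠ ⊤ := by
  unfold Phi; split_ifs
  · exact ENNReal.pow_ne_top ENNReal.ofReal_ne_top
  · simp

theorem dyadic (τ M : ℝ) (hM : 0 < M) (h : M < τ) :
    ∃ j : ℕ, τ * (1 / 2) ^ (j + 1) ≤ M ∧ M < τ * (1 / 2) ^ j := by
  classical
  have hτ : 0 < τ := hM.trans h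
  have hex : ∃ j : ℕ, τ * (1 / 2) ^ j ≤ M := by
    obtain ⟨j, hj⟩ := exists_pow_lt_of_lt_one (show 0 < M / τ by positivity) (show (1 / 2 : ℝ) < 1 by norm_num)
    refine ⟨j, ?_⟩
    rw [lt_div_iff₀ hτ] at hj; linarith
  have h1 := Nat.find_spec hex
  rcases hn : Nat.find hex with _ | j
  · rw [hn] at h1; simp at h1; linarith
  · refine ⟨j, by rw [hn] at h1; exact h1, ?_⟩
    have := Nat.find_min hex (m := j) (by omega)
    exact not_le.mp this

theorem tube_level {d k l : ℕ} (hk : 1 ≤ k) (hl : l + 2 * k ≤ d) (H : ℝ) (hH : 0 ≤ H)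
    (π : EE d → EE d) (t : ℝ) (ht : 0 < t) (hπ : ∀ x, ‖π x - x‖ ≤ H * t) (z : Fin l → EE d)
    (lam : ℝ) (h1 : t ^ 2 ≤ lam) (h2 : lam ≤ 1) :
    volume {x : EE d | ‖π x‖ < 1 ∧
      Metric.infDist (π x) (Submodule.span ℝ (Set.range z) : Set (EE d)) < lam} ≤
      ENNReal.ofReal ((2 * (1 + H)) ^ d * lam ^ k) := by
  have hl0 : 0 < lam := lt_of_lt_of_le (by positivity) h1
  have hts : t ≤ √lam := Real.le_sqrt_of_sq_le h1
  have hs1 : √lam ≤ 1 := Real.sqrt_le_one.mpr h2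
  have hs0 : 0 < √lam := Real.sqrt_pos.mpr hl0
  have hls : lam ≤ √lam := by nlinarith [Real.sq_sqrt hl0.le]
  refine (measure_mono ?_).trans ((tube_vol (by omega) z (1 + H) (lam + H * t) (by positivity)).trans ?_)
  · rintro x ⟨hx1, hx2⟩
    have h3 := hπ x
    have h4 : ‖x‖ ≤ ‖π x‖ + ‖π x - x‖ := by
      have := norm_sub_norm_le x (π x); rw [norm_sub_rev] at this; linarith
    refine ⟨?_, ?_⟩
    · have : H * t ≤ H := by nlinarith
      linarith
    · have := Metric.infDist_le_infDist_add_dist (s := (Submodule.span ℝ (Set.range z) : Set (EE d)))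
        (x := x) (y := π x)
      rw [dist_comm, dist_eq_norm] at this
      linarith
  · rw [← ENNReal.ofReal_pow (by positivity), ← ENNReal.ofReal_pow (by positivity),
      ← ENNReal.ofReal_mul (by positivity)]
    refine ENNReal.ofReal_le_ofReal ?_
    have h5 : 2 * (lam + H * t) ≤ 2 * (1 + H) * √lam := by nlinarith
    have hd : d = l + (d - l) := by omega
    calc (2 * (1 + H)) ^ l * (2 * (lam + H * t)) ^ (d - l)
        ≤ (2 * (1 + H)) ^ l * (2 * (1 + H) * √lam) ^ (d - l) := by gcongr
      _ = (2 * (1 + H)) ^ d * √lam ^ (d - l) := by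
          rw [mul_pow _ (√lam), ← mul_assoc, ← pow_add, ← hd]
      _ ≤ (2 * (1 + H)) ^ d * √lam ^ (2 * k) := by
          gcongr ?_ * ?_
          exact pow_le_pow_of_le_one hs0.le hs1 (by omega)
      _ = _ := by rw [pow_mul, Real.sq_sqrt hl0.le]

theorem tube_int {d k l : ℕ} (hk : 1 ≤ k) (hl : l + 2 * k ≤ d) (H : ℝ) (hH : 0 ≤ H)
    (π : EE d → EE d) (hm : Measurable π) (t : ℝ) (ht : 0 < t)
    (hπ : ∀ x, ‖π x - x‖ ≤ H * t) (z : Fin l → EE d)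
    (τ : ℝ) (h1 : t ^ 2 < τ) (h2 : τ ≤ 1) :
    ∫⁻ x : EE d, Phi k t τ (π x) (Submodule.span ℝ (Set.range z)) ≤
      ENNReal.ofReal ((2 * (1 + H)) ^ d * 2 ^ k * τ) := by
  classical
  set W := Submodule.span ℝ (Set.range z) with hW
  have hτ : 0 < τ := lt_trans (by positivity) h1
  let lam : ℕ → ℝ := fun j => τ * (1 / 2) ^ j
  have hlam0 : ∀ j, 0 < lam j := fun j => by positivity
  have hlam1 : ∀ j, lam j ≤ 1 := fun j => by
    have : ((1 : ℝ) / 2) ^ j ≤ 1 := pow_le_one₀ (by norm_num) (by norm_num)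
    calc lam j ≤ τ * 1 := by simp only [lam]; gcongr
      _ ≤ 1 := by linarith
  let S : ℕ → Set (EE d) := fun j => {x | ‖π x‖ < 1 ∧ Metric.infDist (π x) (W : Set (EE d)) < lam j}
  have hS : ∀ j, MeasurableSet (S j) := fun j =>
    (measurableSet_lt hm.norm measurable_const).inter
      (measurableSet_lt ((Metric.continuous_infDist_pt _).measurable.comp hm) measurable_const)
  let c : ℕ → ENNReal := fun j => if t ^ 2 ≤ lam j then ENNReal.ofReal (2 / lam j) ^ (k - 1) else 0
  have hpt : ∀ x, Phi k t τ (π x) W ≤ ∑' j, (S j).indicator (fun _ => c j) x := by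
    intro x
    unfold Phi
    split_ifs with h
    · set D := Metric.infDist (π x) (W : Set (EE d)) with hD
      have hMpos : 0 < max D (t ^ 2) := lt_max_of_lt_right (by positivity)
      obtain ⟨j, hj1, hj2⟩ := dyadic τ (max D (t ^ 2)) hMpos (max_lt h.2 h1)
      refine le_trans ?_ (ENNReal.le_tsum j)
      have hxS : x ∈ S j := ⟨h.1, lt_of_le_of_lt (le_max_left _ _) hj2⟩
      rw [Set.indicator_of_mem hxS]
      have : t ^ 2 ≤ lam j := (le_max_right D _).trans hj2.le
      simp only [c, if_pos this]
      gcongr ENNReal.ofReal ?_ ^ _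
      rw [div_le_div_iff₀ hMpos (hlam0 j)]
      have : lam j = 2 * (τ * (1 / 2) ^ (j + 1)) := by simp only [lam]; ring
      linarith
    · exact zero_le
  have hterm : ∀ j, c j * volume (S j) ≤ ENNReal.ofReal ((2 * (1 + H)) ^ d * 2 ^ (k - 1) * lam j) := by
    intro j
    by_cases hj : t ^ 2 ≤ lam j
    · simp only [c, if_pos hj]
      refine (mul_le_mul_right (tube_level hk hl H hH π t ht hπ z (lam j) hj (hlam1 j)) _).trans ?_
      rw [← ENNReal.ofReal_pow (by have := hlam0 j; positivity), ← ENNReal.ofReal_mul (by have := hlam0 j; positivity)]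
      refine ENNReal.ofReal_le_ofReal (le_of_eq ?_)
      obtain ⟨k', rfl⟩ : ∃ k', k = k' + 1 := ⟨k - 1, by omega⟩
      have := (hlam0 j).ne'
      simp only [Nat.add_sub_cancel]
      rw [div_pow, pow_succ (lam j)]
      field_simp
    · simp only [c, if_neg hj, zero_mul]; exact zero_le
  have hsum : HasSum (fun j => (2 * (1 + H)) ^ d * 2 ^ (k - 1) * lam j)
      ((2 * (1 + H)) ^ d * 2 ^ (k - 1) * (τ * 2)) :=
    (hasSum_geometric_two.mul_left τ).mul_left _
  calc ∫⁻ x : EE d, Phi k t τ (π x) W ≤ ∫⁻ x, ∑' j, (S j).indicator (fun _ => c j) x :=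
        lintegral_mono hpt
    _ = ∑' j, ∫⁻ x, (S j).indicator (fun _ => c j) x :=
        lintegral_tsum fun j => (measurable_const.indicator (hS j)).aemeasurable
    _ = ∑' j, c j * volume (S j) := by
        congr 1; ext j; rw [lintegral_indicator_const (hS j)]
    _ ≤ ∑' j, ENNReal.ofReal ((2 * (1 + H)) ^ d * 2 ^ (k - 1) * lam j) := ENNReal.tsum_le_tsum hterm
    _ = ENNReal.ofReal (∑' j, (2 * (1 + H)) ^ d * 2 ^ (k - 1) * lam j) :=
        (ENNReal.ofReal_tsum_of_nonneg (fun j => by have := hlam0 j; positivity) hsum.summable).symm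
    _ = _ := by
        rw [hsum.tsum_eq]
        congr 1
        obtain ⟨k', rfl⟩ : ∃ k', k = k' + 1 := ⟨k - 1, by omega⟩
        simp only [Nat.add_sub_cancel]; ring

theorem seq_int {d M : ℕ} (m : ℕ) (hm : m ≤ M) (π : Fin m → EE d → EE d)
    (F : Fin m → EE d → Submodule ℝ (EE d) → ENNReal) (hF : ∀ j u W, F j u W ≠ ⊤)
    (C : Fin m → ENNReal) (hCt : ∀ j, C j ≠ ⊤)
    (hC : ∀ j, ∀ l, l < M → ∀ z : Fin l → EE d,
      ∫⁻ x : EE d, F j (π j x) (Submodule.span ℝ (Set.range z)) ≤ C j) :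
    ∫⁻ w : Fin m → EE d, ∏ j, F j (π j (w j))
      (Submodule.span ℝ ((fun i => π i (w i)) '' Set.Iio j)) ≤ ∏ j, C j := by
  induction m with
  | zero => simp [volume_pi]
  | succ m ih =>
    set G : (Fin (m + 1) → EE d) → ENNReal := fun w => ∏ j, F j (π j (w j))
      (Submodule.span ℝ ((fun i => π i (w i)) '' Set.Iio j)) with hG
    have e := volume_preserving_piFinSuccAbove (fun _ : Fin (m + 1) => EE d) (Fin.last m)
    have h1 : ∫⁻ w, G w = ∫⁻ p : EE d × (Fin m → EE d),
        G ((MeasurableEquiv.piFinSuccAbove (fun _ => EE d) (Fin.last m)).symm p) := by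
      rw [← e.lintegral_comp_emb (MeasurableEquiv.measurableEmbedding _)]
      simp only [MeasurableEquiv.symm_apply_apply]
    rw [h1]
    change ∫⁻ p : EE d × (Fin m → EE d), _ ∂(volume.prod volume) ≤ _
    rw [← lintegral_prod_swap]
    refine (lintegral_prod_le _).trans ?_
    have hval : ∀ (w : Fin m → EE d) (x : EE d),
        G ((MeasurableEquiv.piFinSuccAbove (fun _ => EE d) (Fin.last m)).symm (x, w)) =
        (∏ j : Fin m, F j.castSucc (π j.castSucc (w j))
          (Submodule.span ℝ ((fun i : Fin m => π i.castSucc (w i)) '' Set.Iio j))) *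
        F (Fin.last m) (π (Fin.last m) x)
          (Submodule.span ℝ (Set.range fun i : Fin m => π i.castSucc (w i))) := by
      intro w x
      have hv : (MeasurableEquiv.piFinSuccAbove (fun _ => EE d) (Fin.last m)).symm (x, w) =
          Fin.snoc (α := fun _ => EE d) w x := by
        simp [MeasurableEquiv.piFinSuccAbove, Fin.insertNthEquiv]
      rw [hv]
      simp only [hG]
      rw [Fin.prod_univ_castSucc]
      congr 1
      · refine Finset.prod_congr rfl fun j _ => ?_
        rw [Fin.snoc_castSucc]
        congr 2
        ext u
        simp only [Set.mem_image, Set.mem_Iio]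
        constructor
        · rintro ⟨i, hi, rfl⟩
          obtain ⟨i', rfl⟩ : ∃ i' : Fin m, i = i'.castSucc := ⟨⟨i, lt_trans hi j.2⟩, rfl⟩
          exact ⟨i', hi, by rw [Fin.snoc_castSucc]⟩
        · rintro ⟨i, hi, rfl⟩
          exact ⟨i.castSucc, hi, by rw [Fin.snoc_castSucc]⟩
      · rw [Fin.snoc_last]
        congr 2
        ext u
        simp only [Set.mem_image, Set.mem_Iio, Set.mem_range]
        constructor
        · rintro ⟨i, hi, rfl⟩
          obtain ⟨i', rfl⟩ : ∃ i' : Fin m, i = i'.castSucc := ⟨⟨i, hi⟩, rfl⟩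
          exact ⟨i', by rw [Fin.snoc_castSucc]⟩
        · rintro ⟨i, rfl⟩
          exact ⟨i.castSucc, Fin.castSucc_lt_last i, by rw [Fin.snoc_castSucc]⟩
    simp only [Prod.swap_prod_mk, hval]
    have ih' := ih (by omega) (fun i => π i.castSucc) (fun i => F i.castSucc)
      (fun j => hF j.castSucc) (fun i => C i.castSucc) (fun j => hCt j.castSucc) (fun j => hC j.castSucc)
    calc _ ≤ ∫⁻ w : Fin m → EE d, (∏ j : Fin m, F j.castSucc (π j.castSucc (w j))
          (Submodule.span ℝ ((fun i : Fin m => π i.castSucc (w i)) '' Set.Iio j))) *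
          C (Fin.last m) := by
          refine lintegral_mono fun w => ?_
          simp only
          rw [lintegral_const_mul']
          · exact mul_le_mul_right (hC (Fin.last m) m (by omega) _) _
          · exact ENNReal.prod_ne_top fun j _ => hF _ _ _
      _ ≤ (∏ j : Fin m, C j.castSucc) * C (Fin.last m) := by
          rw [lintegral_mul_const' _ _ (hCt _)]
          exact mul_le_mul_left ih' _
      _ = _ := (Fin.prod_univ_castSucc _).symm

theorem bad_sigma {d k : ℕ} (hk : 1 ≤ k) (hd : 4 * k ≤ d + 1) (H : ℝ) (hH : 0 ≤ H)
    (σ : Fin (k + k) ≃ II k) (i0 : Fin (k + k)) (π : II k → EE d → EE d)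
    (hm : ∀ a, Measurable (π a)) (t : II k → ℝ) (ht : ∀ a, 0 < t a) (ht1 : ∀ a, t a < 1)
    (hπ : ∀ a x, ‖π a x - x‖ ≤ H * t a) (τ : ℝ) (hτ : ∀ a, t a ^ 2 < τ) (hτ1 : τ ≤ 1) :
    ∫⁻ w : II k → EE d, ∏ a, Phi k (t a) (if a = σ i0 then τ else 1) (π a (w a))
      (Submodule.span ℝ (((fun b => π b (w b)) ∘ σ) '' Set.Iio (σ.symm a))) ≤
    ENNReal.ofReal (((2 * (1 + H)) ^ d * 2 ^ k) ^ (k + k) * τ) := by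
  classical
  have e := volume_measurePreserving_piCongrLeft (fun _ : II k => EE d) σ
  rw [← e.lintegral_comp_emb (MeasurableEquiv.measurableEmbedding _)]
  set A := (2 * (1 + H)) ^ d * 2 ^ k with hA
  have hA0 : 0 < A := by positivity
  have hτ0 : 0 < τ := lt_trans (pow_pos (ht (σ i0)) 2) (hτ (σ i0))
  have hev : ∀ (w : Fin (k + k) → EE d) j,
      (MeasurableEquiv.piCongrLeft (fun _ : II k => EE d) σ) w (σ j) = w j := by
    intro w j
    exact Equiv.piCongrLeft_apply_apply (fun _ : II k => EE d) σ w j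
  have h1 := seq_int (d := d) (M := k + k) (k + k) le_rfl (fun j => π (σ j))
    (fun j => Phi k (t (σ j)) (if j = i0 then τ else 1)) (fun j u W => Phi_ne_top _ _ _ _ _)
    (fun j => ENNReal.ofReal (A * (if j = i0 then τ else 1))) (fun _ => ENNReal.ofReal_ne_top)
    (by
      intro j l hl z
      refine tube_int hk (by omega) H hH (π (σ j)) (hm _) (t (σ j)) (ht _) (hπ _) z _ ?_ ?_
      · split_ifs
        · exact hτ _
        · have := ht (σ j); have := ht1 (σ j); nlinarith
      · split_ifs
        · exact hτ1
        · exact le_rfl)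
  refine le_trans (le_of_eq ?_) (h1.trans (le_of_eq ?_))
  · refine lintegral_congr fun w => ?_
    rw [← Equiv.prod_comp σ]
    refine Finset.prod_congr rfl fun j _ => ?_
    rw [hev, Equiv.symm_apply_apply]
    simp only [EmbeddingLike.apply_eq_iff_eq]
    congr 4
    funext i
    simp only [Function.comp_apply, hev]
  · rw [← ENNReal.ofReal_prod_of_nonneg (fun j _ => by split_ifs <;> positivity)]
    rw [Finset.prod_mul_distrib, Finset.prod_const, Finset.card_univ, Fintype.card_fin]
    simp

def BadAt {d k : ℕ} (τ : ℝ) (l : II k) (Z : II k → EE d) : Prop :=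
  ∃ c : II k → ℝ, ‖∑ a, c a • Z a‖ < τ * |c l|

theorem BadAt.span {d k : ℕ} {τ : ℝ} {l : II k} {Z : II k → EE d} (h : BadAt τ l Z) :
    ∃ w ∈ Submodule.span ℝ (Z '' {l}ᶜ), ‖Z l - w‖ < τ := by
  classical
  obtain ⟨c, hc⟩ := h
  have hcl : c l ≠ 0 := by
    rintro h0
    rw [h0, abs_zero, mul_zero] at hc
    exact absurd hc (not_lt.mpr (norm_nonneg _))
  refine ⟨Z l - (c l)⁻¹ • ∑ a, c a • Z a, ?_, ?_⟩
  · rw [← Finset.add_sum_erase _ _ (Finset.mem_univ l), smul_add, smul_smul, inv_mul_cancel₀ hcl,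
      one_smul, sub_add_eq_sub_sub, sub_self, zero_sub]
    refine Submodule.neg_mem _ (Submodule.smul_mem _ _ (Submodule.sum_mem _ fun a ha => ?_))
    refine Submodule.smul_mem _ _ (Submodule.subset_span ⟨a, ?_, rfl⟩)
    simpa using (Finset.mem_erase.mp ha).1
  · rw [sub_sub_cancel, norm_smul, norm_inv, Real.norm_eq_abs]
    rw [inv_mul_lt_iff₀ (abs_pos.mpr hcl)]; linarith

theorem isOpen_BadAt {d k : ℕ} (τ : ℝ) (l : II k) : IsOpen {Z : II k → EE d | BadAt τ l Z} := by
  have : {Z : II k → EE d | BadAt τ l Z} = ⋃ c : II k → ℝ, {Z | ‖∑ a, c a • Z a‖ < τ * |c l|} := by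
    ext Z; simp [BadAt]
  rw [this]
  refine isOpen_iUnion fun c => isOpen_lt ?_ continuous_const
  fun_prop

theorem not_good_iff {d k : ℕ} (τ : ℝ) (Z : II k → EE d) : ¬ Good τ Z ↔ ∃ l, BadAt τ l Z := by
  unfold Good BadAt
  push Not
  exact exists_comm

theorem isClosed_good {d k : ℕ} (τ : ℝ) : IsClosed {Z : II k → EE d | Good τ Z} := by
  rw [← isOpen_compl_iff]
  have : {Z : II k → EE d | Good τ Z}ᶜ = ⋃ l, {Z | BadAt τ l Z} := by
    ext Z; simpa using not_good_iff τ Z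
  rw [this]
  exact isOpen_iUnion fun l => isOpen_BadAt τ l

theorem Gh_sigma {d k : ℕ} (hkd : k + k ≤ d) (R H : ℝ) (hR : 1 ≤ R) (hH : 1 ≤ H)
    (Z : II k → EE d) (hZ : ∀ a, ‖Z a‖ < 1) (σ : Fin (k + k) ≃ II k) (i0 : Fin (k + k))
    (t : II k → ℝ) (ht : ∀ a, 0 < t a) (ht1 : ∀ a, t a < 1) (L U : JJ k → ℝ)
    (hLU : ∀ p, t (e1 p) ^ 2 ≤ H * (U p - L p)) (hte : ∀ p, t (e1 p) = t (e2 p)) (τ : ℝ)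
    (hτ : rdist (Z ∘ σ) i0 < τ) :
    Gh R L U Z ≤ ENNReal.ofReal (R * ((2 * R) ^ (d * d) * (2 * R * H) ^ (Fintype.card (II k × II k)))) *
      ∏ a, Phi k (t a) (if a = σ i0 then τ else 1) (Z a)
      (Submodule.span ℝ ((Z ∘ σ) '' Set.Iio (σ.symm a))) := by
  classical
  have hLU' : ∀ p, L p < U p := by
    intro p
    have h1 := hLU p
    have h2 := pow_pos (ht (e1 p)) 2
    nlinarith
  obtain ⟨q0, qt⟩ := bx_pos L U hLU'
  have hV := V_bound hkd R H hR hH Z (fun a => (hZ a).le) σ (fun a => t a ^ 2)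
    (fun a => pow_pos (ht a) 2) (fun a => by have := ht a; have := ht1 a; nlinarith) L U hLU
    (fun p => by rw [hte p])
  simp only [WIN_iff] at hV
  rw [Gh, ENNReal.div_le_iff q0 qt]
  refine (Wq_le R Z L U).trans ((mul_le_mul_right hV _).trans (le_of_eq ?_))
  have hP : ∀ a, Phi k (t a) (if a = σ i0 then τ else 1) (Z a)
      (Submodule.span ℝ ((Z ∘ σ) '' Set.Iio (σ.symm a))) =
      ENNReal.ofReal (1 / om (fun a => t a ^ 2) Z σ a) ^ (k - 1) := by
    intro a
    have hr : Metric.infDist (Z a) (Submodule.span ℝ ((Z ∘ σ) '' Set.Iio (σ.symm a)) : Set (EE d))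
        = rdist (Z ∘ σ) (σ.symm a) := by simp [rdist]
    unfold Phi
    rw [if_pos, om, hr]
    refine ⟨hZ a, ?_⟩
    rw [hr]
    split_ifs with h
    · rw [h, Equiv.symm_apply_apply]; exact hτ
    · refine (rdist_le_norm _ _).trans_lt ?_
      simpa using hZ a
  rw [Finset.prod_congr rfl fun a _ => hP a, vol_bx,
    ENNReal.ofReal_mul (by positivity : (0:ℝ) ≤ R),
    ENNReal.ofReal_mul (by positivity : (0:ℝ) ≤ (2 * R) ^ (d * d)),
    ENNReal.ofReal_pow (by positivity : (0:ℝ) ≤ 2 * R),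
    ENNReal.ofReal_pow (by positivity : (0:ℝ) ≤ 2 * R * H)]
  ring

theorem exists_sigma {k : ℕ} (hk : 1 ≤ k) (l : II k) : ∃ (σ : Fin (k + k) ≃ II k) (i0 : Fin (k + k)),
    σ i0 = l ∧ ({l}ᶜ : Set (II k)) ⊆ σ '' Set.Iio i0 := by
  classical
  let σ0 : Fin (k + k) ≃ II k := finSumFinEquiv.symm
  let i0 : Fin (k + k) := ⟨k + k - 1, by omega⟩
  refine ⟨σ0.trans (Equiv.swap (σ0 i0) l), i0, by simp, ?_⟩
  intro a ha
  refine ⟨(σ0.trans (Equiv.swap (σ0 i0) l)).symm a, ?_, by simp⟩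
  have h1 : (σ0.trans (Equiv.swap (σ0 i0) l)).symm a ≠ i0 := by
    intro h
    rw [Equiv.symm_apply_eq] at h
    simp at h; exact ha h
  refine lt_of_le_of_ne ?_ h1
  rw [Fin.le_def]
  have := ((σ0.trans (Equiv.swap (σ0 i0) l)).symm a).2
  simp only [i0]; omega

def BC (d k : ℕ) (R H : ℝ) : ℝ :=
  2 * k * ((R * ((2 * R) ^ (d * d) * (2 * R * H) ^ (Fintype.card (II k × II k)))) *
    ((2 * (1 + H)) ^ d * 2 ^ k) ^ (k + k))

theorem BC_nonneg {d k : ℕ} {R H : ℝ} (hR : 1 ≤ R) (hH : 1 ≤ H) : 0 ≤ BC d k R H := by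
  unfold BC; positivity

theorem bad_bound {d k : ℕ} (hk : 1 ≤ k) (hd : 4 * k ≤ d + 1) (R H : ℝ) (hR : 1 ≤ R) (hH : 1 ≤ H)
    (π : II k → EE d → EE d)
    (hm : ∀ a, Measurable (π a)) (t : II k → ℝ) (ht : ∀ a, 0 < t a) (ht1 : ∀ a, t a < 1)
    (hπ : ∀ a x, ‖π a x - x‖ ≤ H * t a) (L U : JJ k → ℝ)
    (hLU : ∀ p, t (e1 p) ^ 2 ≤ H * (U p - L p)) (hte : ∀ p, t (e1 p) = t (e2 p))
    (τ : ℝ) (hτ : ∀ a, t a ^ 2 < τ) (hτ1 : τ ≤ 1) :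
    ∫⁻ w in {w : II k → EE d | (∀ a, ‖π a (w a)‖ < 1) ∧ ¬ Good τ fun a => π a (w a)},
      Gh R L U (fun a => π a (w a)) ≤ ENNReal.ofReal (BC d k R H * τ) := by
  classical
  set A := R * ((2 * R) ^ (d * d) * (2 * R * H) ^ (Fintype.card (II k × II k))) with hA
  have hA0 : 0 < A := by positivity
  set A2 := ((2 * (1 + H)) ^ d * 2 ^ k) ^ (k + k) with hA2
  have hA20 : 0 < A2 := by positivity
  have hmZ : Measurable fun (w : II k → EE d) (a : II k) => π a (w a) :=
    measurable_pi_lambda _ fun a => (hm a).comp (measurable_pi_apply a)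
  set S : II k → Set (II k → EE d) := fun l =>
    {w | (∀ a, ‖π a (w a)‖ < 1) ∧ BadAt τ l fun a => π a (w a)} with hS
  have hSm : ∀ l, MeasurableSet (S l) := by
    intro l
    refine MeasurableSet.inter ?_ (hmZ (isOpen_BadAt τ l).measurableSet)
    have : {w : II k → EE d | ∀ a, ‖π a (w a)‖ < 1} = ⋂ a, {w | ‖π a (w a)‖ < 1} := by
      ext w; simp
    show MeasurableSet {w : II k → EE d | ∀ a, ‖π a (w a)‖ < 1}
    rw [this]
    exact MeasurableSet.iInter fun a =>
      measurableSet_lt ((hm a).comp (measurable_pi_apply a)).norm measurable_const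
  have hU : {w : II k → EE d | (∀ a, ‖π a (w a)‖ < 1) ∧ ¬ Good τ fun a => π a (w a)} =
      ⋃ l, S l := by
    ext w
    simp only [Set.mem_setOf_eq, not_good_iff, Set.mem_iUnion, hS, exists_and_left]
  rw [hU]
  refine (lintegral_iUnion_le _ _).trans ?_
  rw [tsum_fintype]
  have hl : ∀ l, ∫⁻ w in S l, Gh R L U (fun a => π a (w a)) ≤ ENNReal.ofReal (A * A2 * τ) := by
    intro l
    obtain ⟨σ, i0, h1, h2⟩ := exists_sigma hk l
    have hb := bad_sigma hk hd H (by linarith) σ i0 π hm t ht ht1 hπ τ hτ hτ1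
    rw [← lintegral_indicator (hSm l), mul_assoc, ENNReal.ofReal_mul hA0.le]
    refine le_trans ?_ (mul_le_mul_right hb _)
    rw [← lintegral_const_mul' _ _ ENNReal.ofReal_ne_top]
    refine lintegral_mono fun w => ?_
    by_cases hw : w ∈ S l
    · rw [Set.indicator_of_mem hw]
      refine Gh_sigma (by omega) R H hR hH (fun a => π a (w a)) hw.1 σ i0 t ht ht1 L U hLU hte τ ?_
      obtain ⟨u, hu1, hu2⟩ := hw.2.span
      refine lt_of_le_of_lt (Metric.infDist_le_dist_of_mem (y := u) ?_) ?_
      · refine Submodule.span_mono ?_ hu1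
        rw [Set.image_comp]
        exact Set.image_mono h2
      · simp only [Function.comp_apply, h1, dist_eq_norm]; exact hu2
    · rw [Set.indicator_of_notMem hw]; exact zero_le
  refine (Finset.sum_le_sum fun l _ => hl l).trans (le_of_eq ?_)
  rw [Finset.sum_const, Finset.card_univ, ← ENNReal.ofReal_nsmul]
  congr 1
  simp only [Fintype.card_sum, Fintype.card_fin, nsmul_eq_mul, BC, ← hA, ← hA2]
  push_cast; ring

theorem tot_bound {d k : ℕ} (hk : 1 ≤ k) (hd : 4 * k ≤ d + 1) (R H : ℝ) (hR : 1 ≤ R) (hH : 1 ≤ H)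
    (π : II k → EE d → EE d)
    (hm : ∀ a, Measurable (π a)) (t : II k → ℝ) (ht : ∀ a, 0 < t a) (ht1 : ∀ a, t a < 1)
    (hπ : ∀ a x, ‖π a x - x‖ ≤ H * t a) (L U : JJ k → ℝ)
    (hLU : ∀ p, t (e1 p) ^ 2 ≤ H * (U p - L p)) (hte : ∀ p, t (e1 p) = t (e2 p)) :
    ∫⁻ w in {w : II k → EE d | ∀ a, ‖π a (w a)‖ < 1},
      Gh R L U (fun a => π a (w a)) ≤ ENNReal.ofReal (BC d k R H) := by
  have := bad_bound hk hd R H hR hH π hm t ht ht1 hπ L U hLU hte 1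
    (fun a => by have := ht a; have := ht1 a; nlinarith) le_rfl
  rw [mul_one] at this
  refine le_trans (lintegral_mono_set ?_) this
  intro w hw
  refine ⟨hw, fun hg => ?_⟩
  have := hg (Pi.single (Sum.inl ⟨0, by omega⟩) 1) (Sum.inl ⟨0, by omega⟩)
  simp [Pi.single_apply, ite_smul] at this
  exact absurd (hw (Sum.inl ⟨0, by omega⟩)) (not_lt.mpr this)

theorem shell_vol (d k : ℕ) (hd : 1 ≤ d) : ∃ C : ℝ, 0 < C ∧ ∀ h : ℝ, 0 ≤ h → h ≤ 1 →
    volume {w : II k → EE d | (∀ a, ‖w a‖ ≤ 1 + h) ∧ ∃ a, 1 - h ≤ ‖w a‖} ≤ ENNReal.ofReal (C * h) := by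
  classical
  have : Nonempty (Fin d) := ⟨⟨0, hd⟩⟩
  have : Nontrivial (EE d) := Module.nontrivial_of_finrank_pos (R := ℝ) (by simp; omega)
  set V := (volume (Metric.ball (0 : EE d) 1)) with hV
  have hVt : V ≠ ⊤ := measure_ball_lt_top.ne
  set v := V.toReal with hv
  have hVv : V = ENNReal.ofReal v := (ENNReal.ofReal_toReal hVt).symm
  have hv0 : 0 ≤ v := ENNReal.toReal_nonneg
  refine ⟨Fintype.card (II k) * ((3 ^ d + d) * v * (2 ^ d * (v + 1)) ^ (Fintype.card (II k))) + 1,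
    by positivity, fun h h0 h1 => ?_⟩
  have hb : ∀ r : ℝ, 0 ≤ r → volume (Metric.closedBall (0 : EE d) r) = ENNReal.ofReal (r ^ d * v) := by
    intro r hr
    rw [Measure.addHaar_closedBall _ _ hr, ENNReal.ofReal_mul (by positivity), ← hVv]; simp [hV]
  have hb' : ∀ r : ℝ, 0 ≤ r → volume (Metric.ball (0 : EE d) r) ≤ ENNReal.ofReal (r ^ d * v) := by
    intro r hr
    rw [← hb r hr]; exact measure_mono Metric.ball_subset_closedBall
  set S : II k → Set (II k → EE d) := fun a => Set.pi Set.univ fun b =>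
    if b = a then Metric.closedBall 0 (1 + h) \ Metric.ball 0 (1 - h) else Metric.closedBall 0 (1 + h)
    with hS
  have hsub : {w : II k → EE d | (∀ a, ‖w a‖ ≤ 1 + h) ∧ ∃ a, 1 - h ≤ ‖w a‖} ⊆ ⋃ a, S a := by
    rintro w ⟨hw, a, ha⟩
    refine Set.mem_iUnion.mpr ⟨a, fun b _ => ?_⟩
    by_cases hba : b = a
    · subst hba
      simpa using ⟨hw b, by linarith⟩
    · simpa [hba] using hw b
  have hsh : volume (Metric.closedBall (0 : EE d) (1 + h) \ Metric.ball 0 (1 - h)) ≤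
      ENNReal.ofReal ((3 ^ d + d) * h * v) := by
    rw [measure_sdiff ((Metric.ball_subset_ball (by linarith)).trans Metric.ball_subset_closedBall)
      measurableSet_ball.nullMeasurableSet measure_ball_lt_top.ne, hb _ (by linarith),
      Measure.addHaar_ball _ _ (by linarith : 0 ≤ 1 - h), ← hV, hVv,
      ← ENNReal.ofReal_mul (by have : 0 ≤ 1 - h := by linarith
                               positivity), finrank_euclideanSpace, Fintype.card_fin,
      ← ENNReal.ofReal_sub _ (by have : 0 ≤ 1 - h := by linarith
                                 positivity)]
    refine ENNReal.ofReal_le_ofReal ?_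
    have e1 := one_add_pow_le h h0 h1 d
    have e2 := one_add_mul_le_pow (a := -h) (by linarith) d
    have : (1 + h) ^ d - (1 - h) ^ d ≤ (3 ^ d + d) * h := by
      rw [sub_eq_add_neg 1 h]; nlinarith
    nlinarith
  have hSa : ∀ a, volume (S a) ≤
      ENNReal.ofReal ((3 ^ d + d) * v * (2 ^ d * (v + 1)) ^ (Fintype.card (II k)) * h) := by
    intro a
    rw [hS, volume_pi_pi, ← Finset.mul_prod_erase _ _ (Finset.mem_univ a), if_pos rfl]
    have : ∏ b ∈ Finset.univ.erase a, volume (if b = a then Metric.closedBall (0 : EE d) (1 + h) \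
        Metric.ball 0 (1 - h) else Metric.closedBall 0 (1 + h)) ≤
        ENNReal.ofReal ((2 ^ d * (v + 1)) ^ (Fintype.card (II k))) := by
      have h2 : (1 : ℝ) ≤ 2 ^ d * (v + 1) := by
        have : (1 : ℝ) ≤ 2 ^ d := one_le_pow₀ (by norm_num)
        nlinarith
      calc _ ≤ ∏ b ∈ Finset.univ.erase a, ENNReal.ofReal (2 ^ d * (v + 1)) := by
            refine Finset.prod_le_prod' fun b hb2 => ?_
            rw [if_neg (Finset.ne_of_mem_erase hb2), hb _ (by linarith)]
            refine ENNReal.ofReal_le_ofReal ?_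
            refine mul_le_mul (pow_le_pow_left₀ (by linarith) (by linarith) _) (by linarith) hv0
              (by positivity)
        _ ≤ _ := by
            rw [Finset.prod_const, ← ENNReal.ofReal_pow (by positivity)]
            refine ENNReal.ofReal_le_ofReal (pow_le_pow_right₀ h2 ?_)
            exact Finset.card_le_univ _
    refine (mul_le_mul' hsh this).trans (le_of_eq ?_)
    rw [← ENNReal.ofReal_mul (by positivity)]
    congr 1; ring
  refine (measure_mono hsub).trans ((measure_iUnion_le _).trans ?_)
  rw [tsum_fintype]
  refine (Finset.sum_le_sum fun a _ => hSa a).trans ?_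
  rw [Finset.sum_const, Finset.card_univ, ← ENNReal.ofReal_nsmul, nsmul_eq_mul]
  refine ENNReal.ofReal_le_ofReal ?_
  nlinarith

theorem cube_vol (d k : ℕ) : ∃ C : ℝ, 0 < C ∧
    volume {w : II k → EE d | ∀ a, ‖w a‖ ≤ 2} ≤ ENNReal.ofReal C := by
  have : {w : II k → EE d | ∀ a, ‖w a‖ ≤ 2} = Set.pi Set.univ fun _ => Metric.closedBall 0 2 := by
    ext w; simp [Set.mem_pi]
  have ht : volume {w : II k → EE d | ∀ a, ‖w a‖ ≤ 2} ≠ ⊤ := by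
    rw [this, volume_pi_pi]
    exact ENNReal.prod_ne_top fun _ _ => measure_closedBall_lt_top.ne
  refine ⟨(volume {w : II k → EE d | ∀ a, ‖w a‖ ≤ 2}).toReal + 1, by positivity, ?_⟩
  refine le_trans (le_of_eq (ENNReal.ofReal_toReal ht).symm) (ENNReal.ofReal_le_ofReal (by linarith))

structure Fam {d k : ℕ} (H t0 : ℝ) (π : II k → EE d → EE d) (t : II k → ℝ) (L U : JJ k → ℝ) : Prop where
  hm : ∀ a, Measurable (π a)
  ht : ∀ a, 0 < t a
  ht0 : ∀ a, t a ≤ t0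
  hπ : ∀ a x, ‖π a x - x‖ ≤ H * t a
  hLU : ∀ p, t (e1 p) ^ 2 ≤ H * (U p - L p)
  hte : ∀ p, t (e1 p) = t (e2 p)
  hL : ∀ p, |L p| ≤ H * t0
  hU : ∀ p, |U p| ≤ H * t0

theorem Fam.lt {d k : ℕ} {H t0 : ℝ} (hH : 1 ≤ H) {π : II k → EE d → EE d} {t : II k → ℝ}
    {L U : JJ k → ℝ} (h : Fam H t0 π t L U) (p) : L p < U p := by
  have h1 := h.hLU p
  have h2 := pow_pos (h.ht (e1 p)) 2
  nlinarith

theorem Good.mono {d : ℕ} {ι : Type} [Fintype ι] {τ τ' : ℝ} {Z : ι → EE d} (h : Good τ Z)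
    (ht : τ' ≤ τ) : Good τ' Z := fun c l =>
  (mul_le_mul_of_nonneg_right ht (abs_nonneg _)).trans (h c l)

theorem meas_ball_set {d k : ℕ} (π : II k → EE d → EE d) (hm : ∀ a, Measurable (π a)) :
    MeasurableSet {w : II k → EE d | ∀ a, ‖π a (w a)‖ < 1} := by
  have : {w : II k → EE d | ∀ a, ‖π a (w a)‖ < 1} = ⋂ a, {w | ‖π a (w a)‖ < 1} := by
    ext w; simp
  rw [this]
  exact MeasurableSet.iInter fun a =>
      measurableSet_lt ((hm a).comp (measurable_pi_apply a)).norm measurable_const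

theorem VC_eq (d k : ℕ) (R : ℝ) (hR : 1 ≤ R) : ∃ A : ℝ, 0 < A ∧ ∀ τ : ℝ, 0 < τ →
    ENNReal.ofReal R * VC d k (R + 1) τ = ENNReal.ofReal (A * (1 / τ) ^ (Fintype.card (II k) * (k - 1))) := by
  refine ⟨R * (2 * (R + 1)) ^ (d * d + Fintype.card (II k × II k)), by positivity, fun τ hτ => ?_⟩
  rw [VC, ← ENNReal.ofReal_pow (by positivity), ← ENNReal.ofReal_pow (by positivity),
    ← ENNReal.ofReal_mul (by positivity), ← ENNReal.ofReal_mul (by positivity)]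
  congr 1
  ring

/-- exponent -/
def mE (k : ℕ) : ℕ := (Fintype.card (II k) * (k - 1) + 2) + (Fintype.card (II k) * (k - 1)) + 2

theorem pair_cmp {d k : ℕ} (hk : 1 ≤ k) (hd : 4 * k ≤ d + 1) (R H : ℝ) (hR : 1 ≤ R) (hH : 1 ≤ H) :
    ∃ C : ℝ, 0 < C ∧ ∀ τ : ℝ, 0 < τ → τ < 1 →
    ∀ (π π' : II k → EE d → EE d) (t t' : II k → ℝ) (L U L' U' : JJ k → ℝ),
    Fam H (τ ^ mE k) π t L U → Fam H (τ ^ mE k) π' t' L' U' →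
    ∫⁻ w in {w : II k → EE d | ∀ a, ‖π a (w a)‖ < 1}, Gh R L U (fun a => π a (w a)) ≤
    (∫⁻ w in {w : II k → EE d | ∀ a, ‖π' a (w a)‖ < 1}, Gh R L' U' (fun a => π' a (w a))) +
      ENNReal.ofReal (C * τ) := by
  have hkd : k + k ≤ d := by omega
  obtain ⟨C1, hC1, hcmp⟩ := good_cmp hkd R hR
  obtain ⟨A, hA, hVC⟩ := VC_eq d k R hR
  obtain ⟨C3, hC3, hsh⟩ := shell_vol d k (by omega)
  obtain ⟨C4, hC4, hcu⟩ := cube_vol d k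
  set B := BC d k R H with hB
  have hB0 : 0 ≤ B := BC_nonneg hR hH
  have hk1 : (1 : ℝ) ≤ k := by exact_mod_cast hk
  have hkH : 1 ≤ k * H := by nlinarith
  refine ⟨B * (4 * k * H) + 2 * B + C1 * (2 * H) * C4 + A * (C3 * H), by positivity, ?_⟩
  intro τ hτ hτ1 π π' t t' L U L' U' hF hF'
  set c2 := Fintype.card (II k) * (k - 1) with hc2
  set c1 := c2 + 2 with hc1
  have hm : mE k = c1 + c2 + 2 := rfl
  set m := mE k with hm'
  have hτm : τ ^ m ≤ τ ^ 2 := pow_le_pow_of_le_one hτ.le hτ1.le (by omega)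
  have hτ2 : τ ^ 2 < τ := by nlinarith
  have hτm0 : 0 < τ ^ m := by positivity
  have ht1 : ∀ a, t a < 1 := fun a => by have := hF.ht0 a; linarith
  by_cases hsm : 4 * k * H * τ ≤ 1
  swap
  · refine (tot_bound hk hd R H hR hH π hF.hm t hF.ht ht1 hF.hπ L U hF.hLU hF.hte).trans ?_
    refine le_trans (ENNReal.ofReal_le_ofReal ?_) le_add_self
    rw [← hB]
    have h1 : B * 1 ≤ B * (4 * k * H * τ) := mul_le_mul_of_nonneg_left (by linarith) hB0
    have : 0 ≤ (2 * B + C1 * (2 * H) * C4 + A * (C3 * H)) * τ := by positivity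
    nlinarith
  have h4τ : 4 * τ ≤ 1 := by nlinarith
  have hHτ : 4 * (H * τ) ≤ 1 := by nlinarith [mul_pos (by linarith : 0 < H) hτ]
  set s := 2 * H * τ ^ m with hs
  have hs0 : 0 ≤ s := by positivity
  have hH0 : 0 ≤ H := by linarith
  have hHs : H * τ ^ m ≤ s := by
    have : 0 ≤ H * τ ^ m := by positivity
    rw [hs]; linarith
  have hHt : ∀ a, H * t a ≤ H * τ ^ m := fun a => mul_le_mul_of_nonneg_left (hF.ht0 a) hH0
  have hHt' : ∀ a, H * t' a ≤ H * τ ^ m := fun a => mul_le_mul_of_nonneg_left (hF'.ht0 a) hH0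
  have hHm : H * τ ^ m ≤ 1 / 4 := by nlinarith
  have hclose : ∀ (w : II k → EE d) a, ‖π a (w a) - π' a (w a)‖ ≤ s := by
    intro w a
    have h1 := hF.hπ a (w a)
    have h2 := hF'.hπ a (w a)
    have h3 := hHt a
    have h4 := hHt' a
    have : π a (w a) - π' a (w a) = (π a (w a) - w a) - (π' a (w a) - w a) := by abel
    rw [this]
    refine (norm_sub_le _ _).trans ?_
    rw [hs]
    linarith
  have hmZ : Measurable fun (w : II k → EE d) (a : II k) => π a (w a) :=
    measurable_pi_lambda _ fun a => (hF.hm a).comp (measurable_pi_apply a)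
  set S : Set (II k → EE d) := {w | ∀ a, ‖π a (w a)‖ < 1} with hS
  set S' : Set (II k → EE d) := {w | ∀ a, ‖π' a (w a)‖ < 1} with hS'
  set G : Set (II k → EE d) := {w | Good (2 * τ) fun a => π a (w a)} with hG
  have mS : MeasurableSet S := meas_ball_set π hF.hm
  have mS' : MeasurableSet S' := meas_ball_set π' hF'.hm
  have mG : MeasurableSet G := hmZ (isClosed_good (2 * τ)).measurableSet
  have hnorm : ∀ w ∈ S, ∀ a, ‖w a‖ ≤ 1 + H * τ ^ m := by
    intro w hw a
    have h1 := hF.hπ a (w a)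
    have h3 := hHt a
    have h5 : ‖π a (w a)‖ < 1 := hw a
    have : w a = π a (w a) - (π a (w a) - w a) := by abel
    rw [this]
    refine (norm_sub_le _ _).trans ?_
    linarith
  have hcov : S ⊆ (S ∩ Gᶜ) ∪ ((S ∩ G ∩ S') ∪ (S ∩ G ∩ S'ᶜ)) := by
    intro w hw
    by_cases h1 : w ∈ G <;> by_cases h2 : w ∈ S' <;> simp [hw, h1]
  have hg1 : ∀ w ∈ G, Good τ fun a => π a (w a) := fun w hw => Good.mono hw (by linarith)
  have hg2 : ∀ w ∈ G, Good τ fun a => π' a (w a) := fun w hw => by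
    have := Good.perturb (Z' := fun a => π' a (w a)) hw (hclose w)
    refine this.mono ?_
    simp only [Fintype.card_sum, Fintype.card_fin]
    push_cast
    have e1 : 4 * k * H * τ ^ m ≤ 4 * k * H * τ ^ 2 := mul_le_mul_of_nonneg_left hτm (by positivity)
    have e2 : 4 * k * H * τ * τ ≤ 1 * τ := mul_le_mul_of_nonneg_right hsm hτ.le
    rw [hs]
    nlinarith
  have hpc : ∀ c : ℕ, c + 2 ≤ m → (1 / τ) ^ c * τ ^ m ≤ τ := by
    intro c hc
    have : (1 / τ) ^ c * τ ^ m = τ ^ (m - c) := by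
      rw [one_div, inv_pow, pow_sub₀ _ hτ.ne' (by omega), mul_comm]
    rw [this]
    calc τ ^ (m - c) ≤ τ ^ 1 := pow_le_pow_of_le_one hτ.le hτ1.le (by omega)
      _ = τ := pow_one τ
  have p1 : ∫⁻ w in S ∩ Gᶜ, Gh R L U (fun a => π a (w a)) ≤ ENNReal.ofReal (B * (2 * τ)) :=
    bad_bound hk hd R H hR hH π hF.hm t hF.ht ht1 hF.hπ L U hF.hLU hF.hte (2 * τ)
      (fun a => by have := hF.ht0 a; have := hF.ht a; nlinarith) (by linarith)
  have p2 : ∫⁻ w in S ∩ G ∩ S', Gh R L U (fun a => π a (w a)) ≤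
      (∫⁻ w in S', Gh R L' U' (fun a => π' a (w a))) +
        ENNReal.ofReal (C1 * (2 * H) * C4 * τ) := by
    calc _ ≤ ∫⁻ w in S ∩ G ∩ S', (Gh R L' U' (fun a => π' a (w a)) +
          ENNReal.ofReal (C1 * (1 / τ) ^ c1 * s)) := by
          refine setLIntegral_mono' ((mS.inter mG).inter mS') ?_
          rintro w ⟨⟨hw1, hw2⟩, hw3⟩
          refine hcmp τ hτ _ _ (fun a => (hw1 a).le) (fun a => (hw3 a).le) (hg1 w hw2) (hg2 w hw2) s hs0
            (hclose w) L U L' U' (hF.lt hH) (hF'.lt hH) ?_ ?_ ?_ ?_ <;> intro p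
          · have := hF.hL p; linarith
          · have := hF.hU p; linarith
          · have := hF'.hL p; linarith
          · have := hF'.hU p; linarith
      _ = (∫⁻ w in S ∩ G ∩ S', Gh R L' U' (fun a => π' a (w a))) +
          ∫⁻ w in S ∩ G ∩ S', ENNReal.ofReal (C1 * (1 / τ) ^ c1 * s) :=
          lintegral_add_right _ measurable_const
      _ ≤ _ := by
          refine add_le_add (lintegral_mono_set Set.inter_subset_right) ?_
          rw [setLIntegral_const]
          have : volume (S ∩ G ∩ S') ≤ ENNReal.ofReal C4 := by
            refine (measure_mono ?_).trans hcu
            rintro w ⟨⟨hw1, hw2⟩, hw3⟩ a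
            have := hnorm w hw1 a; linarith
          refine (mul_le_mul' le_rfl this).trans ?_
          rw [← ENNReal.ofReal_mul (by positivity)]
          refine ENNReal.ofReal_le_ofReal ?_
          have := mul_le_mul_of_nonneg_left (hpc c1 (by omega)) (by positivity : 0 ≤ C1 * (2 * H) * C4)
          rw [hs]; linarith
  have p3 : ∫⁻ w in S ∩ G ∩ S'ᶜ, Gh R L U (fun a => π a (w a)) ≤
      ENNReal.ofReal (A * (C3 * H) * τ) := by
    calc _ ≤ ∫⁻ w in S ∩ G ∩ S'ᶜ, ENNReal.ofReal (A * (1 / τ) ^ c2) := by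
          refine setLIntegral_mono' ((mS.inter mG).inter mS'.compl) ?_
          rintro w ⟨⟨hw1, hw2⟩, hw3⟩
          rw [← hVC τ hτ]
          exact Gh_le hkd R hR hτ _ (fun a => (hw1 a).le) (hg1 w hw2) L U (hF.lt hH)
      _ ≤ _ := by
          rw [setLIntegral_const]
          have : volume (S ∩ G ∩ S'ᶜ) ≤ ENNReal.ofReal (C3 * (H * τ ^ m)) := by
            refine (measure_mono ?_).trans (hsh (H * τ ^ m) (by positivity) (by linarith))
            rintro w ⟨⟨hw1, hw2⟩, hw3⟩
            refine ⟨hnorm w hw1, ?_⟩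
            have h7 : ∃ a, 1 ≤ ‖π' a (w a)‖ := by
              by_contra hcon
              push Not at hcon
              exact hw3 hcon
            obtain ⟨a, ha⟩ := h7
            refine ⟨a, ?_⟩
            have h1 := hF'.hπ a (w a)
            have h3 := hHt' a
            have : ‖π' a (w a)‖ ≤ ‖π' a (w a) - w a‖ + ‖w a‖ := by
              simpa using norm_add_le (π' a (w a) - w a) (w a)
            linarith
          refine (mul_le_mul' le_rfl this).trans ?_
          rw [← ENNReal.ofReal_mul (by positivity)]
          refine ENNReal.ofReal_le_ofReal ?_
          have := mul_le_mul_of_nonneg_left (hpc c2 (by omega)) (by positivity : 0 ≤ A * (C3 * H))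
          linarith
  refine (lintegral_mono_set hcov).trans ((lintegral_union_le _ _ _).trans ?_)
  refine (add_le_add p1 ((lintegral_union_le _ _ _).trans (add_le_add p2 p3))).trans ?_
  have e : B * (2 * τ) + (C1 * (2 * H) * C4 * τ + A * (C3 * H) * τ) ≤
      (B * (4 * k * H) + 2 * B + C1 * (2 * H) * C4 + A * (C3 * H)) * τ := by
    have : 0 ≤ B * (4 * k * H) * τ := by positivity
    linarith
  refine le_trans ?_ (add_le_add le_rfl (ENNReal.ofReal_le_ofReal e))
  rw [ENNReal.ofReal_add (by positivity) (by positivity), ENNReal.ofReal_add (by positivity) (by positivity)]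
  refine le_of_eq ?_
  ring

structure Cfg (d k : ℕ) where
  π : EE d → EE d
  t : ℝ
  lo : Pairs k → ℝ
  hi : Pairs k → ℝ

structure Cfg.ok {d k : ℕ} (c : Cfg d k) (H t0 : ℝ) : Prop where
  hm : Measurable c.π
  ht : 0 < c.t
  ht0 : c.t ≤ t0
  hπ : ∀ x, ‖c.π x - x‖ ≤ H * c.t
  hlh : ∀ p, 1 ≤ H * (c.hi p - c.lo p)
  hlo : ∀ p, |c.lo p| ≤ H
  hhi : ∀ p, |c.hi p| ≤ H

def Cfg.A {d k : ℕ} (c : Cfg d k) (X : MM d) : Set (Fin k → EE d) :=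
  {x | (∀ l, ‖c.π (x l)‖ < 1) ∧ ∀ p : Pairs k, AX X (c.π (x p.1.1)) (c.π (x p.1.2)) ∈
    Set.Ioo (c.t ^ 2 * c.lo p) (c.t ^ 2 * c.hi p)}

def Cfg.vb {d k : ℕ} (c : Cfg d k) : ENNReal :=
  ∏ p : Pairs k, ENNReal.ofReal (c.t ^ 2 * c.hi p - c.t ^ 2 * c.lo p)

def Cfg.Th {d k : ℕ} (c : Cfg d k) (X : MM d) : ENNReal := volume (c.A X) / c.vb

theorem Cfg.meas_set {d k : ℕ} (c : Cfg d k) (hm : Measurable c.π) :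
    MeasurableSet {q : MM d × (Fin k → EE d) | q.2 ∈ c.A q.1} := by
  have hx : ∀ l, Measurable fun q : MM d × (Fin k → EE d) => c.π (q.2 l) := fun l =>
    hm.comp ((measurable_pi_apply l).comp measurable_snd)
  have : {q : MM d × (Fin k → EE d) | q.2 ∈ c.A q.1} =
    (⋂ l, {q | ‖c.π (q.2 l)‖ < 1}) ∩ ⋂ p : Pairs k, {q | AX q.1 (c.π (q.2 p.1.1)) (c.π (q.2 p.1.2)) ∈
      Set.Ioo (c.t ^ 2 * c.lo p) (c.t ^ 2 * c.hi p)} := by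
    ext q; simp [Cfg.A]
  rw [this]
  refine MeasurableSet.inter (MeasurableSet.iInter fun l =>
    measurableSet_lt (hx l).norm measurable_const) (MeasurableSet.iInter fun p => ?_)
  refine (continuous_AX.measurable.comp
    (measurable_fst.prodMk ((hx p.1.1).prodMk (hx p.1.2)))) measurableSet_Ioo

theorem Cfg.meas_Th {d k : ℕ} (c : Cfg d k) (hm : Measurable c.π) : Measurable c.Th :=
  (measurable_measure_prodMk_left (c.meas_set hm)).div_const _

def cL {d k : ℕ} (a b : Cfg d k) : JJ k → ℝ :=
  Sum.elim (fun p => a.t ^ 2 * a.lo p) (fun p => b.t ^ 2 * b.lo p)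
def cU {d k : ℕ} (a b : Cfg d k) : JJ k → ℝ :=
  Sum.elim (fun p => a.t ^ 2 * a.hi p) (fun p => b.t ^ 2 * b.hi p)
def cπ {d k : ℕ} (a b : Cfg d k) : II k → EE d → EE d := Sum.elim (fun _ => a.π) (fun _ => b.π)
def ct {d k : ℕ} (a b : Cfg d k) : II k → ℝ := Sum.elim (fun _ => a.t) (fun _ => b.t)

theorem cfg_fam {d k : ℕ} (a b : Cfg d k) (H t0 : ℝ) (ht : t0 < 1) (ha : a.ok H t0)
    (hb : b.ok H t0) : Fam H t0 (cπ a b) (ct a b) (cL a b) (cU a b) := by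
  have key : ∀ c : Cfg d k, c.ok H t0 → ∀ z : ℝ, |z| ≤ H → |c.t ^ 2 * z| ≤ H * t0 := by
    intro c hc z hz
    have h1 := hc.ht
    have h2 := hc.ht0
    rw [abs_mul, abs_of_pos (pow_pos h1 2), mul_comm H]
    exact mul_le_mul (by nlinarith) hz (abs_nonneg _) (by linarith)
  have key2 : ∀ c : Cfg d k, c.ok H t0 → ∀ p, c.t ^ 2 ≤ H * (c.t ^ 2 * c.hi p - c.t ^ 2 * c.lo p) := by
    intro c hc p
    have := mul_le_mul_of_nonneg_left (hc.hlh p) (sq_nonneg c.t)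
    linarith
  constructor
  · rintro (i | i); exacts [ha.hm, hb.hm]
  · rintro (i | i); exacts [ha.ht, hb.ht]
  · rintro (i | i); exacts [ha.ht0, hb.ht0]
  · rintro (i | i) x; exacts [ha.hπ x, hb.hπ x]
  · rintro (p | p); exacts [key2 a ha p, key2 b hb p]
  · rintro (p | p) <;> rfl
  · rintro (p | p); exacts [key a ha _ (ha.hlo p), key b hb _ (hb.hlo p)]
  · rintro (p | p); exacts [key a ha _ (ha.hhi p), key b hb _ (hb.hhi p)]

theorem set_prod {d k : ℕ} (a b : Cfg d k) (ha : Measurable a.π) (hb : Measurable b.π) (X : MM d) :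
    volume {w : II k → EE d | (∀ i, ‖cπ a b i (w i)‖ < 1) ∧
      Mv (fun i => cπ a b i (w i)) X ∈ bx (cL a b) (cU a b)} = volume (a.A X) * volume (b.A X) := by
  have e := volume_measurePreserving_sumPiEquivProdPi (fun _ : II k => EE d)
  have : {w : II k → EE d | (∀ i, ‖cπ a b i (w i)‖ < 1) ∧
      Mv (fun i => cπ a b i (w i)) X ∈ bx (cL a b) (cU a b)} =
      (MeasurableEquiv.sumPiEquivProdPi (fun _ : II k => EE d)) ⁻¹' (a.A X ×ˢ b.A X) := by
    ext w
    simp only [Set.mem_ofPred_eq, bx, Set.mem_univ_pi, Sum.forall, Set.mem_preimage, Set.mem_prod, Cfg.A]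
    constructor
    · rintro ⟨⟨h1, h2⟩, h3, h4⟩
      exact ⟨⟨h1, h3⟩, h2, h4⟩
    · rintro ⟨⟨h1, h3⟩, h2, h4⟩
      exact ⟨⟨h1, h2⟩, h3, h4⟩
  have ms : ∀ c : Cfg d k, Measurable c.π → MeasurableSet (c.A X) := fun c hc =>
    measurable_prodMk_left (x := X) (c.meas_set hc)
  rw [this, e.measure_preimage ((ms a ha).prod (ms b hb)).nullMeasurableSet]
  exact Measure.prod_prod _ _

theorem vb_prod {d k : ℕ} (a b : Cfg d k) : volume (bx (cL a b) (cU a b)) = a.vb * b.vb := by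
  rw [vol_bx, Fintype.prod_sum_type]; rfl

theorem E_eq {d k : ℕ} (R : ℝ) (a b : Cfg d k) (ha : Measurable a.π) (hb : Measurable b.π)
    (h0 : a.vb ≠ 0) (h0' : b.vb ≠ 0) (h1 : a.vb ≠ ⊤) (h1' : b.vb ≠ ⊤) :
    ∫⁻ X, rho R X * (a.Th X * b.Th X) =
    ∫⁻ w in {w : II k → EE d | ∀ i, ‖cπ a b i (w i)‖ < 1},
      Gh R (cL a b) (cU a b) (fun i => cπ a b i (w i)) := by
  have hcm : ∀ i, Measurable (cπ a b i) := by rintro (i | i); exacts [ha, hb]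
  have mS := meas_ball_set (cπ a b) hcm
  set S := {w : II k → EE d | ∀ i, ‖cπ a b i (w i)‖ < 1} with hS
  have hmZ : Measurable fun (w : II k → EE d) (i : II k) => cπ a b i (w i) :=
    measurable_pi_lambda _ fun i => (hcm i).comp (measurable_pi_apply i)
  have mW : MeasurableSet {q : (II k → EE d) × MM d |
      Mv (fun i => cπ a b i (q.1 i)) q.2 ∈ bx (cL a b) (cU a b)} := by
    have := (isOpen_WIN (d := d) (cL a b) (cU a b)).measurableSet
    have h2 := (measurable_snd.prodMk (hmZ.comp measurable_fst) :
      Measurable fun q : (II k → EE d) × MM d => (q.2, fun i => cπ a b i (q.1 i))) this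
    simp only [WIN_iff] at h2
    exact h2
  have mSW : MeasurableSet {q : (II k → EE d) × MM d | q.1 ∈ S ∧
      Mv (fun i => cπ a b i (q.1 i)) q.2 ∈ bx (cL a b) (cU a b)} :=
    (measurable_fst mS).inter mW
  have hq : (a.vb * b.vb)⁻¹ ≠ ⊤ := by
    rw [ENNReal.inv_ne_top]; exact mul_ne_zero h0 h0'
  symm
  rw [← lintegral_indicator mS]
  calc _ = ∫⁻ w, (a.vb * b.vb)⁻¹ * ∫⁻ X, rho R X *
        {q : (II k → EE d) × MM d | q.1 ∈ S ∧
      Mv (fun i => cπ a b i (q.1 i)) q.2 ∈ bx (cL a b) (cU a b)}.indicator (fun _ => 1) (w, X) := by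
        refine lintegral_congr fun w => ?_
        by_cases hw : w ∈ S
        · rw [Set.indicator_of_mem hw, Gh, Wq, vb_prod, ENNReal.div_eq_inv_mul]
          congr 1
          refine lintegral_congr fun X => ?_
          congr 1
          by_cases hv : Mv (fun i => cπ a b i (w i)) X ∈ bx (cL a b) (cU a b)
          · rw [Set.indicator_of_mem hv, Set.indicator_of_mem]
            exact ⟨hw, hv⟩
          · rw [Set.indicator_of_notMem hv, Set.indicator_of_notMem (fun hc => hv hc.2)]
        · rw [Set.indicator_of_notMem hw]
          simp [Set.indicator, hw]
    _ = (a.vb * b.vb)⁻¹ * ∫⁻ w, ∫⁻ X, rho R X *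
        {q : (II k → EE d) × MM d | q.1 ∈ S ∧
      Mv (fun i => cπ a b i (q.1 i)) q.2 ∈ bx (cL a b) (cU a b)}.indicator (fun _ => 1) (w, X) :=
        lintegral_const_mul' _ _ hq
    _ = (a.vb * b.vb)⁻¹ * ∫⁻ X, ∫⁻ w, rho R X *
        {q : (II k → EE d) × MM d | q.1 ∈ S ∧
      Mv (fun i => cπ a b i (q.1 i)) q.2 ∈ bx (cL a b) (cU a b)}.indicator (fun _ => 1) (w, X) := by
        congr 1
        refine lintegral_lintegral_swap (Measurable.aemeasurable ?_)
        exact ((meas_rho R).comp measurable_snd).mul (measurable_const.indicator mSW)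
    _ = (a.vb * b.vb)⁻¹ * ∫⁻ X, rho R X * (volume (a.A X) * volume (b.A X)) := by
        congr 1
        refine lintegral_congr fun X => ?_
        rw [lintegral_const_mul' (rho R X) _ ENNReal.ofReal_ne_top, ← set_prod a b ha hb]
        congr 1
        exact lintegral_indicator_one (measurable_prodMk_right (y := X) mSW)
    _ = ∫⁻ X, (a.vb * b.vb)⁻¹ * (rho R X * (volume (a.A X) * volume (b.A X))) :=
        (lintegral_const_mul' _ _ hq).symm
    _ = _ := by
        refine lintegral_congr fun X => ?_
        rw [Cfg.Th, Cfg.Th, ENNReal.mul_inv (Or.inl h0) (Or.inl h1), ENNReal.div_eq_inv_mul,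
          ENNReal.div_eq_inv_mul]
        ring

theorem Cfg.ok.vb_ne {d k : ℕ} {c : Cfg d k} {H t0 : ℝ} (hH : 1 ≤ H) (h : c.ok H t0) :
    c.vb ≠ 0 ∧ c.vb ≠ ⊤ := by
  refine ⟨?_, ENNReal.prod_ne_top fun _ _ => ENNReal.ofReal_ne_top⟩
  rw [Cfg.vb, Finset.prod_ne_zero_iff]
  intro p _
  have h1 := h.hlh p
  have h2 := pow_pos h.ht 2
  have h3 : 0 < c.hi p - c.lo p := by
    by_contra hc
    push Not at hc
    nlinarith
  have := mul_pos h2 h3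
  simp only [ne_eq, ENNReal.ofReal_eq_zero, not_le]
  linarith

theorem Cfg.ok.A_ne_top {d k : ℕ} {c : Cfg d k} {H t0 : ℝ} (h : c.ok H t0) (X : MM d) :
    volume (c.A X) ≠ ⊤ := by
  have : c.A X ⊆ Set.pi Set.univ fun _ => Metric.closedBall 0 (1 + H * c.t) := by
    intro x hx l _
    have h1 := hx.1 l
    have h2 := h.hπ (x l)
    have h3 : ‖x l‖ ≤ ‖c.π (x l)‖ + ‖c.π (x l) - x l‖ := by
      simpa using norm_sub_le (c.π (x l)) (c.π (x l) - x l)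
    simp; linarith
  refine ((measure_mono this).trans_lt ?_).ne
  rw [volume_pi_pi]
  exact (ENNReal.prod_ne_top fun _ _ => measure_closedBall_lt_top.ne).lt_top

theorem Cfg.ok.Th_ne_top {d k : ℕ} {c : Cfg d k} {H t0 : ℝ} (hH : 1 ≤ H) (h : c.ok H t0) (X : MM d) :
    c.Th X ≠ ⊤ := ENNReal.div_ne_top (h.A_ne_top X) (h.vb_ne hH).1

theorem var_bound {d k : ℕ} (hk : 1 ≤ k) (hd : 4 * k ≤ d + 1) (R H : ℝ) (hR : 1 ≤ R) (hH : 1 ≤ H) :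
    ∃ C : ℝ, 0 < C ∧ ∀ τ : ℝ, 0 < τ → τ < 1 → ∀ a b : Cfg d k, a.ok H (τ ^ mE k) → b.ok H (τ ^ mE k) →
    ∫⁻ X, rho R X * ENNReal.ofReal (((a.Th X).toReal - (b.Th X).toReal) ^ 2) ≤ ENNReal.ofReal (C * τ) := by
  obtain ⟨C, hC, hcmp⟩ := pair_cmp hk hd R H hR hH
  refine ⟨2 * C, by positivity, fun τ h0 h1 a b ha hb => ?_⟩
  have ht1 : τ ^ mE k < 1 := pow_lt_one₀ h0.le h1 (by simp [mE])
  have hE : ∀ c c' : Cfg d k, c.ok H (τ ^ mE k) → c'.ok H (τ ^ mE k) →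
      ∫⁻ X, rho R X * (c.Th X * c'.Th X) =
    ∫⁻ w in {w : II k → EE d | ∀ i, ‖cπ c c' i (w i)‖ < 1},
      Gh R (cL c c') (cU c c') (fun i => cπ c c' i (w i)) := fun c c' hc hc' =>
    E_eq R c c' hc.hm hc'.hm (hc.vb_ne hH).1 (hc'.vb_ne hH).1 (hc.vb_ne hH).2 (hc'.vb_ne hH).2
  have hF := fun c c' hc hc' => cfg_fam (d := d) (k := k) c c' H (τ ^ mE k) ht1 hc hc'
  have c1 := hcmp τ h0 h1 _ _ _ _ _ _ _ _ (hF a a ha ha) (hF a b ha hb)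
  have c2 := hcmp τ h0 h1 _ _ _ _ _ _ _ _ (hF b b hb hb) (hF a b ha hb)
  rw [← hE _ _ ha ha, ← hE _ _ ha hb] at c1
  rw [← hE _ _ hb hb, ← hE _ _ ha hb] at c2
  have hfin : ∫⁻ X, rho R X * (a.Th X * b.Th X) ≠ ⊤ := by
    rw [hE _ _ ha hb]
    have hf := hF a b ha hb
    exact ((tot_bound hk hd R H hR hH _ hf.hm _ hf.ht (fun i => (hf.ht0 i).trans_lt ht1) hf.hπ _ _
      hf.hLU hf.hte).trans_lt ENNReal.ofReal_lt_top).ne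
  have mD : ∀ c c' : Cfg d k, c.ok H (τ ^ mE k) → c'.ok H (τ ^ mE k) →
      Measurable fun X => rho R X * (c.Th X * c'.Th X) := fun c c' hc hc' =>
    (meas_rho R).mul ((c.meas_Th hc.hm).mul (c'.meas_Th hc'.hm))
  have key : (∫⁻ X, rho R X * ENNReal.ofReal (((a.Th X).toReal - (b.Th X).toReal) ^ 2)) +
      2 * ∫⁻ X, rho R X * (a.Th X * b.Th X) =
      (∫⁻ X, rho R X * (a.Th X * a.Th X)) + ∫⁻ X, rho R X * (b.Th X * b.Th X) := by
    rw [← lintegral_const_mul' _ _ ENNReal.ofNat_ne_top, ← lintegral_add_right _ ((mD a b ha hb).const_mul 2),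
      ← lintegral_add_right _ (mD b b hb hb)]
    refine lintegral_congr fun X => ?_
    have e1 := ENNReal.ofReal_toReal (ha.Th_ne_top hH X)
    have e2 := ENNReal.ofReal_toReal (hb.Th_ne_top hH X)
    set x := (a.Th X).toReal
    set y := (b.Th X).toReal
    have hx : 0 ≤ x := ENNReal.toReal_nonneg
    have hy : 0 ≤ y := ENNReal.toReal_nonneg
    rw [← e1, ← e2, mul_left_comm 2, ← mul_add, ← mul_add, ← ENNReal.ofReal_mul hx, ← ENNReal.ofReal_mul hx,
      ← ENNReal.ofReal_mul hy, ← ENNReal.ofReal_ofNat 2, ← ENNReal.ofReal_mul (by norm_num),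
      ← ENNReal.ofReal_add (by positivity) (by positivity),
      ← ENNReal.ofReal_add (by positivity) (by positivity)]
    congr 2; ring
  have h2 : 2 * (∫⁻ X, rho R X * (a.Th X * b.Th X)) ≠ ⊤ := ENNReal.mul_ne_top ENNReal.ofNat_ne_top hfin
  rw [← ENNReal.add_le_add_iff_right h2, key]
  refine (add_le_add c1 c2).trans (le_of_eq ?_)
  rw [show 2 * C * τ = C * τ + C * τ by ring, ENNReal.ofReal_add (by positivity) (by positivity)]
  ring

def ev {d : ℕ} (v : Fin d → ℤ) : EE d := WithLp.toLp 2 fun i => (v i : ℝ)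

def sX {d k : ℕ} (N : ℕ) (v₀ : Fin d → ℤ) (X : MM d) (a b : Pairs k → ℝ) (T : ℝ) :
    Set (Fin k → Fin d → ℤ) :=
  {v | (∀ l j, (N : ℤ) ∣ (v l j - v₀ j)) ∧
    (∀ p : Pairs k, AX X (ev (v p.1.1)) (ev (v p.1.2)) ∈ Set.Ioo (a p) (b p)) ∧ ∀ l, ‖ev (v l)‖ < T}

def cX {d k : ℕ} (N : ℕ) (v₀ : Fin d → ℤ) (X : MM d) (a b : Pairs k → ℝ) (T : ℝ) : ℕ :=
  Nat.card (sX N v₀ X a b T)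

def qf {d k : ℕ} (N : ℕ) (v₀ : Fin d → ℤ) (T : ℝ) (x : Fin k → EE d) (l : Fin k) (i : Fin d) : ℤ :=
  ⌊(T * x l i - v₀ i) / N⌋

def fc {d k : ℕ} (N : ℕ) (v₀ : Fin d → ℤ) (T : ℝ) (lo hi : Pairs k → ℝ) : Cfg d k where
  π := fun x => T⁻¹ • ev (fun i => v₀ i + N * ⌊(T * x i - v₀ i) / N⌋)
  t := T⁻¹
  lo := lo
  hi := hi

theorem meas_ev {d : ℕ} {α : Type} [MeasurableSpace α] (f : α → Fin d → ℤ) (hf : ∀ i, Measurable fun x => f x i) :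
    Measurable fun x => ev (f x) := by
  refine (PiLp.volume_preserving_toLp (Fin d)).measurable.comp (measurable_pi_lambda _ fun i => ?_)
  exact (measurable_from_top (f := fun z : ℤ => (z : ℝ))).comp (hf i)

theorem norm_le_sum {d : ℕ} (x : EE d) (c : ℝ) (hc : 0 ≤ c) (h : ∀ i, |x i| ≤ c) : ‖x‖ ≤ d * c := by
  rw [EuclideanSpace.norm_eq]
  refine Real.sqrt_le_iff.mpr ⟨by positivity, ?_⟩
  calc ∑ i, ‖x i‖ ^ 2 ≤ ∑ i : Fin d, c ^ 2 := by
        refine Finset.sum_le_sum fun i _ => pow_le_pow_left₀ (norm_nonneg _) ?_ 2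
        simpa using h i
    _ = d * c ^ 2 := by simp
    _ ≤ (d * c) ^ 2 := by
        rw [mul_pow]
        have : (d : ℝ) ≤ (d : ℝ) ^ 2 := by exact_mod_cast Nat.le_self_pow (by norm_num) d
        exact mul_le_mul_of_nonneg_right this (sq_nonneg c)

theorem fc_ok {d k : ℕ} (N : ℕ) (hN : 0 < N) (v₀ : Fin d → ℤ) (T : ℝ) (hT : 0 < T) (lo hi : Pairs k → ℝ)
    (H t0 : ℝ) (hH : (d : ℝ) * N ≤ H) (ht0 : T⁻¹ ≤ t0) (h1 : ∀ p, 1 ≤ H * (hi p - lo p))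
    (h2 : ∀ p, |lo p| ≤ H) (h3 : ∀ p, |hi p| ≤ H) : (fc (k := k) N v₀ T lo hi).ok H t0 where
  hm := by
    have h0 : Measurable fun x : EE d => ev (fun i => v₀ i + N * ⌊(T * x i - v₀ i) / N⌋) := by
      refine meas_ev (fun (x : EE d) i => v₀ i + N * ⌊(T * x i - v₀ i) / N⌋) fun i => ?_
      have hx : Measurable fun x : EE d => (T * x i - v₀ i) / N := by fun_prop
      exact (measurable_from_top (f := fun z : ℤ => v₀ i + N * z)).comp (Int.measurable_floor.comp hx)
    exact h0.const_smul T⁻¹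
  ht := inv_pos.mpr hT
  ht0 := ht0
  hπ := fun x => by
    have hN' : (0 : ℝ) < N := by exact_mod_cast hN
    show ‖T⁻¹ • ev (fun i => v₀ i + N * ⌊(T * x i - v₀ i) / N⌋) - x‖ ≤ H * T⁻¹
    have := norm_le_sum (T⁻¹ • ev (fun i => v₀ i + N * ⌊(T * x i - v₀ i) / N⌋) - x) (N * T⁻¹)
      (by positivity) (fun i => by
        simp only [PiLp.sub_apply, PiLp.smul_apply, ev, smul_eq_mul]
        push_cast
        have e1 := Int.floor_le ((T * x i - v₀ i) / N)
        have e2 := Int.lt_floor_add_one ((T * x i - v₀ i) / N)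
        rw [le_div_iff₀ hN'] at e1
        rw [div_lt_iff₀ hN'] at e2
        have : T⁻¹ * ((v₀ i : ℝ) + N * ⌊(T * x i - v₀ i) / N⌋) - x i =
          ((v₀ i : ℝ) + N * ⌊(T * x i - v₀ i) / N⌋ - T * x i) * T⁻¹ := by field_simp
        rw [this, abs_mul, abs_of_pos (inv_pos.mpr hT)]
        refine mul_le_mul_of_nonneg_right ?_ (inv_pos.mpr hT).le
        rw [abs_le]; constructor <;> nlinarith)
    refine this.trans ?_
    rw [← mul_assoc]
    exact mul_le_mul_of_nonneg_right hH (inv_pos.mpr hT).le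
  hlh := h1
  hlo := h2
  hhi := h3

theorem cell_vol {d k : ℕ} (N : ℕ) (hN : 0 < N) (v₀ : Fin d → ℤ) (T : ℝ) (hT : 0 < T)
    (z : Fin k → Fin d → ℤ) :
    MeasurableSet (qf (d := d) (k := k) N v₀ T ⁻¹' {z}) ∧ volume (qf (d := d) (k := k) N v₀ T ⁻¹' {z}) =
      ENNReal.ofReal ((N / T) ^ (d * k)) := by
  have hN' : (0 : ℝ) < N := by exact_mod_cast hN
  have hset : qf (d := d) (k := k) N v₀ T ⁻¹' {z} = Set.pi Set.univ fun l =>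
      (WithLp.ofLp : EE d → Fin d → ℝ) ⁻¹' (Set.pi Set.univ fun i =>
        Set.Ico ((v₀ i + N * z l i) / T) ((v₀ i + N * (z l i + 1)) / T)) := by
    ext x
    simp only [Set.mem_preimage, Set.mem_singleton_iff, funext_iff, Set.mem_univ_pi, qf, Int.floor_eq_iff,
      Set.mem_Ico]
    refine forall_congr' fun l => forall_congr' fun i => ?_
    rw [le_div_iff₀ hN', div_lt_iff₀ hN', div_le_iff₀ hT, lt_div_iff₀ hT]
    constructor <;> rintro ⟨h1, h2⟩ <;> constructor <;> linarith
  have hm : ∀ l, MeasurableSet (Set.pi Set.univ fun i =>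
        Set.Ico ((v₀ i + N * z l i) / T) ((v₀ i + N * (z l i + 1)) / T)) :=
    fun l => MeasurableSet.univ_pi fun i => measurableSet_Ico
  rw [hset]
  refine ⟨MeasurableSet.univ_pi fun l => (PiLp.volume_preserving_ofLp (Fin d)).measurable (hm l), ?_⟩
  rw [volume_pi_pi]
  have : ∀ l, volume ((WithLp.ofLp : EE d → Fin d → ℝ) ⁻¹' (Set.pi Set.univ fun i =>
        Set.Ico ((v₀ i + N * z l i) / T) ((v₀ i + N * (z l i + 1)) / T))) =
        ENNReal.ofReal ((N / T) ^ d) := by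
    intro l
    rw [(PiLp.volume_preserving_ofLp (Fin d)).measure_preimage (hm l).nullMeasurableSet, volume_pi_pi]
    simp only [Real.volume_Ico]
    rw [Finset.prod_congr rfl (g := fun _ => ENNReal.ofReal (N / T))]
    · simp [ENNReal.ofReal_pow (show 0 ≤ (N : ℝ) / T by positivity)]
    · intro i _
      congr 1; ring
  rw [Finset.prod_congr rfl fun l _ => this l, Finset.prod_const, Finset.card_univ, Fintype.card_fin,
    ← ENNReal.ofReal_pow (by positivity), ← pow_mul]

theorem AX_smul2 {d : ℕ} (X : MM d) (c : ℝ) (u w : EE d) : AX X (c • u) (c • w) = c ^ 2 * AX X u w := by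
  have : tens (c • u) (c • w) - tens (c • w) (c • u) = (c ^ 2) • (tens u w - tens w u) := by
    ext p; simp [tens]; ring
  rw [AX, this, inner_smul_right]; rfl

theorem A_eq {d k : ℕ} (N : ℕ) (v₀ : Fin d → ℤ) (T : ℝ) (hT : 0 < T) (lo hi : Pairs k → ℝ)
    (X : MM d) : (fc N v₀ T lo hi).A X = qf N v₀ T ⁻¹'
      {z | (fun l i => v₀ i + N * z l i) ∈ sX N v₀ X lo hi T} := by
  ext x
  simp only [Cfg.A, fc, sX, Set.mem_preimage, Set.mem_ofPred_eq, AX_smul2, norm_smul]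
  have h1 : ∀ l, (‖T⁻¹‖ * ‖ev fun i => v₀ i + N * ⌊(T * (x l) i - v₀ i) / N⌋‖ < 1) ↔
      ‖ev fun i => v₀ i + N * qf N v₀ T x l i‖ < T := by
    intro l
    rw [Real.norm_eq_abs, abs_of_pos (inv_pos.mpr hT), inv_mul_lt_iff₀ hT, mul_one]; rfl
  have h2 : ∀ p : Pairs k, (T⁻¹ ^ 2 * AX X (ev fun i => v₀ i + N * ⌊(T * (x p.1.1) i - v₀ i) / N⌋)
      (ev fun i => v₀ i + N * ⌊(T * (x p.1.2) i - v₀ i) / N⌋) ∈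
      Set.Ioo (T⁻¹ ^ 2 * lo p) (T⁻¹ ^ 2 * hi p)) ↔ AX X (ev fun i => v₀ i + N * qf N v₀ T x p.1.1 i)
      (ev fun i => v₀ i + N * qf N v₀ T x p.1.2 i) ∈ Set.Ioo (lo p) (hi p) := by
    intro p
    have : 0 < T⁻¹ ^ 2 := by positivity
    simp only [Set.mem_Ioo, mul_lt_mul_iff_right₀ this]; rfl
  simp only [h1, h2]
  constructor
  · rintro ⟨h3, h4⟩
    exact ⟨fun l j => ⟨qf N v₀ T x l j, by ring⟩, h4, h3⟩
  · rintro ⟨_, h4, h3⟩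
    exact ⟨h3, h4⟩

theorem cell_count {d k : ℕ} (N : ℕ) (hN : 0 < N) (v₀ : Fin d → ℤ) (T : ℝ) (hT : 0 < T)
    (lo hi : Pairs k → ℝ) (X : MM d) (hf : volume ((fc N v₀ T lo hi).A X) ≠ ⊤) :
    (sX N v₀ X lo hi T).Finite ∧
    volume ((fc N v₀ T lo hi).A X) = ENNReal.ofReal (cX N v₀ X lo hi T * (N / T) ^ (d * k)) := by
  have hN' : (0 : ℝ) < N := by exact_mod_cast hN
  set S := {z : Fin k → Fin d → ℤ | (fun l i => v₀ i + N * z l i) ∈ sX N v₀ X lo hi T} with hS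
  let e : S ≃ sX N v₀ X lo hi T := Equiv.ofBijective (fun z => ⟨_, z.2⟩) (by
    constructor
    · rintro ⟨z, hz⟩ ⟨z', hz'⟩ h
      simp only [Subtype.mk.injEq, funext_iff] at h ⊢
      intro l i
      have := h l i
      have hN2 : (N : ℤ) ≠ 0 := by exact_mod_cast hN.ne'
      exact mul_left_cancel₀ hN2 (by linarith)
    · rintro ⟨v, hv⟩
      have h1 := hv.1
      choose z hz using h1
      have : (fun l i => v₀ i + N * z l i) = v := by
        funext l i; rw [← hz l i]; ring
      refine ⟨⟨z, ?_⟩, ?_⟩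
      · rw [hS, Set.mem_ofPred_eq, this]; exact hv
      · exact Subtype.ext this)
  have hv := A_eq N v₀ T hT lo hi X
  rw [← hS] at hv
  have hc := tsum_measure_preimage_singleton (μ := volume) (f := qf (d := d) (k := k) N v₀ T)
    (Set.to_countable S) (fun y _ => (cell_vol N hN v₀ T hT y).1)
  simp only [(cell_vol N hN v₀ T hT _).2] at hc
  rw [← hv] at hc
  have hfin : Finite S := by
    by_contra hinf
    rw [not_finite_iff_infinite] at hinf
    rw [ENNReal.tsum_const_eq_top_of_ne_zero] at hc
    · exact hf hc.symm
    · simp only [ne_eq, ENNReal.ofReal_eq_zero, not_le]; positivity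
  refine ⟨Set.finite_coe_iff.mp (e.finite_iff.mp hfin), ?_⟩
  rw [← hc, ENNReal.tsum_set_const, ENNReal.ofReal_mul (by positivity), cX, ← Nat.card_congr e]
  congr 1
  have : S.Finite := hfin
  rw [ENNReal.ofReal_natCast, Nat.card_coe_set_eq, this.encard_eq_coe_toFinset_card,
    Set.ncard_eq_toFinset_card _ this]
  simp

theorem sX_finite {d k : ℕ} (N : ℕ) (v₀ : Fin d → ℤ) (X : MM d) (a b : Pairs k → ℝ) (T : ℝ) :
    (sX N v₀ X a b T).Finite := by
  refine (Set.finite_Icc (fun _ _ => -⌈T⌉ : Fin k → Fin d → ℤ) (fun _ _ => ⌈T⌉)).subset ?_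
  intro v hv
  have h : ∀ l i, |v l i| ≤ ⌈T⌉ := by
    intro l i
    have h1 := PiLp.norm_apply_le (ev (v l)) i
    have h2 := hv.2.2 l
    have h3 : ‖(ev (v l)) i‖ = ((|v l i| : ℤ) : ℝ) := by simp [ev]
    rw [h3] at h1
    have h4 : ((|v l i| : ℤ) : ℝ) ≤ (⌈T⌉ : ℝ) := h1.trans (h2.le.trans (Int.le_ceil T))
    exact_mod_cast h4
  exact ⟨fun l i => (abs_le.mp (h l i)).1, fun l i => (abs_le.mp (h l i)).2⟩

theorem cX_mono {d k : ℕ} (N : ℕ) (v₀ : Fin d → ℤ) (X : MM d) {a b a' b' : Pairs k → ℝ} {T T' : ℝ}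
    (ha : ∀ p, a' p ≤ a p) (hb : ∀ p, b p ≤ b' p) (hT : T ≤ T') :
    cX N v₀ X a b T ≤ cX N v₀ X a' b' T' := by
  refine Nat.card_mono (sX_finite N v₀ X a' b' T') ?_
  rintro v ⟨h1, h2, h3⟩
  exact ⟨h1, fun p => ⟨(ha p).trans_lt (h2 p).1, (h2 p).2.trans_le (hb p)⟩, fun l => (h3 l).trans_le hT⟩

theorem Th_formula {d k E : ℕ} (hE : d * k = E + 2 * Fintype.card (Pairs k)) (N : ℕ) (hN : 0 < N)
    (v₀ : Fin d → ℤ) (T : ℝ) (hT : 0 < T)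
    (lo hi : Pairs k → ℝ) (hlh : ∀ p, lo p < hi p) (X : MM d)
    (hf : volume ((fc N v₀ T lo hi).A X) ≠ ⊤) :
    (N : ℝ) ^ (d * k) * cX N v₀ X lo hi T =
      ((fc N v₀ T lo hi).Th X).toReal * (∏ p, (hi p - lo p)) * T ^ E := by
  have hv : (fc (d := d) N v₀ T lo hi).vb = ENNReal.ofReal (∏ p, ((T⁻¹) ^ 2 * (hi p - lo p))) := by
    rw [ENNReal.ofReal_prod_of_nonneg]
    · refine Finset.prod_congr rfl fun p _ => ?_
      rw [mul_sub]; rfl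
    · intro p _
      have := hlh p
      exact mul_nonneg (by positivity) (by linarith)
  have hP : 0 < ∏ p, (hi p - lo p) := Finset.prod_pos fun p _ => by linarith [hlh p]
  rw [Finset.prod_mul_distrib, Finset.prod_const, Finset.card_univ, ← pow_mul] at hv
  rw [Cfg.Th, (cell_count N hN v₀ T hT lo hi X hf).2, hv, ← ENNReal.ofReal_div_of_pos (by positivity),
    ENNReal.toReal_ofReal (by positivity), hE, div_pow]
  generalize Fintype.card (Pairs k) = K
  have : T⁻¹ ^ (2 * K) = (T ^ (2 * K))⁻¹ := inv_pow _ _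
  rw [this, pow_add T, mul_comm]
  field_simp

theorem ae_bdd {d : ℕ} (G : ℕ → MM d → ENNReal) (hG : ∀ j, Measurable (G j))
    (h : ∀ R : ℕ, 1 ≤ R → ∃ C : ℝ, ∀ j, ∫⁻ X, rho (R : ℝ) X * G j X ≤ ENNReal.ofReal (C / ((j : ℝ) + 2) ^ 2)) :
    ∀ᵐ X, ∃ C : ℝ, 0 < C ∧ ∀ j, G j X ≤ ENNReal.ofReal C := by
  have key : ∀ R : ℕ, 1 ≤ R → ∀ᵐ X, ∑' j, rho (R : ℝ) X * G j X < ⊤ := by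
    intro R hR
    obtain ⟨C, hC⟩ := h R hR
    have hm : ∀ j, Measurable fun X => rho (R : ℝ) X * G j X := fun j => (meas_rho _).mul (hG j)
    refine ae_lt_top (Measurable.tsum hm) ?_
    rw [lintegral_tsum fun j => (hm j).aemeasurable]
    have hs : Summable fun j : ℕ => |C| / ((j : ℝ) + 2) ^ 2 := by
      have := (summable_nat_add_iff 2).mpr (Real.summable_one_div_nat_pow.mpr (one_lt_two))
      refine (this.mul_left |C|).congr fun j => ?_
      push_cast; ring
    refine ne_top_of_le_ne_top (b := ∑' j : ℕ, ENNReal.ofReal (|C| / ((j : ℝ) + 2) ^ 2)) ?_ ?_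
    · rw [← ENNReal.ofReal_tsum_of_nonneg (fun j => by positivity) hs]
      exact ENNReal.ofReal_ne_top
    · refine ENNReal.tsum_le_tsum fun j => (hC j).trans (ENNReal.ofReal_le_ofReal ?_)
      exact div_le_div_of_nonneg_right (le_abs_self C) (by positivity)
  have key2 : ∀ᵐ X : MM d, ∀ R : ℕ, 1 ≤ R → ∑' j, rho (R : ℝ) X * G j X < ⊤ := by
    rw [ae_all_iff]; intro R; rw [ae_all_iff]; exact key R
  filter_upwards [key2] with X hX
  obtain ⟨R, hR⟩ := exists_nat_gt (‖X‖ + 1)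
  have hR1 : 1 ≤ R := by
    have : (0 : ℝ) < R := by linarith [norm_nonneg X]
    exact_mod_cast this
  have h1 := hX R hR1
  refine ⟨(∑' j, rho (R : ℝ) X * G j X).toReal + 1, by positivity, fun j => ?_⟩
  have h2 : (1 : ENNReal) ≤ rho (R : ℝ) X := by
    rw [rho, ENNReal.one_le_ofReal]; linarith
  calc G j X ≤ rho (R : ℝ) X * G j X := le_mul_of_one_le_left' h2
    _ ≤ ∑' j, rho (R : ℝ) X * G j X := ENNReal.le_tsum j
    _ = ENNReal.ofReal (∑' j, rho (R : ℝ) X * G j X).toReal := (ENNReal.ofReal_toReal h1.ne).symm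
    _ ≤ _ := ENNReal.ofReal_le_ofReal (by linarith)

theorem interp1 (F : ℝ → ℝ) (hF : Monotone F) (L C : ℝ) (hC : 0 ≤ C) (E M J0 : ℕ) (hM : 1 ≤ M)
    (h : ∀ J : ℕ, J0 ≤ J → |F ((J : ℝ) ^ M) - L * ((J : ℝ) ^ M) ^ E| ≤ C / J * ((J : ℝ) ^ M) ^ E) :
    ∃ C' > 0, ∃ T0 > 0, ∀ T > T0, |F T - L * T ^ E| ≤ C' * T ^ ((E : ℝ) - 1 / M) := by
  set B : ℝ := 3 ^ (M * E) with hB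
  have hB0 : 0 < B := by positivity
  refine ⟨2 * (|L| * B + C * (1 + B) + 1), by positivity, ((J0 : ℝ) + 1) ^ M, by positivity, fun T hT => ?_⟩
  have hT0 : 0 < T := lt_of_le_of_lt (by positivity) hT
  have hM0 : (M : ℝ) ≠ 0 := by positivity
  set r := T ^ (1 / (M : ℝ)) with hr
  have hrM : r ^ M = T := by
    rw [hr, ← Real.rpow_natCast, ← Real.rpow_mul hT0.le, one_div_mul_cancel hM0, Real.rpow_one]
  have hr0 : 0 < r := Real.rpow_pos_of_pos hT0 _
  have hrJ : (J0 : ℝ) + 1 < r := by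
    rw [← hrM] at hT
    exact lt_of_pow_lt_pow_left₀ M hr0.le hT
  set J := ⌊r⌋₊ with hJ
  have hJr : (J : ℝ) ≤ r := Nat.floor_le hr0.le
  have hrJ1 : r < J + 1 := Nat.lt_floor_add_one r
  have hJJ : J0 + 1 ≤ J := Nat.le_floor (by push_cast; linarith)
  have hJ1 : (1 : ℝ) ≤ J := by exact_mod_cast (by omega : 1 ≤ J)
  have hJp : (0 : ℝ) < J := by linarith
  have h1 := h J (by omega)
  have h2 := h (J + 1) (by omega)
  push_cast at h2
  set x := ((J : ℝ) ^ M) ^ E with hx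
  set y := (((J : ℝ) + 1) ^ M) ^ E with hy
  have hx0 : 0 < x := by positivity
  have hTl : (J : ℝ) ^ M ≤ T := by rw [← hrM]; exact pow_le_pow_left₀ hJp.le hJr M
  have hTu : T ≤ ((J : ℝ) + 1) ^ M := by rw [← hrM]; exact pow_le_pow_left₀ hr0.le hrJ1.le M
  have hxz : x ≤ T ^ E := pow_le_pow_left₀ (by positivity) hTl E
  have hzy : T ^ E ≤ y := pow_le_pow_left₀ hT0.le hTu E
  have hyx : y ≤ x + B * (x / J) := by
    have e := one_add_pow_le (1 / (J : ℝ)) (by positivity) (by rw [div_le_one hJp]; exact hJ1) (M * E)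
    have : y = x * (1 + 1 / (J : ℝ)) ^ (M * E) := by
      rw [hx, hy, ← pow_mul, ← pow_mul, ← mul_pow]; congr 1; field_simp
    rw [this]
    refine (mul_le_mul_of_nonneg_left e hx0.le).trans (le_of_eq ?_)
    rw [hB]; ring
  have hF1 := hF hTl
  have hF2 := hF hTu
  have hxJ : x / J ≤ x := div_le_self hx0.le hJ1
  have hxzJ : x / J ≤ T ^ E / J := div_le_div_of_nonneg_right hxz hJp.le
  have hpow : T ^ E / J ≤ 2 * T ^ ((E : ℝ) - 1 / M) := by
    rw [Real.rpow_sub hT0, Real.rpow_natCast, ← hr, div_le_iff₀ hJp]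
    have : r ≤ 2 * J := by linarith
    rw [mul_div_assoc', div_mul_eq_mul_div, le_div_iff₀ hr0]
    have := mul_le_mul_of_nonneg_left this (pow_pos hT0 E).le
    linarith
  have hCy : C / ((J : ℝ) + 1) * y ≤ C * (1 + B) * (x / J) := by
    have e1 : C / ((J : ℝ) + 1) ≤ C / J := div_le_div_of_nonneg_left hC hJp (by linarith)
    have e2 : y ≤ (1 + B) * x := by
      have := mul_le_mul_of_nonneg_left hxJ hB0.le
      linarith
    calc C / ((J : ℝ) + 1) * y ≤ C / J * ((1 + B) * x) :=
          mul_le_mul e1 e2 (by positivity) (by positivity)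
      _ = _ := by ring
  have hCx : C / J * x ≤ C * (1 + B) * (x / J) := by
    have : C / J * x = C * (x / J) := by ring
    rw [this]
    refine mul_le_mul_of_nonneg_right ?_ (by positivity)
    have := mul_nonneg hC hB0.le
    linarith
  have hL1 : |L * (y - T ^ E)| ≤ |L| * (B * (x / J)) := by
    rw [abs_mul, abs_of_nonneg (by linarith : 0 ≤ y - T ^ E)]
    exact mul_le_mul_of_nonneg_left (by linarith) (abs_nonneg L)
  have hL2 : |L * (T ^ E - x)| ≤ |L| * (B * (x / J)) := by
    rw [abs_mul, abs_of_nonneg (by linarith : 0 ≤ T ^ E - x)]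
    exact mul_le_mul_of_nonneg_left (by linarith) (abs_nonneg L)
  have hfin : |F T - L * T ^ E| ≤ (|L| * B + C * (1 + B)) * (x / J) := by
    rw [abs_le] at *
    constructor <;> linarith
  refine hfin.trans ?_
  calc (|L| * B + C * (1 + B)) * (x / J) ≤ (|L| * B + C * (1 + B) + 1) * (2 * T ^ ((E : ℝ) - 1 / M)) :=
        mul_le_mul (by linarith) (hxzJ.trans hpow) (by positivity) (by positivity)
    _ = _ := by ring

theorem prod_pert {ι : Type} (s : Finset ι) (x : ι → ℝ) : ∃ C : ℝ, 0 ≤ C ∧ ∀ (y : ι → ℝ) (ε : ℝ),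
    0 ≤ ε → ε ≤ 1 → (∀ i, |y i - x i| ≤ ε) → |∏ i ∈ s, y i - ∏ i ∈ s, x i| ≤ C * ε := by
  classical
  induction s using Finset.induction_on with
  | empty => exact ⟨0, le_rfl, fun y ε _ _ _ => by simp⟩
  | insert i s hi ih =>
    obtain ⟨C, hC, h⟩ := ih
    refine ⟨(|x i| + 1) * C + |∏ i ∈ s, x i|, by positivity, fun y ε h0 h1 hy => ?_⟩
    rw [Finset.prod_insert hi, Finset.prod_insert hi]
    have e := h y ε h0 h1 hy
    have e2 : |y i| ≤ |x i| + 1 := by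
      have := abs_sub_abs_le_abs_sub (y i) (x i)
      linarith [hy i]
    have : y i * ∏ i ∈ s, y i - x i * ∏ i ∈ s, x i =
      y i * (∏ i ∈ s, y i - ∏ i ∈ s, x i) + (y i - x i) * ∏ i ∈ s, x i := by ring
    rw [this]
    refine (abs_add_le _ _).trans ?_
    rw [abs_mul, abs_mul]
    calc |y i| * |∏ i ∈ s, y i - ∏ i ∈ s, x i| + |y i - x i| * |∏ i ∈ s, x i| ≤
        (|x i| + 1) * (C * ε) + ε * |∏ i ∈ s, x i| :=
          add_le_add (mul_le_mul e2 e (abs_nonneg _) (by positivity))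
            (mul_le_mul_of_nonneg_right (hy i) (abs_nonneg _))
      _ = _ := by ring

def Kc (k : ℕ) : ℕ := Fintype.card (Pairs k)
def ME (k : ℕ) : ℕ := (2 * Kc k + 6) * mE k
def Tj (k j : ℕ) : ℝ := ((j : ℝ) + 2) ^ ME k

theorem Tj_pos (k j : ℕ) : 0 < Tj k j := by unfold Tj; positivity

theorem gen_ae {d k : ℕ} (hk : 1 ≤ k) (hd : 4 * k ≤ d + 1) {ι : Type} (s : ℕ → Finset ι)
    (a b : ℕ → ι → Cfg d k) (H : ℝ) (hH : 1 ≤ H) (Q : ℝ) (hQ : 0 ≤ Q)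
    (hs : ∀ j, ((s j).card : ℝ) ≤ Q * ((j : ℝ) + 2) ^ (2 * Kc k))
    (ha : ∀ j, ∀ i ∈ s j, (a j i).ok H (Tj k j)⁻¹) (hb : ∀ j, ∀ i ∈ s j, (b j i).ok H (Tj k j)⁻¹) :
    ∀ᵐ X, ∃ C : ℝ, 0 < C ∧ ∀ j, ∀ i ∈ s j,
      |((a j i).Th X).toReal - ((b j i).Th X).toReal| ≤ C / ((j : ℝ) + 2) ^ 2 := by
  set G : ℕ → MM d → ENNReal := fun j X => ∑ i ∈ s j, ENNReal.ofReal (((j : ℝ) + 2) ^ 4) *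
    ENNReal.ofReal ((((a j i).Th X).toReal - ((b j i).Th X).toReal) ^ 2) with hG
  have hm : ∀ j, ∀ i ∈ s j, Measurable fun X =>
      ENNReal.ofReal ((((a j i).Th X).toReal - ((b j i).Th X).toReal) ^ 2) := by
    intro j i hi
    have h1 := ((a j i).meas_Th (ha j i hi).hm).ennreal_toReal
    have h2 := ((b j i).meas_Th (hb j i hi).hm).ennreal_toReal
    exact ((h1.sub h2).pow_const 2).ennreal_ofReal
  have key := ae_bdd G (fun j => Finset.measurable_fun_sum _ fun i hi => (hm j i hi).const_mul _) ?_
  · filter_upwards [key] with X hX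
    obtain ⟨C, hC, h⟩ := hX
    refine ⟨C + 1, by linarith, fun j i hi => ?_⟩
    have h1 := (Finset.single_le_sum (f := fun i => ENNReal.ofReal (((j : ℝ) + 2) ^ 4) *
      ENNReal.ofReal ((((a j i).Th X).toReal - ((b j i).Th X).toReal) ^ 2)) (fun _ _ => zero_le) hi).trans (h j)
    set x := ((a j i).Th X).toReal - ((b j i).Th X).toReal
    have hJ : (0 : ℝ) < (j : ℝ) + 2 := by positivity
    rw [← ENNReal.ofReal_mul (by positivity), ENNReal.ofReal_le_ofReal_iff hC.le] at h1
    rw [le_div_iff₀ (by positivity)]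
    refine abs_le_of_sq_le_sq' ?_ (by linarith) |>.2 |> fun h => h
    rw [mul_pow, sq_abs]
    nlinarith
  · intro R hR
    obtain ⟨C, hC, h⟩ := var_bound (d := d) hk hd (R : ℝ) H (by exact_mod_cast hR) hH
    refine ⟨Q * C, fun j => ?_⟩
    have hJ : (1 : ℝ) < (j : ℝ) + 2 := by linarith [(Nat.cast_nonneg j : (0 : ℝ) ≤ j)]
    have hJ0 : (0 : ℝ) < (j : ℝ) + 2 := by linarith
    have hτ : ((((j : ℝ) + 2) ^ (2 * Kc k + 6))⁻¹) ^ mE k = (Tj k j)⁻¹ := by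
      rw [Tj, ME, pow_mul, inv_pow]
    have h2 := h ((((j : ℝ) + 2) ^ (2 * Kc k + 6))⁻¹) (by positivity)
      (inv_lt_one_of_one_lt₀ (one_lt_pow₀ hJ (by omega)))
    rw [hτ] at h2
    simp only [hG]
    simp_rw [Finset.mul_sum]
    have hm2 : ∀ i ∈ s j, Measurable fun X => rho (R : ℝ) X * (ENNReal.ofReal (((j : ℝ) + 2) ^ 4) *
        ENNReal.ofReal ((((a j i).Th X).toReal - ((b j i).Th X).toReal) ^ 2)) :=
      fun i hi => (meas_rho _).mul ((hm j i hi).const_mul _)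
    rw [lintegral_finsetSum' _ fun i hi => (hm2 i hi).aemeasurable]
    have h3 : ∀ i ∈ s j, ∫⁻ X, rho (R : ℝ) X * (ENNReal.ofReal (((j : ℝ) + 2) ^ 4) *
        ENNReal.ofReal ((((a j i).Th X).toReal - ((b j i).Th X).toReal) ^ 2)) ≤
        ENNReal.ofReal (((j : ℝ) + 2) ^ 4 * (C * (((j : ℝ) + 2) ^ (2 * Kc k + 6))⁻¹)) := by
      intro i hi
      have e : ∀ X, rho (R : ℝ) X * (ENNReal.ofReal (((j : ℝ) + 2) ^ 4) *
        ENNReal.ofReal ((((a j i).Th X).toReal - ((b j i).Th X).toReal) ^ 2)) =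
        ENNReal.ofReal (((j : ℝ) + 2) ^ 4) * (rho (R : ℝ) X *
        ENNReal.ofReal ((((a j i).Th X).toReal - ((b j i).Th X).toReal) ^ 2)) := fun X => by ring
      simp_rw [e]
      have hm3 : Measurable fun X => rho (R : ℝ) X *
          ENNReal.ofReal ((((a j i).Th X).toReal - ((b j i).Th X).toReal) ^ 2) :=
        (meas_rho _).mul (hm j i hi)
      rw [lintegral_const_mul _ hm3,
        ENNReal.ofReal_mul (p := ((j : ℝ) + 2) ^ 4) (by positivity)]
      exact mul_le_mul_right (h2 _ _ (ha j i hi) (hb j i hi)) _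
    refine (Finset.sum_le_sum h3).trans ?_
    rw [Finset.sum_const, nsmul_eq_mul, ← ENNReal.ofReal_natCast, ← ENNReal.ofReal_mul (by positivity)]
    refine ENNReal.ofReal_le_ofReal ?_
    refine (mul_le_mul_of_nonneg_right (hs j) (by positivity)).trans (le_of_eq ?_)
    rw [show 2 * Kc k + 6 = 2 * Kc k + 4 + 2 by omega, pow_add, pow_add]
    field_simp

def Dref (d k : ℕ) (X : MM d) (j : ℕ) : ℝ := ((fc (k := k) 1 0 (Tj k j) (fun _ => -1) (fun _ => 1)).Th X).toReal

theorem ref_ok {d k : ℕ} (H : ℝ) (hH : 1 ≤ H) (hd : (d : ℝ) ≤ H) (j i : ℕ) (hij : j ≤ i) :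
    (fc (d := d) (k := k) 1 0 (Tj k i) (fun _ => -1) (fun _ => 1)).ok H (Tj k j)⁻¹ := by
  refine fc_ok 1 one_pos 0 _ (Tj_pos k i) _ _ H _ (by simpa using hd) ?_ (fun p => by linarith)
    (fun p => by simpa using hH) (fun p => by simpa using hH)
  refine inv_anti₀ (Tj_pos k j) (pow_le_pow_left₀ (by positivity) ?_ _)
  have : (j : ℝ) ≤ i := by exact_mod_cast hij
  linarith

theorem ref_ae {d k : ℕ} (hk : 1 ≤ k) (hd : 4 * k ≤ d + 1) :
    ∀ᵐ X : MM d, ∃ C : ℝ, 0 < C ∧ ∀ j, |Dref d k X (j + 1) - Dref d k X j| ≤ C / ((j : ℝ) + 2) ^ 2 := by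
  have h := gen_ae hk hd (fun _ => (Finset.univ : Finset Unit))
    (fun j _ => fc (d := d) (k := k) 1 0 (Tj k (j + 1)) (fun _ => -1) (fun _ => 1))
    (fun j _ => fc (d := d) (k := k) 1 0 (Tj k j) (fun _ => -1) (fun _ => 1)) ((d : ℝ) + 1) (by simp) 1
    (by norm_num) (fun j => by
      have : (1 : ℝ) ≤ ((j : ℝ) + 2) ^ (2 * Kc k) :=
        one_le_pow₀ (by linarith [(Nat.cast_nonneg j : (0 : ℝ) ≤ j)])
      simpa using this)
    (fun j i _ => ref_ok _ (by simp) (by simp) j (j + 1) (by omega))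
    (fun j i _ => ref_ok _ (by simp) (by simp) j j le_rfl)
  filter_upwards [h] with X hX
  obtain ⟨C, hC, h⟩ := hX
  exact ⟨C, hC, fun j => h j () (Finset.mem_univ _)⟩

theorem cfg_ae {d k : ℕ} (hk : 1 ≤ k) (hd : 4 * k ≤ d + 1) (N : ℕ) (hN : 0 < N) (v₀ : Fin d → ℤ)
    (H : ℕ) (hH : 1 ≤ H) (hdH : d * N ≤ H) :
    ∀ᵐ X : MM d, ∃ C : ℝ, 0 < C ∧ ∀ (j : ℕ) (r q : Pairs k → ℤ), (∀ p, |r p| ≤ H * (j + 2)) →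
      (∀ p, |q p| ≤ H * (j + 2)) → (∀ p, (j + 2 : ℤ) ≤ H * (q p - r p)) →
      |((fc N v₀ (Tj k j) (fun p => (r p : ℝ) / (j + 2)) (fun p => (q p : ℝ) / (j + 2))).Th X).toReal
        - Dref d k X j| ≤ C / ((j : ℝ) + 2) ^ 2 := by
  classical
  have hdN : d ≤ H := (Nat.le_mul_of_pos_right d hN).trans hdH
  set I : ℕ → Finset (Pairs k → ℤ) := fun j => Fintype.piFinset fun _ =>
    Finset.Icc (-(H * (j + 2) : ℤ)) (H * (j + 2)) with hI
  have h := gen_ae hk hd (fun j => ((I j) ×ˢ (I j)).filter fun z => ∀ p, (j + 2 : ℤ) ≤ H * (z.2 p - z.1 p))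
    (fun j z => fc N v₀ (Tj k j) (fun p => (z.1 p : ℝ) / (j + 2)) (fun p => (z.2 p : ℝ) / (j + 2)))
    (fun j _ => fc (d := d) (k := k) 1 0 (Tj k j) (fun _ => -1) (fun _ => 1)) (H : ℝ) (by exact_mod_cast hH)
    ((3 * H : ℝ) ^ (2 * Kc k)) (by positivity) (fun j => by
      refine (Nat.cast_le.mpr (Finset.card_filter_le _ _)).trans ?_
      rw [Finset.card_product]
      simp only [hI]
      rw [Fintype.card_piFinset, Finset.prod_const, Finset.card_univ, ← pow_add, ← mul_pow]
      rw [show Fintype.card (Pairs k) + Fintype.card (Pairs k) = 2 * Kc k by rw [Kc]; ring]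
      push_cast
      refine pow_le_pow_left₀ (by positivity) ?_ _
      have : (Finset.Icc (-(H * (j + 2) : ℤ)) (H * (j + 2))).card = 2 * (H * (j + 2)) + 1 := by
        rw [Int.card_Icc]
        have : ((H * (j + 2) : ℤ) + 1 - -(H * (j + 2) : ℤ)) = ((2 * (H * (j + 2)) + 1 : ℕ) : ℤ) := by
          push_cast; ring
        rw [this, Int.toNat_natCast]
      rw [this]
      have h1 : (1 : ℝ) ≤ H * (j + 2) := by
        have : 1 ≤ H * (j + 2) := Nat.one_le_iff_ne_zero.mpr (by positivity)
        exact_mod_cast this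
      push_cast
      linarith)
    (fun j z hz => by
      rw [Finset.mem_filter, Finset.mem_product, hI, Fintype.mem_piFinset, Fintype.mem_piFinset] at hz
      obtain ⟨⟨h1, h2⟩, h3⟩ := hz
      have hJ : (0 : ℝ) < (j : ℝ) + 2 := by positivity
      have hab : ∀ x : ℤ, x ∈ Finset.Icc (-(H * (j + 2) : ℤ)) (H * (j + 2)) → |(x : ℝ) / ((j : ℝ) + 2)| ≤ H := by
        intro x hx
        rw [Finset.mem_Icc, ← abs_le] at hx
        rw [abs_div, abs_of_pos hJ, div_le_iff₀ hJ]
        have : ((|x| : ℤ) : ℝ) ≤ ((H * (j + 2) : ℤ) : ℝ) := by exact_mod_cast hx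
        push_cast at this
        exact this
      refine fc_ok N hN v₀ _ (Tj_pos k j) _ _ H _ (by exact_mod_cast hdH) le_rfl (fun p => ?_)
        (fun p => hab _ (h1 p)) (fun p => hab _ (h2 p))
      have := h3 p
      have h4 : ((j + 2 : ℤ) : ℝ) ≤ ((H * (z.2 p - z.1 p) : ℤ) : ℝ) := by exact_mod_cast this
      push_cast at h4
      rw [← sub_div, mul_div_assoc', le_div_iff₀ hJ]
      linarith)
    (fun j i _ => ref_ok _ (by exact_mod_cast hH) (by exact_mod_cast hdN) j j le_rfl)
  filter_upwards [h] with X hX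
  obtain ⟨C, hC, h⟩ := hX
  refine ⟨C, hC, fun j r q hr hq hrq => h j (r, q) ?_⟩
  rw [Finset.mem_filter, Finset.mem_product, hI, Fintype.mem_piFinset, Fintype.mem_piFinset]
  exact ⟨⟨fun p => Finset.mem_Icc.mpr (abs_le.mp (hr p)), fun p => Finset.mem_Icc.mpr (abs_le.mp (hq p))⟩, hrq⟩

theorem exists_H {k : ℕ} (a b : Pairs k → ℝ) (hab : ∀ p, a p < b p) (D : ℕ) : ∃ H : ℕ, 1 ≤ H ∧ D ≤ H ∧
    ∀ p, |a p| + 1 ≤ H ∧ |b p| + 1 ≤ H ∧ 2 ≤ H * (b p - a p) := by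
  obtain ⟨H, hH⟩ := exists_nat_ge ((D : ℝ) + 1 + ∑ p, (|a p| + |b p| + 2 / (b p - a p)))
  have h0 : ∀ p, 0 ≤ |a p| + |b p| + 2 / (b p - a p) := fun p => by
    have := sub_pos.mpr (hab p)
    positivity
  have h1 : ∀ p, |a p| + |b p| + 2 / (b p - a p) ≤ ∑ p, (|a p| + |b p| + 2 / (b p - a p)) := fun p =>
    Finset.single_le_sum (fun p _ => h0 p) (Finset.mem_univ p)
  have h2 : (0 : ℝ) ≤ ∑ p, (|a p| + |b p| + 2 / (b p - a p)) := Finset.sum_nonneg fun p _ => h0 p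
  have hD : (0 : ℝ) ≤ D := Nat.cast_nonneg D
  refine ⟨H, ?_, ?_, fun p => ?_⟩
  · have : (1 : ℝ) ≤ H := by linarith
    exact_mod_cast this
  · have : (D : ℝ) ≤ H := by linarith
    exact_mod_cast this
  · have hp := sub_pos.mpr (hab p)
    have h3 : 0 ≤ 2 / (b p - a p) := by positivity
    have := h1 p
    have ha := abs_nonneg (a p)
    have hb := abs_nonneg (b p)
    refine ⟨by linarith, by linarith, ?_⟩
    rw [← div_le_iff₀ hp]; linarith

theorem A_fin {d k : ℕ} (N : ℕ) (hN : 0 < N) (v₀ : Fin d → ℤ) (T : ℝ) (hT : 0 < T)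
    (lo hi : Pairs k → ℝ) (hlh : ∀ p, lo p < hi p) (X : MM d) :
    volume ((fc N v₀ T lo hi).A X) ≠ ⊤ := by
  obtain ⟨H, h1, h2, h3⟩ := exists_H lo hi hlh (d * N)
  exact (fc_ok N hN v₀ T hT lo hi H T⁻¹ (by exact_mod_cast h2) le_rfl (fun p => by linarith [(h3 p).2.2])
    (fun p => by linarith [(h3 p).1]) (fun p => by linarith [(h3 p).2.1])).A_ne_top X

theorem tele (u : ℕ → ℝ) (C : ℝ) (hC : 0 < C) (h : ∀ j : ℕ, |u (j + 1) - u j| ≤ C / ((j : ℝ) + 2) ^ 2) :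
    ∃ c, ∀ j : ℕ, |u j - c| ≤ C / ((j : ℝ) + 1) := by
  have e : ∀ j : ℕ, C / ((j : ℝ) + 2) ^ 2 ≤ C / ((j : ℝ) + 1) - C / ((j : ℝ) + 1 + 1) := by
    intro j
    have hj : (0 : ℝ) ≤ j := Nat.cast_nonneg j
    have : C / ((j : ℝ) + 1) - C / ((j : ℝ) + 1 + 1) = C / (((j : ℝ) + 1) * ((j : ℝ) + 2)) := by
      field_simp; ring
    rw [this]
    exact div_le_div_of_nonneg_left hC.le (by positivity) (by nlinarith)
  have hw : Monotone fun j : ℕ => u j - C / ((j : ℝ) + 1) := monotone_nat_of_le_succ fun j => by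
    have := abs_le.mp (h j)
    push_cast
    linarith [e j]
  have hv : Antitone fun j : ℕ => u j + C / ((j : ℝ) + 1) := antitone_nat_of_succ_le fun j => by
    have := abs_le.mp (h j)
    push_cast
    linarith [e j]
  have := hw.ciSup_mem_iInter_Icc_of_antitone hv (fun j => by
    have : 0 < C / ((j : ℝ) + 1) := by positivity
    show u j - C / ((j : ℝ) + 1) ≤ u j + C / ((j : ℝ) + 1)
    linarith)
  refine ⟨⨆ n : ℕ, (u n - C / ((n : ℝ) + 1)), fun j => ?_⟩
  have h2 := Set.mem_iInter.mp this j
  rw [Set.mem_Icc] at h2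
  rw [abs_le]
  constructor <;> linarith [h2.1, h2.2]

def Asy {d : ℕ} (k N : ℕ) (v₀ : Fin d → ℤ) (E : ℕ) (X : MM d) (c : ℝ) : Prop :=
  ∀ a b : Pairs k → ℝ, (∀ p, a p < b p) → ∃ C > 0, ∃ T0 > 0, ∀ T > T0,
    |(N : ℝ) ^ (d * k) * cX N v₀ X a b T - c * (∏ p, (b p - a p)) * T ^ E| ≤ C * T ^ ((E : ℝ) - 1 / ME k)

theorem level {d k E : ℕ} (hE : d * k = E + 2 * Fintype.card (Pairs k)) (N : ℕ) (hN : 0 < N)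
    (v₀ : Fin d → ℤ) (X : MM d) (c C2 : ℝ) (hC2 : 0 < C2)
    (hc : ∀ j : ℕ, |Dref d k X j - c| ≤ C2 / ((j : ℝ) + 1))
    (h : ∀ H : ℕ, 1 ≤ H → d * N ≤ H → ∃ C : ℝ, 0 < C ∧ ∀ (j : ℕ) (r q : Pairs k → ℤ), (∀ p, |r p| ≤ H * (j + 2)) →
      (∀ p, |q p| ≤ H * (j + 2)) → (∀ p, (j + 2 : ℤ) ≤ H * (q p - r p)) →
      |((fc N v₀ (Tj k j) (fun p => (r p : ℝ) / (j + 2)) (fun p => (q p : ℝ) / (j + 2))).Th X).toReal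
        - Dref d k X j| ≤ C / ((j : ℝ) + 2) ^ 2) : Asy k N v₀ E X c := by
  intro a b hab
  obtain ⟨H, hH1, hH2, hH⟩ := exists_H a b hab (d * N)
  obtain ⟨C1, hC1, h1⟩ := h H hH1 hH2
  obtain ⟨C4, hC4, h4⟩ := prod_pert Finset.univ (fun p => b p - a p)
  set P := ∏ p, (b p - a p) with hP
  have hHr : (1 : ℝ) ≤ H := by exact_mod_cast hH1
  set C3 := C1 + 2 * C2 with hC3
  set C := C3 * (|P| + C4) + |c| * (C4 * 2) with hCdef
  have hC0 : 0 ≤ C := by positivity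
  -- common estimate
  have key : ∀ (j : ℕ) (r q : Pairs k → ℤ), 2 * H ≤ j →
      (∀ p, |(r p : ℝ) - ((j : ℝ) + 2) * a p| ≤ 1) → (∀ p, |(q p : ℝ) - ((j : ℝ) + 2) * b p| ≤ 1) →
      |(N : ℝ) ^ (d * k) * cX N v₀ X (fun p => (r p : ℝ) / (j + 2)) (fun p => (q p : ℝ) / (j + 2)) (Tj k j)
        - c * P * Tj k j ^ E| ≤ C / ((j : ℝ) + 2) * Tj k j ^ E := by
    intro j r q hj hr hq
    have hjH : (2 : ℝ) * H ≤ j := by exact_mod_cast hj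
    set J : ℝ := (j : ℝ) + 2 with hJ
    have hJ0 : 0 < J := by positivity
    have hJ2 : 2 ≤ J := by linarith [(Nat.cast_nonneg j : (0 : ℝ) ≤ j)]
    have hwid : ∀ p, J ≤ H * ((q p : ℝ) - r p) := by
      intro p
      have e1 := abs_le.mp (hr p)
      have e2 := abs_le.mp (hq p)
      have e3 : J * (b p - a p) - 2 ≤ (q p : ℝ) - r p := by linarith
      have e4 := mul_le_mul_of_nonneg_left e3 (by linarith : (0 : ℝ) ≤ H)
      have e5 := mul_le_mul_of_nonneg_left (hH p).2.2 hJ0.le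
      linarith
    have hbd : ∀ (x : ℝ) (z : ℤ), |x| + 1 ≤ H → |(z : ℝ) - J * x| ≤ 1 → |z| ≤ (H : ℤ) * (j + 2) := by
      intro x z hx hz
      have e1 : |(z : ℝ)| ≤ 1 + J * |x| := by
        have := abs_sub_abs_le_abs_sub (z : ℝ) (J * x)
        rw [abs_mul, abs_of_pos hJ0] at this
        linarith
      have e2 := mul_le_mul_of_nonneg_left hx hJ0.le
      have : ((|z| : ℤ) : ℝ) ≤ (((H : ℤ) * (j + 2) : ℤ) : ℝ) := by
        push_cast
        rw [← hJ]; linarith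
      exact_mod_cast this
    have hΘ := h1 j r q (fun p => hbd _ _ (hH p).1 (hr p)) (fun p => hbd _ _ (hH p).2.1 (hq p)) (fun p => by
      have := hwid p
      rw [hJ] at this
      exact_mod_cast this)
    have hlt : ∀ p, (r p : ℝ) / J < (q p : ℝ) / J := by
      intro p
      refine div_lt_div_of_pos_right ?_ hJ0
      have := hwid p
      by_contra hcon
      push Not at hcon
      have := mul_nonneg (by linarith : (0 : ℝ) ≤ H) (sub_nonneg.mpr hcon)
      linarith
    have hTf := Th_formula hE N hN v₀ (Tj k j) (Tj_pos k j) _ _ hlt X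
      (A_fin N hN v₀ _ (Tj_pos k j) _ _ hlt X)
    rw [hTf]
    set Θ := ((fc N v₀ (Tj k j) (fun p => (r p : ℝ) / J) (fun p => (q p : ℝ) / J)).Th X).toReal
    set P' := ∏ p, ((q p : ℝ) / J - (r p : ℝ) / J) with hP'
    have hPP : |P' - P| ≤ C4 * (2 / J) := by
      refine h4 _ (2 / J) (by positivity) (by rw [div_le_one hJ0]; exact hJ2) fun p => ?_
      have : (q p : ℝ) / J - (r p : ℝ) / J - (b p - a p) =
        (((q p : ℝ) - J * b p) - ((r p : ℝ) - J * a p)) / J := by field_simp; ring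
      rw [this, abs_div, abs_of_pos hJ0]
      refine div_le_div_of_nonneg_right ((abs_sub _ _).trans ?_) hJ0.le
      linarith [hr p, hq p]
    have hΘc : |Θ - c| ≤ C3 / J := by
      have e1 : C1 / J ^ 2 ≤ C1 / J := div_le_div_of_nonneg_left hC1.le hJ0 (by nlinarith)
      have e2 : C2 / ((j : ℝ) + 1) ≤ 2 * C2 / J := by
        rw [div_le_div_iff₀ (by positivity) hJ0]
        have : J ≤ 2 * ((j : ℝ) + 1) := by rw [hJ]; linarith [(Nat.cast_nonneg j : (0 : ℝ) ≤ j)]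
        have := mul_le_mul_of_nonneg_left this hC2.le
        linarith
      have e3 := abs_sub_le Θ (Dref d k X j) c
      have e4 : C3 / J = C1 / J + 2 * C2 / J := by rw [hC3]; ring
      linarith [hc j]
    have hP'b : |P'| ≤ |P| + C4 := by
      have e1 := abs_sub_abs_le_abs_sub P' P
      have e2 : C4 * (2 / J) ≤ C4 * 1 := mul_le_mul_of_nonneg_left (by rw [div_le_one hJ0]; exact hJ2) hC4
      linarith
    have hx : 0 < Tj k j ^ E := pow_pos (Tj_pos k j) E
    have : Θ * P' * Tj k j ^ E - c * P * Tj k j ^ E = ((Θ - c) * P' + c * (P' - P)) * Tj k j ^ E := by ring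
    rw [this, abs_mul, abs_of_pos hx]
    refine mul_le_mul_of_nonneg_right ((abs_add_le _ _).trans ?_) hx.le
    rw [abs_mul, abs_mul]
    have e1 := mul_le_mul hΘc hP'b (abs_nonneg _) (by positivity)
    have e2 := mul_le_mul_of_nonneg_left hPP (abs_nonneg c)
    refine (add_le_add e1 e2).trans (le_of_eq ?_)
    rw [hCdef]; ring
  refine interp1 (fun T => (N : ℝ) ^ (d * k) * cX N v₀ X a b T) (fun T T' hTT => ?_) (c * P) C hC0 E (ME k)
    (2 * H + 2) (Nat.mul_pos (by omega) (by unfold mE; omega)) fun J hJ => ?_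
  · refine mul_le_mul_of_nonneg_left ?_ (by positivity)
    exact_mod_cast cX_mono N v₀ X (fun p => le_rfl) (fun p => le_rfl) hTT
  · obtain ⟨j, rfl⟩ : ∃ j, J = j + 2 := ⟨J - 2, by omega⟩
    have hTJ : ((j + 2 : ℕ) : ℝ) ^ ME k = Tj k j := by rw [Tj]; push_cast; rfl
    rw [hTJ]
    push_cast
    have hJ0 : (0 : ℝ) < (j : ℝ) + 2 := by positivity
    have fl : ∀ x : ℝ, |(⌊x⌋ : ℝ) - x| ≤ 1 := fun x => by
      rw [abs_le]; constructor <;> linarith [Int.floor_le x, Int.lt_floor_add_one x]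
    have cl : ∀ x : ℝ, |(⌈x⌉ : ℝ) - x| ≤ 1 := fun x => by
      rw [abs_le]; constructor <;> linarith [Int.le_ceil x, Int.ceil_lt_add_one x]
    have k1 := key j (fun p => ⌊((j : ℝ) + 2) * a p⌋) (fun p => ⌈((j : ℝ) + 2) * b p⌉) (by omega)
      (fun p => fl _) (fun p => cl _)
    have k2 := key j (fun p => ⌈((j : ℝ) + 2) * a p⌉) (fun p => ⌊((j : ℝ) + 2) * b p⌋) (by omega)
      (fun p => cl _) (fun p => fl _)
    have m1 : cX N v₀ X a b (Tj k j) ≤ cX N v₀ X (fun p => ((⌊((j : ℝ) + 2) * a p⌋ : ℤ) : ℝ) / (j + 2))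
        (fun p => ((⌈((j : ℝ) + 2) * b p⌉ : ℤ) : ℝ) / (j + 2)) (Tj k j) :=
      cX_mono N v₀ X (fun p => by rw [div_le_iff₀ hJ0, mul_comm]; exact Int.floor_le _)
        (fun p => by rw [le_div_iff₀ hJ0, mul_comm]; exact Int.le_ceil _) le_rfl
    have m2 : cX N v₀ X (fun p => ((⌈((j : ℝ) + 2) * a p⌉ : ℤ) : ℝ) / (j + 2))
        (fun p => ((⌊((j : ℝ) + 2) * b p⌋ : ℤ) : ℝ) / (j + 2)) (Tj k j) ≤ cX N v₀ X a b (Tj k j) :=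
      cX_mono N v₀ X (fun p => by rw [le_div_iff₀ hJ0, mul_comm]; exact Int.le_ceil _)
        (fun p => by rw [div_le_iff₀ hJ0, mul_comm]; exact Int.floor_le _) le_rfl
    have hN0 : (0 : ℝ) ≤ (N : ℝ) ^ (d * k) := by positivity
    have m1' := mul_le_mul_of_nonneg_left (Nat.cast_le (α := ℝ).mpr m1) hN0
    have m2' := mul_le_mul_of_nonneg_left (Nat.cast_le (α := ℝ).mpr m2) hN0
    rw [abs_le] at k1 k2 ⊢
    constructor <;> linarith [k1.1, k1.2, k2.1, k2.2]

theorem main_ae {d k E : ℕ} (hk : 1 ≤ k) (hd : 4 * k ≤ d + 1) (hE : d * k = E + 2 * Fintype.card (Pairs k))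
    (N : ℕ) (hN : 0 < N) (v₀ : Fin d → ℤ) :
    ∀ᵐ X : MM d, ∃ c, Asy k 1 0 E X c ∧ Asy k N v₀ E X c := by
  have g : ∀ (N : ℕ) (_ : 0 < N) (v₀ : Fin d → ℤ), ∀ᵐ X : MM d, ∀ H : ℕ, 1 ≤ H → d * N ≤ H →
      ∃ C : ℝ, 0 < C ∧ ∀ (j : ℕ) (r q : Pairs k → ℤ), (∀ p, |r p| ≤ H * (j + 2)) →
      (∀ p, |q p| ≤ H * (j + 2)) → (∀ p, (j + 2 : ℤ) ≤ H * (q p - r p)) →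
      |((fc N v₀ (Tj k j) (fun p => (r p : ℝ) / (j + 2)) (fun p => (q p : ℝ) / (j + 2))).Th X).toReal
        - Dref d k X j| ≤ C / ((j : ℝ) + 2) ^ 2 := by
    intro N hN v₀
    rw [ae_all_iff]; intro H
    rw [ae_all_iff]; intro h1
    rw [ae_all_iff]; intro h2
    exact cfg_ae hk hd N hN v₀ H h1 h2
  filter_upwards [g 1 one_pos 0, g N hN v₀, ref_ae hk hd] with X h1 h2 h3
  obtain ⟨C, hC, h⟩ := h3
  obtain ⟨c, hc⟩ := tele _ C hC h
  exact ⟨c, level hE 1 one_pos 0 X c C hC hc h1, level hE N hN v₀ X c C hC hc h2⟩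

def SS {d l : ℕ} (X : MM d) (V : Fin l → EE d) (T : ℝ) : Set (Fin d → ℤ) :=
  {v | ‖ev v‖ < T ∧ ∀ i, AX X (V i) (ev v) ∈ Set.Ioo (-1 : ℝ) 1}

theorem ev_sub {d : ℕ} (v w : Fin d → ℤ) : ev (v - w) = ev v - ev w := by
  ext i; simp [ev]

theorem AX_sub_right {d : ℕ} (X : MM d) (u w w' : EE d) : AX X u (w - w') = AX X u w - AX X u w' := by
  have : tens u (w - w') - tens (w - w') u = (tens u w - tens w u) - (tens u w' - tens w' u) := by
    rw [tens_sub_left, tens_sub_right]; abel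
  rw [AX, this, inner_sub_right]; rfl

theorem SS_finite {d l : ℕ} (X : MM d) (V : Fin l → EE d) (T : ℝ) : (SS X V T).Finite := by
  refine (Set.finite_Icc (fun _ => -⌈T⌉ : Fin d → ℤ) (fun _ => ⌈T⌉)).subset ?_
  intro v hv
  have h : ∀ i, |v i| ≤ ⌈T⌉ := by
    intro i
    have h1 := PiLp.norm_apply_le (ev v) i
    have h3 : ‖(ev v) i‖ = ((|v i| : ℤ) : ℝ) := by simp [ev]
    rw [h3] at h1
    have h4 : ((|v i| : ℤ) : ℝ) ≤ (⌈T⌉ : ℝ) := h1.trans (hv.1.le.trans (Int.le_ceil T))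
    exact_mod_cast h4
  exact ⟨fun i => (abs_le.mp (h i)).1, fun i => (abs_le.mp (h i)).2⟩

theorem pigeon {d : ℕ} (l : ℕ) (X : MM d) : ∃ c : ℝ, 0 < c ∧ ∃ T0 : ℝ, 1 ≤ T0 ∧ ∀ T, T0 ≤ T →
    ∀ V : Fin l → EE d, (∀ i, ‖V i‖ < T) → c * T ^ d ≤ Nat.card (SS X V T) * T ^ (2 * l) := by
  classical
  set Q : ℝ := 4 * ‖X‖ + 5 with hQ
  have hQ0 : 0 < Q := by positivity
  refine ⟨(1 / (2 * ((d : ℝ) + 1))) ^ d / Q ^ l, by positivity, 2 * ((d : ℝ) + 1),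
    by linarith [(Nat.cast_nonneg d : (0 : ℝ) ≤ d)], fun T hT V hV => ?_⟩
  have hd0 : (0 : ℝ) ≤ d := Nat.cast_nonneg d
  have hT1 : 1 ≤ T := by linarith
  set m := ⌊T / ((d : ℝ) + 1)⌋₊ with hm
  have hm1 : (m : ℝ) * (d + 1) ≤ T := by
    rw [← le_div_iff₀ (by positivity)]; exact Nat.floor_le (by positivity)
  have hm2 : 1 / (2 * ((d : ℝ) + 1)) * T ≤ m := by
    have e1 := Nat.lt_floor_add_one (T / ((d : ℝ) + 1))
    rw [← hm] at e1
    have e2 : 1 ≤ 1 / (2 * ((d : ℝ) + 1)) * T := by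
      rw [div_mul_eq_mul_div, le_div_iff₀ (by positivity)]; linarith
    have e3 : T / ((d : ℝ) + 1) = 1 / (2 * ((d : ℝ) + 1)) * T + 1 / (2 * ((d : ℝ) + 1)) * T := by
      field_simp; ring
    linarith
  have hm0 : (0 : ℝ) < m := lt_of_lt_of_le (by positivity) hm2
  set s : Finset (Fin d → ℤ) := Fintype.piFinset fun _ => Finset.Ico (0 : ℤ) m with hs
  set W : ℤ := ⌈2 * ‖X‖ * T ^ 2⌉ with hW
  have hW0 : (0 : ℝ) ≤ 2 * ‖X‖ * T ^ 2 := by positivity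
  have hWn : 0 ≤ W := Int.ceil_nonneg hW0
  set t : Finset (Fin l → ℤ) := Fintype.piFinset fun _ => Finset.Icc (-W - 1) W with ht
  set f : (Fin d → ℤ) → (Fin l → ℤ) := fun v i => ⌊AX X (V i) (ev v)⌋ with hf
  have hsn : ∀ v ∈ s, ∀ i, 0 ≤ v i ∧ v i < m := by
    intro v hv i
    rw [hs, Fintype.mem_piFinset] at hv
    exact Finset.mem_Ico.mp (hv i)
  have hnorm : ∀ v : Fin d → ℤ, (∀ i, |(v i : ℝ)| ≤ m) → ‖ev v‖ < T := by
    intro v hv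
    have := norm_le_sum (ev v) m hm0.le (fun i => by simpa [ev] using hv i)
    linarith
  have hmaps : ∀ v ∈ s, f v ∈ t := by
    intro v hv
    rw [ht, Fintype.mem_piFinset]
    intro i
    have h1 := AX_le X (V i) (ev v)
    have h2 := hnorm v (fun i => by
      obtain ⟨e1, e2⟩ := hsn v hv i
      have e1' : (0 : ℝ) ≤ v i := by exact_mod_cast e1
      have e2' : (v i : ℝ) ≤ m := by exact_mod_cast e2.le
      rw [abs_of_nonneg e1']; exact e2')
    have h3 : ‖V i‖ * ‖ev v‖ ≤ T * T := mul_le_mul (hV i).le h2.le (norm_nonneg _) (by linarith)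
    have h4 : |AX X (V i) (ev v)| ≤ 2 * ‖X‖ * T ^ 2 := by
      refine h1.trans ?_
      rw [sq]
      exact mul_le_mul_of_nonneg_left h3 (by positivity)
    have h5 := Int.le_ceil (2 * ‖X‖ * T ^ 2)
    rw [← hW] at h5
    have h6 := abs_le.mp h4
    rw [Finset.mem_Icc]
    constructor
    · rw [hf]
      refine Int.le_floor.mpr ?_
      push_cast; linarith
    · have : (⌊AX X (V i) (ev v)⌋ : ℝ) ≤ (W : ℝ) := (Int.floor_le _).trans (by linarith)
      exact_mod_cast this
  have hcs : (s.card : ℝ) = (m : ℝ) ^ d := by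
    rw [hs, Fintype.card_piFinset, Finset.prod_const, Finset.card_univ, Fintype.card_fin, Int.card_Ico]
    simp
  have hct : (t.card : ℝ) ≤ (Q * T ^ 2) ^ l := by
    rw [ht, Fintype.card_piFinset, Finset.prod_const, Finset.card_univ, Fintype.card_fin, Int.card_Icc]
    push_cast
    refine pow_le_pow_left₀ (by positivity) ?_ l
    have e : ((((W + 1 - (-W - 1)).toNat : ℤ)) : ℝ) = 2 * W + 2 := by
      rw [Int.toNat_of_nonneg (by omega)]; push_cast; ring
    rw [← Int.cast_natCast, e]
    have h5 := Int.ceil_lt_add_one (2 * ‖X‖ * T ^ 2)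
    rw [← hW] at h5
    have : 1 ≤ T ^ 2 := one_le_pow₀ hT1
    have : Q * T ^ 2 = 2 * (2 * ‖X‖ * T ^ 2) + 5 * T ^ 2 := by rw [hQ]; ring
    linarith
  have htn : t.Nonempty := by
    rw [ht]; exact Fintype.piFinset_nonempty.mpr fun _ => ⟨0, by rw [Finset.mem_Icc]; omega⟩
  have htc : (0 : ℝ) < t.card := by exact_mod_cast htn.card_pos
  obtain ⟨y, hy, hb⟩ := Finset.exists_le_card_fiber_of_nsmul_le_card_of_maps_to (M := ℝ) hmaps htn
    (b := (m : ℝ) ^ d / t.card) (by rw [nsmul_eq_mul, hcs, mul_div_cancel₀ _ htc.ne'])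
  set F := s.filter fun x => f x = y with hF
  have hFp : 0 < F.card := by
    have : (0 : ℝ) < (F.card : ℝ) := lt_of_lt_of_le (by positivity) hb
    exact_mod_cast this
  obtain ⟨w, hw⟩ := Finset.card_pos.mp hFp
  have hFS : F.card ≤ Nat.card (SS X V T) := by
    rw [Nat.card_coe_set_eq, ← Set.ncard_coe_finset, ← Set.ncard_image_of_injective (F : Set (Fin d → ℤ))
      (sub_left_injective (b := w))]
    refine Set.ncard_le_ncard ?_ (SS_finite X V T)
    rintro _ ⟨v, hv, rfl⟩
    rw [Finset.mem_coe, hF, Finset.mem_filter] at hv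
    rw [hF, Finset.mem_filter] at hw
    refine ⟨hnorm _ fun i => ?_, fun i => ?_⟩
    · obtain ⟨e1, e2⟩ := hsn v hv.1 i
      obtain ⟨e3, e4⟩ := hsn w hw.1 i
      have : |v i - w i| ≤ m := by rw [abs_le]; constructor <;> omega
      have : ((|v i - w i| : ℤ) : ℝ) ≤ m := by exact_mod_cast this
      simpa using this
    · show AX X (V i) (ev (v - w)) ∈ Set.Ioo (-1 : ℝ) 1
      rw [ev_sub, AX_sub_right]
      have : ⌊AX X (V i) (ev v)⌋ = ⌊AX X (V i) (ev w)⌋ := by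
        have := congrFun (hv.2.trans hw.2.symm) i
        exact this
      exact abs_lt.mp (Int.abs_sub_lt_one_of_floor_eq_floor this)
  have hFS' : (F.card : ℝ) ≤ Nat.card (SS X V T) := by exact_mod_cast hFS
  have h7 : (m : ℝ) ^ d / (Q * T ^ 2) ^ l ≤ Nat.card (SS X V T) :=
    (div_le_div_of_nonneg_left (by positivity) htc hct).trans (hb.trans hFS')
  rw [div_le_iff₀ (by positivity), mul_pow, ← pow_mul] at h7
  rw [div_mul_eq_mul_div, div_le_iff₀ (by positivity), ← mul_pow]
  refine (pow_le_pow_left₀ (by positivity) hm2 d).trans (h7.trans (le_of_eq (by ring)))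

theorem count_lower {d : ℕ} (X : MM d) (l : ℕ) : ∃ c : ℝ, 0 < c ∧ ∃ T0 : ℝ, 1 ≤ T0 ∧ ∀ T, T0 ≤ T →
    c * T ^ (d * l) ≤ cX (k := l) 1 0 X (fun _ => -1) (fun _ => 1) T * T ^ (l * (l - 1)) := by
  induction l with
  | zero =>
    refine ⟨1, one_pos, 1, le_rfl, fun T hT => ?_⟩
    have : 0 < cX (k := 0) 1 0 X (fun _ => -1) (fun _ => 1) T := by
      rw [cX]
      have := (sX_finite (k := 0) 1 0 X (fun _ => -1) (fun _ => 1) T).to_subtype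
      have : Nonempty (sX (k := 0) 1 0 X (fun _ => -1) (fun _ => 1) T) :=
        ⟨⟨fun i => i.elim0, fun i => i.elim0, fun p => p.1.1.elim0, fun i => i.elim0⟩⟩
      exact Nat.card_pos
    have : (1 : ℝ) ≤ cX (k := 0) 1 0 X (fun _ => -1) (fun _ => 1) T := by exact_mod_cast this
    simpa using this
  | succ l ih =>
    obtain ⟨c, hc, T0, hT0, h⟩ := ih
    obtain ⟨c', hc', T1, hT1, h'⟩ := pigeon l X
    refine ⟨c * c', by positivity, max T0 T1, le_max_of_le_left hT0, fun T hT => ?_⟩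
    have h1 := h T ((le_max_left _ _).trans hT)
    have h2 := h' T ((le_max_right _ _).trans hT)
    have hT1 : 1 ≤ T := hT0.trans ((le_max_left _ _).trans hT)
    set S := sX (k := l) 1 0 X (fun _ => -1) (fun _ => 1) T with hS
    have hSf : S.Finite := sX_finite 1 0 X _ _ T
    have := hSf.fintype
    have hf2 : ∀ V : S, Finite (SS X (fun i => ev (V.1 i)) T) := fun V => (SS_finite X _ T).to_subtype
    have hfs := (sX_finite (k := l + 1) 1 0 X (fun _ => -1) (fun _ => 1) T).to_subtype
    have hcard : Nat.card ((V : S) × SS X (fun i => ev (V.1 i)) T) ≤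
        cX (k := l + 1) 1 0 X (fun _ => -1) (fun _ => 1) T := by
      refine Nat.card_le_card_of_injective
        (fun z => ⟨Fin.snoc (α := fun _ => Fin d → ℤ) z.1.1 z.2.1, ?_⟩) ?_
      · obtain ⟨⟨V, hV⟩, ⟨v, hv⟩⟩ := z
        refine ⟨fun _ _ => by simp, ?_, ?_⟩
        · rintro ⟨⟨p, q⟩, hpq⟩
          dsimp only at hpq ⊢
          induction q using Fin.lastCases with
          | last =>
            induction p using Fin.lastCases with
            | last => exact absurd hpq (lt_irrefl _)
            | cast p =>
              rw [Fin.snoc_castSucc, Fin.snoc_last]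
              exact hv.2 p
          | cast q =>
            induction p using Fin.lastCases with
            | last => exact absurd (hpq.trans (Fin.castSucc_lt_last q)) (lt_irrefl _)
            | cast p =>
              rw [Fin.snoc_castSucc, Fin.snoc_castSucc]
              exact hV.2.1 ⟨(p, q), by simpa using hpq⟩
        · intro i
          induction i using Fin.lastCases with
          | last => rw [Fin.snoc_last]; exact hv.1
          | cast i => rw [Fin.snoc_castSucc]; exact hV.2.2 i
      · rintro ⟨⟨V, hV⟩, ⟨v, hv⟩⟩ ⟨⟨V', hV'⟩, ⟨v', hv'⟩⟩ he
        have he' := Subtype.ext_iff.mp he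
        dsimp only at he'
        obtain ⟨e1, e2⟩ := Fin.snoc_inj.mp he'
        subst e1; subst e2; rfl
    rw [Nat.card_sigma] at hcard
    have hsum : (Nat.card S : ℝ) * (c' * T ^ d) ≤
        (∑ V : S, Nat.card (SS X (fun i => ev (V.1 i)) T) : ℕ) * T ^ (2 * l) := by
      push_cast
      rw [Finset.sum_mul, Nat.card_eq_fintype_card, ← nsmul_eq_mul, ← Finset.card_univ, ← Finset.sum_const]
      exact Finset.sum_le_sum fun V _ => h2 _ V.2.2.2
    have hcard' : ((∑ V : S, Nat.card (SS X (fun i => ev (V.1 i)) T) : ℕ) : ℝ) ≤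
        cX (k := l + 1) 1 0 X (fun _ => -1) (fun _ => 1) T := by exact_mod_cast hcard
    have hTp : ∀ i : ℕ, (0 : ℝ) < T ^ i := fun i => pow_pos (by linarith) i
    have hex : (l + 1) * (l + 1 - 1) = l * (l - 1) + 2 * l := by
      cases l with
      | zero => rfl
      | succ l => simp only [Nat.add_sub_cancel]; ring
    rw [hex, pow_add, mul_add, mul_one, pow_add]
    calc c * c' * (T ^ (d * l) * T ^ d) = (c * T ^ (d * l)) * (c' * T ^ d) := by ring
      _ ≤ (Nat.card S * T ^ (l * (l - 1))) * (c' * T ^ d) :=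
          mul_le_mul_of_nonneg_right h1 (mul_nonneg hc'.le (hTp d).le)
      _ = (Nat.card S * (c' * T ^ d)) * T ^ (l * (l - 1)) := by ring
      _ ≤ ((∑ V : S, Nat.card (SS X (fun i => ev (V.1 i)) T) : ℕ) * T ^ (2 * l)) * T ^ (l * (l - 1)) :=
          mul_le_mul_of_nonneg_right hsum (hTp _).le
      _ ≤ (cX (k := l + 1) 1 0 X (fun _ => -1) (fun _ => 1) T * T ^ (2 * l)) * T ^ (l * (l - 1)) :=
          mul_le_mul_of_nonneg_right (mul_le_mul_of_nonneg_right hcard' (hTp _).le) (hTp _).le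
      _ = _ := by ring

theorem Asy_pos {d k E : ℕ} (hE : d * k = E + k * (k - 1)) (X : MM d) (c : ℝ) (h : Asy k 1 0 E X c) : 0 < c := by
  obtain ⟨C, hC, T0, hT0, h1⟩ := h (fun _ => -1) (fun _ => 1) (fun _ => by norm_num)
  obtain ⟨c0, hc0, T1, hT1, h2⟩ := count_lower X k
  by_contra hcn
  push Not at hcn
  have hM : (0 : ℝ) < 1 / ME k := by
    have : 0 < ME k := Nat.mul_pos (by omega) (by unfold mE; omega)
    positivity
  have h3 : ∀ T, max T0 T1 < T → c0 ≤ C * T ^ (-(1 / ME k : ℝ)) := by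
    intro T hT
    have hTT0 := (le_max_left _ _).trans_lt hT
    have hTT1 := (le_max_right _ _).trans_lt hT
    have e1 := (abs_le.mp (h1 T hTT0)).2
    have e2 := h2 T hTT1.le
    have hTp : 0 < T := by linarith
    rw [hE, pow_add, ← mul_assoc] at e2
    have e3 := le_of_mul_le_mul_right e2 (pow_pos hTp _)
    have e4 : c * (∏ p : Pairs k, ((1 : ℝ) - (-1))) * T ^ E ≤ 0 := by
      refine mul_nonpos_of_nonpos_of_nonneg (mul_nonpos_of_nonpos_of_nonneg hcn ?_) (pow_pos hTp E).le
      exact Finset.prod_nonneg fun _ _ => by norm_num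
    have e5 : c0 * T ^ E ≤ C * T ^ ((E : ℝ) - 1 / ME k) := by
      rw [Nat.cast_one, one_pow, one_mul] at e1
      exact e3.trans (((le_sub_self_iff _).mpr e4).trans e1)
    rw [sub_eq_add_neg, Real.rpow_add hTp, Real.rpow_natCast] at e5
    refine le_of_mul_le_mul_right ?_ (pow_pos hTp E)
    linarith
  have h4 : Filter.Tendsto (fun T : ℝ => C * T ^ (-(1 / ME k : ℝ))) Filter.atTop (nhds (C * 0)) :=
    (tendsto_rpow_neg_atTop hM).const_mul C
  have h5 := ge_of_tendsto h4 ((Filter.eventually_gt_atTop (max T0 T1)).mono h3)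
  linarith

def mx {d : ℕ} (Y : MM d) : Matrix (Fin d) (Fin d) ℝ := fun i j => Y (i, j)
def toX {d : ℕ} (B : Matrix (Fin d) (Fin d) ℝ) : MM d := WithLp.toLp 2 fun p => B p.1 p.2
def Cm {d : ℕ} (Y : MM d) : Matrix (Fin d) (Fin d) ℝ := mx Y - (mx Y)ᵀ
def Fm (n : ℕ) (Y : MM (2 * n)) : Matrix (Fin (2 * n)) (Fin (2 * n)) ℝ :=
  (1 / 2 : ℝ) • Jmat n + mx Y - (1 / 8 : ℝ) • (Cm Y * Jmat n * Cm Y)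
def Sm (n : ℕ) (Y : MM (2 * n)) : Matrix (Fin (2 * n)) (Fin (2 * n)) ℝ :=
  1 - (1 / 2 : ℝ) • (Jmat n * Cm Y)

theorem Jmat_tr (n : ℕ) : (Jmat n)ᵀ = - Jmat n := by
  ext i j
  simp only [Jmat, Matrix.transpose_apply, Matrix.neg_apply]
  have := i.2
  have := j.2
  split_ifs <;> first | omega | norm_num

theorem Jmat_sq (n : ℕ) : Jmat n * Jmat n = -1 := by
  ext i j
  rw [Matrix.mul_apply, Matrix.neg_apply, Matrix.one_apply]
  have hi := i.2
  have hj := j.2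
  by_cases h : (i : ℕ) < n
  · rw [Finset.sum_eq_single (⟨i + n, by omega⟩ : Fin (2 * n))]
    · simp only [Jmat, Fin.ext_iff]
      split_ifs <;> first | omega | norm_num
    · intro b _ hb
      rw [Ne, Fin.ext_iff] at hb
      simp only [Jmat]
      simp only at hb
      split_ifs <;> first | omega | norm_num
    · simp
  · rw [Finset.sum_eq_single (⟨i - n, by omega⟩ : Fin (2 * n))]
    · simp only [Jmat, Fin.ext_iff]
      split_ifs <;> first | omega | norm_num
    · intro b _ hb
      rw [Ne, Fin.ext_iff] at hb
      simp only [Jmat]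
      simp only at hb
      split_ifs <;> first | omega | norm_num
    · simp

theorem Cm_tr {d : ℕ} (Y : MM d) : (Cm Y)ᵀ = - Cm Y := by
  rw [Cm, Matrix.transpose_sub, Matrix.transpose_transpose]; abel

theorem SJS (n : ℕ) (Y : MM (2 * n)) : (Sm n Y)ᵀ * Jmat n * Sm n Y = Fm n Y - (Fm n Y)ᵀ := by
  have hC := Cm_tr Y
  have hmx : mx Y - (mx Y)ᵀ = Cm Y := rfl
  have e1 : Fm n Y - (Fm n Y)ᵀ = Jmat n + Cm Y - (1 / 4 : ℝ) • (Cm Y * Jmat n * Cm Y) := by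
    rw [Fm, Matrix.transpose_sub, Matrix.transpose_add, Matrix.transpose_smul, Matrix.transpose_smul,
      Matrix.transpose_mul, Matrix.transpose_mul, hC, Jmat_tr]
    have : -Cm Y * (-Jmat n * -Cm Y) = -(Cm Y * Jmat n * Cm Y) := by noncomm_ring
    rw [this]
    generalize Cm Y * Jmat n * Cm Y = Q
    rw [← hmx]
    module
  have e2 : (Sm n Y)ᵀ = 1 - (1 / 2 : ℝ) • (Cm Y * Jmat n) := by
    rw [Sm, Matrix.transpose_sub, Matrix.transpose_smul, Matrix.transpose_mul, hC, Jmat_tr,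
      Matrix.transpose_one, neg_mul_neg]
  rw [e1, e2, Sm]
  have hJ := Jmat_sq n
  generalize Jmat n = J at *
  generalize Cm Y = C at *
  have h1 : J * (J * C) = -C := by rw [← mul_assoc, hJ, neg_one_mul]
  have h2 : C * J * J = -C := by rw [mul_assoc, hJ, mul_neg_one]
  have h3 : C * J * J * (J * C) = -(C * J * C) := by rw [h2, neg_mul, ← mul_assoc]
  simp only [sub_mul, mul_sub, one_mul, mul_one, smul_mul_assoc, mul_smul_comm, h1, h2, neg_mul, mul_neg, ← mul_assoc C J C]
  module

theorem AX_toX {d : ℕ} (B : Matrix (Fin d) (Fin d) ℝ) (u w : Fin d → ℝ) :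
    AX (toX B) (WithLp.toLp 2 u) (WithLp.toLp 2 w) = u ⬝ᵥ ((B - Bᵀ) *ᵥ w) := by
  rw [AX, PiLp.inner_apply]
  simp only [toX, tens, PiLp.sub_apply, RCLike.inner_apply, conj_trivial, dotProduct, Matrix.mulVec,
    Fintype.sum_prod_type, Finset.mul_sum, Matrix.sub_apply, Matrix.transpose_apply]
  have : ∀ i j, (u i * w j - w i * u j) * B i j = u i * (B i j * w j) - u j * (B i j * w i) := by
    intro i j; ring
  simp only [this, sub_mul, mul_sub, Finset.sum_sub_distrib]
  congr 1
  rw [Finset.sum_comm]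

theorem sympG_eq (n : ℕ) (g : SL2n n) (v w : Fin (2 * n) → ℝ) :
    sympG n g v w = v ⬝ᵥ ((g.1ᵀ * Jmat n * g.1) *ᵥ w) := by
  rw [sympG, symp, ← Matrix.mulVec_mulVec, ← Matrix.mulVec_mulVec, Matrix.dotProduct_mulVec v,
    Matrix.vecMul_transpose]

theorem transfer_pt (n : ℕ) (hn : 0 < n) (Y : MM (2 * n)) (hY : 0 < (Sm n Y).det) :
    ∃ h : SL2n n, ∃ lam : ℝ, 0 < lam ∧ ∀ (g : SL2n n) (v w : Fin (2 * n) → ℝ),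
      sympG n (h * g) v w = lam * AX (toX (g.1ᵀ * Fm n Y * g.1)) (WithLp.toLp 2 v) (WithLp.toLp 2 w) := by
  set r : ℝ := (Sm n Y).det ^ (-(1 / ((2 * n : ℕ) : ℝ))) with hr
  have hr0 : 0 < r := Real.rpow_pos_of_pos hY _
  have hdet : (r • Sm n Y).det = 1 := by
    have h2 : ((2 * n : ℕ) : ℝ) ≠ 0 := by positivity
    rw [Matrix.det_smul, Fintype.card_fin, hr, ← Real.rpow_natCast, ← Real.rpow_mul hY.le, neg_mul,
      one_div_mul_cancel h2, Real.rpow_neg_one, inv_mul_cancel₀ hY.ne']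
  let h : SL2n n := ⟨r • Sm n Y, hdet⟩
  refine ⟨h, r ^ 2, by positivity, fun g v w => ?_⟩
  have e' : ∀ M : Matrix (Fin (2 * n)) (Fin (2 * n)) ℝ, r ^ 2 * (v ⬝ᵥ M *ᵥ w) = v ⬝ᵥ ((r ^ 2 • M) *ᵥ w) := by
    intro M
    rw [Matrix.smul_mulVec, dotProduct_smul, smul_eq_mul]
  rw [sympG_eq, AX_toX, e']
  congr 2
  have hc : (h * g).1 = (r • Sm n Y) * g.1 := rfl
  rw [hc]
  have e : (g.1ᵀ * Fm n Y * g.1) - (g.1ᵀ * Fm n Y * g.1)ᵀ = g.1ᵀ * (Fm n Y - (Fm n Y)ᵀ) * g.1 := by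
    simp only [Matrix.transpose_mul, Matrix.transpose_transpose, Matrix.mul_sub, Matrix.sub_mul, Matrix.mul_assoc]
  rw [e, ← SJS, Matrix.transpose_mul, Matrix.transpose_smul]
  simp only [Matrix.mul_assoc, smul_mul_assoc, mul_smul_comm, smul_smul, sq, Matrix.smul_mul, Matrix.mul_smul]

def Qm (n : ℕ) (Y : MM (2 * n)) : MM (2 * n) := toX (Cm Y * Jmat n * Cm Y)

theorem Cm_neg {d : ℕ} (Y : MM d) : Cm (-Y) = - Cm Y := by
  ext i j
  simp [Cm, mx]
  ring

theorem Qm_contDiff (n : ℕ) : ContDiff ℝ 1 (Qm n) := by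
  rw [contDiff_euclidean]
  intro p
  simp only [Qm, toX, Cm, mx, Matrix.mul_apply, Matrix.sub_apply, Matrix.transpose_apply]
  fun_prop

theorem Qm_strict (n : ℕ) : HasStrictFDerivAt (Qm n) (0 : MM (2 * n) →L[ℝ] MM (2 * n)) 0 := by
  have h1 := (Qm_contDiff n).contDiffAt.hasStrictFDerivAt (x := 0) one_ne_zero
  have h2 : Qm n = fun Y => Qm n (-Y) := by
    funext Y
    rw [Qm, Qm, Cm_neg, neg_mul, neg_mul_neg]
  have h3 : HasFDerivAt (fun Y => Qm n (-Y)) ((fderiv ℝ (Qm n) 0).comp (-ContinuousLinearMap.id ℝ (MM (2 * n)))) 0 := by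
    have h4 : HasFDerivAt (Qm n) (fderiv ℝ (Qm n) 0) (-(0 : MM (2 * n))) := by
      rw [neg_zero]; exact h1.hasFDerivAt
    exact h4.comp (0 : MM (2 * n)) ((hasFDerivAt_id (0 : MM (2 * n))).neg)
  rw [← h2] at h3
  have h5 := h1.hasFDerivAt.unique h3
  have h6 : fderiv ℝ (Qm n) 0 = 0 := by
    ext1 Y
    have := DFunLike.congr_fun h5 Y
    simp only [ContinuousLinearMap.comp_apply, _root_.neg_apply, ContinuousLinearMap.id_apply, map_neg] at this
    have h7 : (2 : ℝ) • (fderiv ℝ (Qm n) 0) Y = 0 := by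
      rw [two_smul]
      nth_rewrite 1 [this]
      exact neg_add_cancel _
    exact (smul_eq_zero.mp h7).resolve_left two_ne_zero
  rw [h6] at h1
  exact h1

theorem Fm_eq (n : ℕ) (Y : MM (2 * n)) :
    toX (Fm n Y) = toX ((1 / 2 : ℝ) • Jmat n) + Y - (1 / 8 : ℝ) • Qm n Y := by
  ext p
  simp [toX, Fm, Qm, mx]

theorem Fm_strict (n : ℕ) : HasStrictFDerivAt (fun Y => toX (Fm n Y))
    (ContinuousLinearMap.id ℝ (MM (2 * n))) 0 := by
  have h := ((hasStrictFDerivAt_id (𝕜 := ℝ) (0 : MM (2 * n))).const_add (toX ((1 / 2 : ℝ) • Jmat n))).sub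
    ((Qm_strict n).const_smul (1 / 8 : ℝ))
  rw [smul_zero, sub_zero] at h
  have e : (fun Y => toX (Fm n Y)) = fun Y => toX ((1 / 2 : ℝ) • Jmat n) + Y - (1 / 8 : ℝ) • Qm n Y :=
    funext (Fm_eq n)
  rw [e]
  exact h

theorem Fm_null (n : ℕ) : ∃ s ∈ nhds (0 : MM (2 * n)), ∀ S : Set (MM (2 * n)), volume S = 0 →
    volume {Y | Y ∈ s ∧ toX (Fm n Y) ∈ S} = 0 := by
  have h : HasStrictFDerivAt (fun Y => toX (Fm n Y))
    ((ContinuousLinearEquiv.refl ℝ (MM (2 * n)) : MM (2 * n) ≃L[ℝ] MM (2 * n)) : MM (2 * n) →L[ℝ] MM (2 * n)) 0 :=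
    Fm_strict n
  obtain ⟨s, hs0, hso, ha⟩ := h.approximates_deriv_on_open_nhds
  refine ⟨s, hso.mem_nhds hs0, fun S hS => ?_⟩
  have hal := ha.antilipschitz (by
    by_cases hsub : Subsingleton (MM (2 * n))
    · left; exact hsub
    · right
      refine NNReal.half_lt_self ?_
      rcases ContinuousLinearEquiv.subsingleton_or_nnnorm_symm_pos (ContinuousLinearEquiv.refl ℝ (MM (2 * n)) : MM (2 * n) ≃L[ℝ] MM (2 * n)) with h | h
      · exact absurd h hsub
      · exact (inv_pos.2 h).ne')
  obtain ⟨sc, h2⟩ : ∃ sc : NNReal, (Measure.hausdorffMeasure (Module.finrank ℝ (MM (2 * n))) : Measure (MM (2 * n))) = sc • 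
      (volume : Measure (MM (2 * n))) :=
    ⟨_, Measure.isAddLeftInvariant_eq_smul _ _⟩
  obtain ⟨sc', h2'⟩ : ∃ sc : NNReal, (volume : Measure (MM (2 * n))) = sc • 
     (Measure.hausdorffMeasure (Module.finrank ℝ (MM (2 * n))) : Measure (MM (2 * n)))  :=
    ⟨_, Measure.isAddLeftInvariant_eq_smul _ _⟩
  have h1 := hal.hausdorffMeasure_preimage_le (d := (Module.finrank ℝ (MM (2 * n)) : ℝ)) (Nat.cast_nonneg _) S
  have h3 : (Measure.hausdorffMeasure (Module.finrank ℝ (MM (2 * n))) : Measure (MM (2 * n))) S = 0 := by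
    rw [h2, Measure.smul_apply, hS, smul_zero]
  rw [h3, mul_zero, nonpos_iff_eq_zero] at h1
  have h4 := (isometry_subtype_coe (s := s)).hausdorffMeasure_image (d := (Module.finrank ℝ (MM (2 * n)) : ℝ)) (Or.inl (Nat.cast_nonneg _)) ((s.domRestrict fun Y => toX (Fm n Y)) ⁻¹' S)
  rw [h1] at h4
  rw [h2', Measure.smul_apply]
  have h5 : {Y | Y ∈ s ∧ toX (Fm n Y) ∈ S} = Subtype.val '' ((s.domRestrict fun Y => toX (Fm n Y)) ⁻¹' S) := by
    ext Y
    constructor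
    · rintro ⟨h, h'⟩
      exact ⟨⟨Y, h⟩, h', rfl⟩
    · rintro ⟨⟨Z, hZ⟩, h, rfl⟩
      exact ⟨hZ, h⟩
  rw [h5, h4, smul_zero]

theorem conj_null {d : ℕ} (g : Matrix.SpecialLinearGroup (Fin d) ℝ) (S : Set (MM d)) (hS : volume S = 0) :
    volume {X : MM d | toX (g.1ᵀ * mx X * g.1) ∈ S} = 0 := by
  have hd : DifferentiableOn ℝ (fun X : MM d => toX ((g⁻¹).1ᵀ * mx X * (g⁻¹).1)) S := by
    apply Differentiable.differentiableOn
    rw [differentiable_euclidean]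
    intro p
    simp only [toX, mx, Matrix.mul_apply]
    fun_prop
  refine measure_mono_null ?_ (addHaar_image_eq_zero_of_differentiableOn_of_addHaar_eq_zero volume hd hS)
  intro X hX
  refine ⟨_, hX, ?_⟩
  have h1 : g.1 * (g⁻¹).1 = 1 := by
    have := congrArg Subtype.val (mul_inv_cancel g)
    exact this
  have h2 : (g⁻¹).1ᵀ * g.1ᵀ = 1 := by rw [← Matrix.transpose_mul, h1, Matrix.transpose_one]
  show toX ((g⁻¹).1ᵀ * (g.1ᵀ * mx X * g.1) * (g⁻¹).1) = X
  have h3 : (g⁻¹).1ᵀ * (g.1ᵀ * mx X * g.1) * (g⁻¹).1 = mx X := by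
    calc _ = ((g⁻¹).1ᵀ * g.1ᵀ) * mx X * (g.1 * (g⁻¹).1) := by simp only [Matrix.mul_assoc]
      _ = _ := by rw [h1, h2, one_mul, mul_one]
  rw [h3]
  rfl

theorem SL_sigma (n : ℕ) : SigmaCompactSpace (SL2n n) := by
  have hc : IsClosed {A : Matrix (Fin (2 * n)) (Fin (2 * n)) ℝ | A.det = 1} :=
    isClosed_eq (Continuous.matrix_det continuous_id) continuous_const
  have hs : SigmaCompactSpace (Matrix (Fin (2 * n)) (Fin (2 * n)) ℝ) :=
    inferInstanceAs (SigmaCompactSpace (Fin (2 * n) → Fin (2 * n) → ℝ))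
  exact hc.isClosedEmbedding_subtypeVal.sigmaCompactSpace

theorem SL_meas_mul (n : ℕ) (h : SL2n n) : Measurable fun g : SL2n n => h * g := by
  apply Measurable.subtype_mk
  have : ∀ i j : Fin (2 * n), Measurable fun g : SL2n n => g.1 i j := fun i j =>
    (measurable_pi_apply j).comp ((measurable_pi_apply i).comp measurable_subtype_coe)
  refine measurable_pi_iff.mpr fun i => measurable_pi_iff.mpr fun j => ?_
  show Measurable fun g : SL2n n => (h.1 * g.1) i j
  simp only [Matrix.mul_apply]
  exact Finset.measurable_sum _ fun k _ => (this k j).const_mul _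

theorem FG_meas (n : ℕ) : Measurable fun p : MM (2 * n) × SL2n n =>
    toX (p.2.1ᵀ * Fm n p.1 * p.2.1) := by
  have hg : ∀ i j : Fin (2 * n), Measurable fun p : MM (2 * n) × SL2n n => p.2.1 i j := fun i j =>
    (measurable_pi_apply j).comp ((measurable_pi_apply i).comp (measurable_subtype_coe.comp measurable_snd))
  have hF : ∀ i j : Fin (2 * n), Measurable fun p : MM (2 * n) × SL2n n => Fm n p.1 i j := by
    intro i j
    have hc : Continuous fun Y : MM (2 * n) => Fm n Y i j := by
      simp only [Fm, Cm, mx, Matrix.mul_apply, Matrix.sub_apply, Matrix.add_apply, Matrix.smul_apply, Matrix.transpose_apply]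
      fun_prop
    exact hc.measurable.comp measurable_fst
  refine (MeasurableEquiv.toLp 2 _).measurable.comp (measurable_pi_iff.mpr fun q => ?_)
  simp only [Matrix.mul_apply, Matrix.transpose_apply]
  exact Finset.measurable_sum _ fun k _ => (Finset.measurable_sum _ fun l _ => (hg _ _).mul (hF _ _)).mul (hg _ _)

theorem transfer_ae (n : ℕ) (hn : 0 < n) (P : MM (2 * n) → Prop) (hP : ∀ᵐ X, P X)
    (μ : Measure (SL2n n)) (hμ : μ.IsHaarMeasure) :
    ∃ lam : ℝ, 0 < lam ∧ ∀ᵐ g ∂μ, ∃ X, P X ∧ ∀ v w : Fin (2 * n) → ℝ,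
      sympG n g v w = lam * AX X (WithLp.toLp 2 v) (WithLp.toLp 2 w) := by
  have hsc := SL_sigma n
  have hsf : SigmaFinite μ := inferInstance
  set S := toMeasurable volume {X | ¬ P X} with hS
  have hS0 : volume S = 0 := by rw [hS, measure_toMeasurable]; exact hP
  have hSm : MeasurableSet S := measurableSet_toMeasurable _ _
  obtain ⟨s, hs, hnull⟩ := Fm_null n
  have hdet : ∀ᶠ Y in nhds (0 : MM (2 * n)), 0 < (Sm n Y).det := by
    have hc : Continuous fun Y : MM (2 * n) => (Sm n Y).det := by
      apply Continuous.matrix_det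
      refine continuous_matrix fun i j => ?_
      simp only [Sm, Cm, mx, Matrix.mul_apply, Matrix.sub_apply, Matrix.smul_apply, Matrix.transpose_apply]
      fun_prop
    have h0 : (Sm n 0).det = 1 := by
      have : Cm (0 : MM (2 * n)) = 0 := by
        ext i j; simp [Cm, mx]
      rw [Sm, this, mul_zero, smul_zero, sub_zero, Matrix.det_one]
    exact hc.continuousAt.eventually (lt_mem_nhds (h0.symm ▸ one_pos : (0 : ℝ) < (Sm n 0).det))
  obtain ⟨U, hU, hUo, hU0⟩ := mem_nhds_iff.mp (Filter.inter_mem hs hdet)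
  set Z : Set (MM (2 * n) × SL2n n) := {p | p.1 ∈ U ∧ toX (p.2.1ᵀ * Fm n p.1 * p.2.1) ∈ S} with hZ
  have hZm : MeasurableSet Z := (measurable_fst hUo.measurableSet).inter (FG_meas n hSm)
  have hZ0 : (volume.prod μ) Z = 0 := by
    rw [Measure.prod_apply_symm hZm]
    apply lintegral_eq_zero_of_ae_eq_zero
    refine Filter.Eventually.of_forall fun g => ?_
    refine measure_mono_null ?_ (hnull _ (conj_null g S hS0))
    intro Y hY
    exact ⟨(hU hY.1).1, hY.2⟩
  have hae := Measure.measure_ae_null_of_prod_null hZ0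
  have hUp : 0 < volume U := hUo.measure_pos _ ⟨0, hU0⟩
  obtain ⟨Y, hYU, hY⟩ : ∃ Y ∈ U, μ (Prod.mk Y ⁻¹' Z) = 0 := by
    by_contra hcon
    push Not at hcon
    have : volume U ≤ 0 := by
      rw [← show volume {Y : MM (2 * n) | ¬ μ (Prod.mk Y ⁻¹' Z) = 0} = 0 from hae]
      exact measure_mono fun Y hY => hcon Y hY
    exact absurd hUp (not_lt.mpr this)
  obtain ⟨h, lam, hlam, htr⟩ := transfer_pt n hn Y (hU hYU).2
  refine ⟨lam, hlam, ?_⟩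
  have h1 : ∀ᵐ g ∂μ, toX (g.1ᵀ * Fm n Y * g.1) ∉ S := by
    rw [ae_iff]
    refine measure_mono_null ?_ hY
    intro g hg
    exact ⟨hYU, not_not.mp hg⟩
  have h2 : μ.map (fun g => h⁻¹ * g) = μ := map_mul_left_eq_self μ h⁻¹
  rw [← h2] at h1
  have h3 := ae_of_ae_map (SL_meas_mul n h⁻¹).aemeasurable h1
  filter_upwards [h3] with g hg
  refine ⟨toX ((h⁻¹ * g).1ᵀ * Fm n Y * (h⁻¹ * g).1), ?_, fun v w => ?_⟩
  rotate_left
  · have := htr (h⁻¹ * g) v w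
    rw [mul_inv_cancel_left] at this
    exact this
  · by_contra hcon
    exact hg (subset_toMeasurable _ _ hcon)

theorem enorm2_ev {d : ℕ} (v : Fin d → ℤ) : enorm2 (fun j => ((v j : ℤ) : ℝ)) = ‖ev v‖ := by
  rw [enorm2, EuclideanSpace.norm_eq]
  congr 1
  refine Finset.sum_congr rfl fun i _ => ?_
  rw [Real.norm_eq_abs, sq_abs]
  rfl

theorem NC_eq (n k N : ℕ) (v₀ : Fin (2 * n) → ℤ) (g : SL2n n) (X : MM (2 * n)) (lam : ℝ) (hl : 0 < lam)
    (h : ∀ v w : Fin (2 * n) → ℝ, sympG n g v w = lam * AX X (WithLp.toLp 2 v) (WithLp.toLp 2 w))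
    (a b : Pairs k → ℝ) (T : ℝ) :
    NcountCong n k N v₀ g a b T = cX N v₀ X (fun p => a p / lam) (fun p => b p / lam) T := by
  rw [NcountCong, cX]
  congr 2
  ext v
  simp only [sX, Set.mem_ofPred_eq, h, enorm2_ev, Set.mem_Ioo]
  have e : ∀ p : Pairs k, (a p < lam * AX X (ev (v p.1.1)) (ev (v p.1.2)) ∧
      lam * AX X (ev (v p.1.1)) (ev (v p.1.2)) < b p) ↔ (a p / lam < AX X (ev (v p.1.1)) (ev (v p.1.2)) ∧
      AX X (ev (v p.1.1)) (ev (v p.1.2)) < b p / lam) := by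
    intro p
    rw [div_lt_iff₀ hl, lt_div_iff₀ hl, mul_comm lam]
  exact and_congr Iff.rfl (and_congr (forall_congr' e) Iff.rfl)

theorem N_eq (n k : ℕ) (g : SL2n n) (a b : Pairs k → ℝ) (T : ℝ) :
    Ncount n k g a b T = NcountCong n k 1 0 g a b T := by
  rw [NcountCong, Ncount]
  simp

theorem two_card (k : ℕ) : 2 * Fintype.card (Pairs k) = k * (k - 1) := by
  have h1 : Fintype.card (Pairs k) = (Finset.univ.filter fun p : Fin k × Fin k => p.1 < p.2).card :=
    Fintype.card_subtype _
  have h2 : (Finset.univ.filter fun p : Fin k × Fin k => p.2 < p.1).card =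
      (Finset.univ.filter fun p : Fin k × Fin k => p.1 < p.2).card := by
    refine Finset.card_bij (fun p _ => p.swap) ?_ ?_ ?_
    · intro p hp; simpa using hp
    · intro p _ q _ h; exact Prod.swap_injective h
    · intro p hp; exact ⟨p.swap, by simpa using hp, Prod.swap_swap p⟩
  have h3 := Finset.offDiag_card (Finset.univ : Finset (Fin k))
  have h4 : (Finset.univ : Finset (Fin k)).offDiag = (Finset.univ.filter fun p : Fin k × Fin k => p.1 < p.2) ∪
      (Finset.univ.filter fun p : Fin k × Fin k => p.2 < p.1) := by
    ext p
    simp [Finset.mem_offDiag, lt_or_lt_iff_ne]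
  rw [h4, Finset.card_union_of_disjoint, h2, ← h1, Finset.card_fin] at h3
  · rw [Nat.mul_sub, mul_one, ← h3]; ring
  · rw [Finset.disjoint_left]
    intro p hp hq
    simp only [Finset.mem_filter, Finset.mem_univ, true_and] at hp hq
    exact absurd hp (not_lt.mpr hq.le)

def Pg (n k N : ℕ) (v₀ : Fin (2 * n) → ℤ) (E : ℕ) (g : SL2n n) (c : ℝ) : Prop :=
  ∀ a b : Pairs k → ℝ, (∀ p, a p < b p) → ∃ C > 0, ∃ T0 > 0, ∀ T > T0,
    |(N : ℝ) ^ (2 * n * k) * NcountCong n k N v₀ g a b T - c * (∏ p, (b p - a p)) * T ^ E| ≤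
      C * T ^ ((E : ℝ) - 1 / ME k)

theorem Pg_of (n k N : ℕ) (v₀ : Fin (2 * n) → ℤ) (E : ℕ) (g : SL2n n) (X : MM (2 * n)) (lam : ℝ) (hl : 0 < lam)
    (h : ∀ v w : Fin (2 * n) → ℝ, sympG n g v w = lam * AX X (WithLp.toLp 2 v) (WithLp.toLp 2 w))
    (c : ℝ) (hA : Asy k N v₀ E X c) : Pg n k N v₀ E g (c / lam ^ Fintype.card (Pairs k)) := by
  intro a b hab
  obtain ⟨C, hC, T0, hT0, h1⟩ := hA (fun p => a p / lam) (fun p => b p / lam)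
    (fun p => div_lt_div_of_pos_right (hab p) hl)
  refine ⟨C, hC, T0, hT0, fun T hT => ?_⟩
  have h2 := h1 T hT
  rw [NC_eq n k N v₀ g X lam hl h a b T]
  have e : ∏ p, (b p / lam - a p / lam) = (∏ p : Pairs k, (b p - a p)) / lam ^ Fintype.card (Pairs k) := by
    simp only [← sub_div]
    rw [Finset.prod_div_distrib, Finset.prod_const, Finset.card_univ]
  rw [e] at h2
  have e2 : c / lam ^ Fintype.card (Pairs k) * (∏ p : Pairs k, (b p - a p)) =
    c * ((∏ p : Pairs k, (b p - a p)) / lam ^ Fintype.card (Pairs k)) := by ring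
  rw [e2]
  exact h2

theorem ME_pos (k : ℕ) : 0 < ME k := Nat.mul_pos (by omega) (by unfold mE; omega)

theorem fin_bd (n k N : ℕ) (hN : 0 < N) (v₀ : Fin (2 * n) → ℤ) (E : ℕ) (g : SL2n n) (c : ℝ)
    (h : Pg n k N v₀ E g c) (hE : 0 < E) (hexp : expo n k = E) (δ : ℝ) (hδ : 1 - 1 / ((ME k : ℝ) * E) < δ)
    (a b : Pairs k → ℝ) (hab : ∀ p, a p < b p) :
    ∃ C > (0:ℝ), ∃ T0 > (0:ℝ), ∀ T > T0,
      |(NcountCong n k N v₀ g a b T : ℝ)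
        - (c / (N : ℝ) ^ (2*n*k)) * (∏ p : Pairs k, (b p - a p)) * T ^ expo n k|
        ≤ C * T ^ (δ * expo n k) := by
  obtain ⟨C, hC, T0, hT0, h1⟩ := h a b hab
  refine ⟨C, hC, max T0 1, lt_max_of_lt_left hT0, fun T hT => ?_⟩
  have hT1 : 1 < T := (le_max_right _ _).trans_lt hT
  have h2 := h1 T ((le_max_left _ _).trans_lt hT)
  have hM : (0 : ℝ) < ME k := Nat.cast_pos.mpr (ME_pos k)
  have hE0 : (0 : ℝ) < E := Nat.cast_pos.mpr hE
  have hN1 : (1 : ℝ) ≤ (N : ℝ) ^ (2 * n * k) := one_le_pow₀ (by exact_mod_cast hN)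
  have hle : T ^ ((E : ℝ) - 1 / ME k) ≤ T ^ (δ * E) := by
    apply Real.rpow_le_rpow_of_exponent_le hT1.le
    have := mul_le_mul_of_nonneg_right hδ.le hE0.le
    have e : (1 - 1 / ((ME k : ℝ) * E)) * E = E - 1 / ME k := by field_simp
    rw [e] at this
    exact this
  rw [hexp, Real.rpow_natCast]
  set D := (N : ℝ) ^ (2 * n * k) with hD
  have hD0 : 0 < D := lt_of_lt_of_le one_pos hN1
  have e : (NcountCong n k N v₀ g a b T : ℝ) - (c / D) * (∏ p : Pairs k, (b p - a p)) * T ^ E =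
      (D * NcountCong n k N v₀ g a b T - c * (∏ p, (b p - a p)) * T ^ E) / D := by
    field_simp
  rw [e, abs_div, abs_of_pos hD0]
  exact (div_le_self (abs_nonneg _) hN1).trans (h2.trans (mul_le_mul_of_nonneg_left hle hC.le))

theorem stmt5 (n k : ℕ) (hk : 2 ≤ k) (hnk : k^2 + 3 ≤ 2*n)
    (N : ℕ) (hN : 0 < N) (v₀ : Fin (2*n) → ℤ)
    (hgcd : Int.gcd (Finset.univ.gcd v₀) (N : ℤ) = 1) :
    ∃ δ0 ∈ Set.Ioo (0:ℝ) 1, ∃ c : SL2n n → ℝ,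
      ∀ δ ∈ Set.Ioo δ0 (1:ℝ), ∀ a b : Pairs k → ℝ, (∀ p, a p < b p) →
        ∀ μ : Measure (SL2n n), μ.IsHaarMeasure →
          ∀ᵐ g ∂μ, 0 < c g ∧
            (∃ C > (0:ℝ), ∃ T0 > (0:ℝ), ∀ T > T0,
              |(Ncount n k g a b T : ℝ)
                - c g * (∏ p : Pairs k, (b p - a p)) * T ^ expo n k|
                ≤ C * T ^ (δ * expo n k)) ∧
            (∃ C > (0:ℝ), ∃ T0 > (0:ℝ), ∀ T > T0,
              |(NcountCong n k N v₀ g a b T : ℝ)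
                - (c g / (N : ℝ) ^ (2*n*k)) * (∏ p : Pairs k, (b p - a p)) * T ^ expo n k|
                ≤ C * T ^ (δ * expo n k)) := by
  classical
  have hk1 : 1 ≤ k := by omega
  obtain ⟨m, rfl⟩ : ∃ m, k = m + 1 := ⟨k - 1, by omega⟩
  have hn : 0 < n := by nlinarith
  have hle : (m + 1) * (m + 1 - 1) < 2 * n * (m + 1) := by
    rw [Nat.add_sub_cancel]
    nlinarith
  have h4 : 4 * (m + 1) ≤ 2 * n + 1 := by
    have : 4 * (m + 1) ≤ (m + 1) ^ 2 + 4 := by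
      zify
      nlinarith [sq_nonneg ((m : ℤ) - 1)]
    omega
  set k := m + 1 with hkm
  obtain ⟨E, hE, hE0⟩ : ∃ E : ℕ, 2 * n * k = E + k * (k - 1) ∧ 0 < E :=
    ⟨2 * n * k - k * (k - 1), by omega, by omega⟩
  have hexp : expo n k = E := by
    rw [expo, hE]; push_cast; ring
  have hM : (1 : ℝ) ≤ ME k := by exact_mod_cast ME_pos k
  have hM2 : (2 : ℝ) ≤ ME k := by
    have : 2 ≤ ME k := by
      have h1 : 6 * 1 ≤ ME k := Nat.mul_le_mul (by omega) (by unfold mE; omega)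
      omega
    exact_mod_cast this
  have hE1 : (1 : ℝ) ≤ E := by exact_mod_cast hE0
  have hME : (2 : ℝ) ≤ (ME k : ℝ) * E := by nlinarith
  refine ⟨1 - 1 / ((ME k : ℝ) * E), ⟨?_, ?_⟩,
    fun g => if h : ∃ c, 0 < c ∧ Pg n k 1 0 E g c ∧ Pg n k N v₀ E g c then h.choose else 1, ?_⟩
  · have : 1 / ((ME k : ℝ) * E) ≤ 1 / 2 := one_div_le_one_div_of_le two_pos hME
    linarith
  · have : 0 < 1 / ((ME k : ℝ) * E) := by positivity
    linarith
  intro δ hδ a b hab μ hμ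
  have hmain := main_ae (d := 2 * n) (E := E) hk1 h4 (by rw [two_card]; exact hE) N hN v₀
  obtain ⟨lam, hlam, hae⟩ := transfer_ae n hn _ hmain μ hμ
  filter_upwards [hae] with g hg
  obtain ⟨X, ⟨c, hc1, hc2⟩, hX⟩ := hg
  have hcp : 0 < c := Asy_pos hE X c hc1
  have hex : ∃ c, 0 < c ∧ Pg n k 1 0 E g c ∧ Pg n k N v₀ E g c :=
    ⟨c / lam ^ Fintype.card (Pairs k), by positivity, Pg_of n k 1 0 E g X lam hlam hX c hc1,
      Pg_of n k N v₀ E g X lam hlam hX c hc2⟩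
  rw [dif_pos hex]
  obtain ⟨h0, h1, h2⟩ := hex.choose_spec
  refine ⟨h0, ?_, fin_bd n k N hN v₀ E g _ h2 hE0 hexp δ hδ.1 a b hab⟩
  have h3 := fin_bd n k 1 one_pos 0 E g _ h1 hE0 hexp δ hδ.1 a b hab
  simp only [Nat.cast_one, one_pow, div_one] at h3
  simp only [N_eq]
  exact h3
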